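/- There exists an absolute constant c > 0 such that for every prime p and every set A ⊆ F_p² satisfying 4p < |A| < p^{5/4}, the pinned distance count satisfies Δ_pin(A) ≥ c·|A|^{4/3}·p^{−2/3}. -/

import Mathlib

namespace Stmt2

/-- The (algebraic) squared distance in the plane `F²`. -/
def dist2 {F : Type*} [CommRing F] (x y : F × F) : F :=
  (x.1 - y.1) ^ 2 + (x.2 - y.2) ^ 2

/-- `Δ(A;x)`, the number of distances from the pin `x` to points of `A`. -/
noncomputable def pinnedCount {F : Type*} [CommRing F] (A : Finset (F × F)) (x : F × F) : ℕ :=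
  Set.ncard ((fun a => dist2 a x) '' (A : Set (F × F)))

/-- `Δ_pin(A) = max_{x ∈ A} Δ(A;x)`. -/
noncomputable def pinnedMax {F : Type*} [CommRing F] (A : Finset (F × F)) : ℕ :=
  A.sup (fun x => pinnedCount A x)

open MvPolynomial in
theorem degreeOf_det_le {K σ m : Type*} [CommRing K] [Fintype m] [DecidableEq m]
    (M : Matrix m m (MvPolynomial σ K)) (i : σ) (d : m → ℕ)
    (h : ∀ a b, degreeOf i (M a b) ≤ d b) : degreeOf i M.det ≤ ∑ b, d b := by
  rw [Matrix.det_apply']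
  refine (degreeOf_sum_le _ _ _).trans (Finset.sup_le fun s _ => ?_)
  refine (degreeOf_mul_le _ _ _).trans ?_
  have h0 : degreeOf i (((Equiv.Perm.sign s : ℤ) : MvPolynomial σ K)) = 0 := by
    rw [← map_intCast (C : K →+* MvPolynomial σ K), degreeOf_C]
  rw [h0, zero_add]
  exact (degreeOf_prod_le _ _ _).trans (Finset.sum_le_sum fun b _ => h _ _)

open MvPolynomial in
theorem degreeOf_resultant_le {K σ : Type*} [CommRing K] (f g : Polynomial (MvPolynomial σ K))
    (m n : ℕ) (i : σ) (df dg : ℕ) (hf : ∀ k, degreeOf i (f.coeff k) ≤ df)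
    (hg : ∀ k, degreeOf i (g.coeff k) ≤ dg) :
    degreeOf i (Polynomial.resultant f g m n) ≤ m * dg + n * df := by
  have := degreeOf_det_le (Polynomial.sylvester f g m n) i
    (Fin.addCases (fun _ => dg) (fun _ => df)) (by
      intro a b
      induction b using Fin.addCases <;> simp only [Polynomial.sylvester, Matrix.of_apply,
        Fin.addCases_left, Fin.addCases_right] <;> split_ifs <;> simp [hf, hg])
  refine this.trans (le_of_eq ?_)
  simp [Fin.sum_univ_add]

open MvPolynomial in
theorem card_le_degreeOf_zero {K : Type*} [Field K] {n : ℕ} {r : MvPolynomial (Fin (n + 1)) K}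
    (hr : r ≠ 0) (S : Finset K) (hS : ∀ t ∈ S, (finSuccEquiv K n r).eval (C t) = 0) :
    S.card ≤ degreeOf 0 r := by
  classical
  rw [← natDegree_finSuccEquiv]
  have h0 : finSuccEquiv K n r ≠ 0 := by simpa using hr
  rw [← Finset.card_image_of_injective S (C_injective (Fin n) K)]
  refine Polynomial.card_le_degree_of_subset_roots (p := finSuccEquiv K n r) fun x hx => ?_
  simp only [Finset.image_val, Multiset.mem_dedup, Multiset.mem_map, Finset.mem_val] at hx
  obtain ⟨t, ht, rfl⟩ := hx
  exact (Polynomial.mem_roots h0).2 (hS t ht)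

/-- Restriction of `f(z, y, x)` to the line `y = l`, `z = u + w x`. -/
noncomputable def evL {K : Type*} [Field K] (u w l : K) :
    MvPolynomial (Fin 3) K →ₐ[K] Polynomial K :=
  MvPolynomial.aeval ![Polynomial.C u + Polynomial.C w * Polynomial.X, Polynomial.C l, Polynomial.X]

/-- Restriction of `f(z, y, x)` to the line `x = l`, `z = u + w y`. -/
noncomputable def evM {K : Type*} [Field K] (u w l : K) :
    MvPolynomial (Fin 3) K →ₐ[K] Polynomial K :=
  MvPolynomial.aeval ![Polynomial.C u + Polynomial.C w * Polynomial.X, Polynomial.X, Polynomial.C l]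

theorem evL_eq_eval₂ {K : Type*} [Field K] (u w l : K) (f : MvPolynomial (Fin 3) K) :
    evL u w l f = (MvPolynomial.finSuccEquiv K 2 f).eval₂
      (MvPolynomial.aeval ![Polynomial.C l, Polynomial.X] :
        MvPolynomial (Fin 2) K →ₐ[K] Polynomial K).toRingHom
      (Polynomial.C u + Polynomial.C w * Polynomial.X) := by
  let ψ : MvPolynomial (Fin 2) K →ₐ[K] Polynomial K :=
    MvPolynomial.aeval ![Polynomial.C l, Polynomial.X]
  have h : (evL u w l).toRingHom = (Polynomial.eval₂RingHom ψ.toRingHom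
      (Polynomial.C u + Polynomial.C w * Polynomial.X)).comp
      (MvPolynomial.finSuccEquiv K 2).toRingEquiv.toRingHom := by
    apply MvPolynomial.ringHom_ext
    · intro a
      simp [evL, MvPolynomial.finSuccEquiv_apply, ψ]
    · have h0 : MvPolynomial.finSuccEquiv K 2 (MvPolynomial.X 0) = Polynomial.X :=
        MvPolynomial.finSuccEquiv_X_zero
      have h1 : MvPolynomial.finSuccEquiv K 2 (MvPolynomial.X 1) =
        Polynomial.C (MvPolynomial.X 0) := MvPolynomial.finSuccEquiv_X_succ (j := 0)
      have h2 : MvPolynomial.finSuccEquiv K 2 (MvPolynomial.X 2) =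
        Polynomial.C (MvPolynomial.X 1) := MvPolynomial.finSuccEquiv_X_succ (j := 1)
      intro i
      fin_cases i <;> simp [evL, ψ, h0, h1, h2]
  exact congrArg (fun φ => φ f) h

theorem eval_finSuccEquiv_eq_zero {K : Type*} [Field K] (l : K) (r : MvPolynomial (Fin 2) K)
    (h : (MvPolynomial.aeval ![Polynomial.C l, Polynomial.X] :
        MvPolynomial (Fin 2) K →ₐ[K] Polynomial K) r = 0) :
    (MvPolynomial.finSuccEquiv K 1 r).eval (MvPolynomial.C l) = 0 := by
  have h1 : (Polynomial.aeval (MvPolynomial.X 0 : MvPolynomial (Fin 1) K)).toRingHom.comp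
      (MvPolynomial.aeval ![Polynomial.C l, Polynomial.X] :
        MvPolynomial (Fin 2) K →ₐ[K] Polynomial K).toRingHom =
      (Polynomial.evalRingHom (MvPolynomial.C l)).comp
        (MvPolynomial.finSuccEquiv K 1).toRingEquiv.toRingHom := by
    apply MvPolynomial.ringHom_ext
    · intro a
      simp [MvPolynomial.finSuccEquiv_apply, MvPolynomial.algebraMap_eq]
    · have h0 : MvPolynomial.finSuccEquiv K 1 (MvPolynomial.X 0) = Polynomial.X :=
        MvPolynomial.finSuccEquiv_X_zero
      have h1 : MvPolynomial.finSuccEquiv K 1 (MvPolynomial.X 1) =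
        Polynomial.C (MvPolynomial.X 0) := MvPolynomial.finSuccEquiv_X_succ (j := 0)
      intro i
      fin_cases i <;> simp [MvPolynomial.algebraMap_eq, h0, h1]
  have h2 := congrArg (fun φ => φ r) h1
  simp only [AlgHom.toRingHom_eq_coe, RingHom.comp_apply, RingHom.coe_coe, h, map_zero] at h2
  exact h2.symm

open MvPolynomial in
theorem card_lines_le_of_not_dvd {K ι : Type*} [Field K] {u w l : ι → K}
    (hl : Function.Injective l) {g h : MvPolynomial (Fin 3) K} (hg : Irreducible g)
    (hz : degreeOf 0 g ≠ 0) (hgh : ¬ g ∣ h) (L : Finset ι)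
    (hL : ∀ i ∈ L, evL (u i) (w i) (l i) g = 0 ∧ evL (u i) (w i) (l i) h = 0) :
    L.card ≤ degreeOf 0 g * degreeOf 1 h + degreeOf 0 h * degreeOf 1 g := by
  classical
  let R := MvPolynomial (Fin 2) K
  let e := finSuccEquiv K 2
  have hnd : (e g).natDegree ≠ 0 := by rwa [natDegree_finSuccEquiv]
  have hirr : Irreducible (e g) := (MulEquiv.irreducible_iff e.toMulEquiv).2 hg
  have hprim := hirr.isPrimitive hnd
  have hirr' := (hprim.irreducible_iff_irreducible_map_fraction_map
    (K := FractionRing R)).1 hirr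
  have hnd' : ¬ (e g).map (algebraMap R (FractionRing R)) ∣
      (e h).map (algebraMap R (FractionRing R)) := fun H =>
    hgh (by
      have := hprim.dvd_of_fraction_map_dvd_fraction_map H
      exact (map_dvd_iff e).1 this)
  have hcop := (hirr'.coprime_iff_not_dvd).2 hnd'
  set r : R := Polynomial.resultant (e g) (e h) with hr
  have hr0 : r ≠ 0 := by
    intro h0
    have h1 : Polynomial.resultant ((e g).map (algebraMap R (FractionRing R)))
        ((e h).map (algebraMap R (FractionRing R))) (e g).natDegree (e h).natDegree = 0 := by
      rw [Polynomial.resultant_map_map, ← hr, h0, map_zero]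
    have hinj := IsFractionRing.injective R (FractionRing R)
    rw [← Polynomial.natDegree_map_eq_of_injective hinj (e g),
      ← Polynomial.natDegree_map_eq_of_injective hinj (e h), Polynomial.resultant_eq_zero_iff] at h1
    exact h1.2 hcop
  obtain ⟨P, Q, -, -, hPQ⟩ := Polynomial.exists_mul_add_mul_eq_C_resultant (e g) (e h) le_rfl le_rfl
    (Or.inl hnd)
  have hdeg : degreeOf 0 r ≤ degreeOf 0 g * degreeOf 1 h + degreeOf 0 h * degreeOf 1 g := by
    have := degreeOf_resultant_le (e g) (e h) (e g).natDegree (e h).natDegree 0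
      (degreeOf 1 g) (degreeOf 1 h) (fun k => degreeOf_coeff_finSuccEquiv g 0 k)
      (fun k => degreeOf_coeff_finSuccEquiv h 0 k)
    rwa [← natDegree_finSuccEquiv g, ← natDegree_finSuccEquiv h]
  rw [← Finset.card_image_of_injective L hl]
  refine le_trans (card_le_degreeOf_zero hr0 _ fun t ht => ?_) hdeg
  obtain ⟨i, hi, rfl⟩ := Finset.mem_image.1 ht
  apply eval_finSuccEquiv_eq_zero
  obtain ⟨h1, h2⟩ := hL i hi
  rw [evL_eq_eval₂] at h1 h2
  have := congrArg (Polynomial.eval₂ (aeval ![Polynomial.C (l i), Polynomial.X] :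
        MvPolynomial (Fin 2) K →ₐ[K] Polynomial K).toRingHom
      (Polynomial.C (u i) + Polynomial.C (w i) * Polynomial.X)) hPQ
  rw [Polynomial.eval₂_add, Polynomial.eval₂_mul, Polynomial.eval₂_mul, h1, h2,
    Polynomial.eval₂_C] at this
  simpa using this.symm

section

/-- The derivation acting on the coefficients of a polynomial. -/
noncomputable def coeffDerivation {K A : Type*} [CommRing K] [CommRing A] [Algebra K A]
    (D : Derivation K A A) : Derivation K (Polynomial A) (Polynomial A) :=
  (PolynomialModule.equivPolynomialSelf (R := A)).toLinearMap.compDer D.mapCoeffs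

theorem coeff_coeffDerivation {K A : Type*} [CommRing K] [CommRing A] [Algebra K A]
    (D : Derivation K A A) (q : Polynomial A) (i : ℕ) :
    (coeffDerivation D q).coeff i = D (q.coeff i) := rfl

theorem coeffDerivation_C {K A : Type*} [CommRing K] [CommRing A] [Algebra K A]
    (D : Derivation K A A) (a : A) :
    coeffDerivation D (Polynomial.C a) = Polynomial.C (D a) := by
  ext i
  rw [coeff_coeffDerivation, Polynomial.coeff_C, Polynomial.coeff_C]
  split_ifs <;> simp

theorem coeffDerivation_X {K A : Type*} [CommRing K] [CommRing A] [Algebra K A]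
    (D : Derivation K A A) : coeffDerivation D (Polynomial.X : Polynomial A) = 0 := by
  ext i
  rw [coeff_coeffDerivation, Polynomial.coeff_X]
  split_ifs <;> simp

theorem derivation_aeval {K B σ : Type*} [Fintype σ] [CommRing K] [CommRing B] [Algebra K B]
    (D : Derivation K B B) (a : σ → B) (f : MvPolynomial σ K) :
    D (MvPolynomial.aeval a f) =
      ∑ i, MvPolynomial.aeval a (MvPolynomial.pderiv i f) * D (a i) := by
  classical
  induction f using MvPolynomial.induction_on with
  | C c => simp
  | add p q hp hq => simp [hp, hq, add_mul, Finset.sum_add_distrib]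
  | mul_X p j hp =>
    simp [Derivation.leibniz, hp, add_mul, Finset.sum_add_distrib, MvPolynomial.pderiv_X,
      Finset.mul_sum, Pi.single_apply, mul_assoc, apply_ite (MvPolynomial.aeval a)]

open MvPolynomial

/-- The numerator of the second derivative of `z` along `x`, for the surface `g(z, y, x) = 0`. -/
noncomputable def flex {K : Type*} [Field K] (g : MvPolynomial (Fin 3) K) :
    MvPolynomial (Fin 3) K :=
  pderiv 2 (pderiv 2 g) * pderiv 0 g ^ 2 - 2 * pderiv 2 (pderiv 0 g) * pderiv 2 g * pderiv 0 g
    + pderiv 0 (pderiv 0 g) * pderiv 2 g ^ 2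

theorem pderiv_pderiv_comm {K σ : Type*} [CommRing K] (i j : σ) (g : MvPolynomial σ K) :
    pderiv i (pderiv j g) = pderiv j (pderiv i g) := by
  have : ⁅(pderiv i : Derivation K (MvPolynomial σ K) (MvPolynomial σ K)),
      (pderiv j : Derivation K (MvPolynomial σ K) (MvPolynomial σ K))⁆ = 0 := by
    apply MvPolynomial.derivation_ext
    intro k
    classical
    rw [Derivation.commutator_apply, pderiv_X, pderiv_X, Pi.single_apply, Pi.single_apply]
    split_ifs <;> simp
  have h := congrArg (fun d => d g) this
  simpa [Derivation.commutator_apply, sub_eq_zero] using h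

theorem evL_flex {K : Type*} [Field K] {u w l : K} {g : MvPolynomial (Fin 3) K}
    (h : evL u w l g = 0) : evL u w l (flex g) = 0 := by
  have key : ∀ f, Polynomial.derivative (evL u w l f) =
      evL u w l (pderiv 0 f) * Polynomial.C w + evL u w l (pderiv 2 f) := by
    intro f
    have := derivation_aeval (Polynomial.derivative' (R := K))
      ![Polynomial.C u + Polynomial.C w * Polynomial.X, Polynomial.C l, Polynomial.X] f
    simpa [Fin.sum_univ_three, Polynomial.derivative', evL] using this
  have h1 := key g
  have h2 := key (pderiv 0 g)
  have h3 := key (pderiv 2 g)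
  rw [h, Polynomial.derivative_zero] at h1
  have h4 : evL u w l (pderiv 2 g) = - (evL u w l (pderiv 0 g) * Polynomial.C w) := by
    linear_combination -h1
  rw [h4, Polynomial.derivative_neg, Polynomial.derivative_mul, h2,
    pderiv_pderiv_comm 0 2] at h3
  simp only [Polynomial.derivative_C, mul_zero, add_zero] at h3
  simp only [flex, map_add, map_sub, map_mul, map_pow, map_ofNat, h4]
  linear_combination -(evL u w l (pderiv 0 g))^2 * h3

theorem degreeOf_pderiv_le {K σ : Type*} [CommRing K] (i j : σ) (g : MvPolynomial σ K) :
    degreeOf j (pderiv i g) ≤ degreeOf j g := by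
  classical
  conv_lhs => rw [g.as_sum, map_sum]
  refine (degreeOf_sum_le _ _ _).trans (Finset.sup_le fun m hm => ?_)
  rw [pderiv_monomial]
  by_cases h : coeff m g * (m i : K) = 0
  · simp [h]
  rw [degreeOf_monomial_eq _ _ h]
  refine le_trans ?_ (monomial_le_degreeOf j hm)
  simp

theorem degreeOf_flex_le {K : Type*} [Field K] (j : Fin 3) (g : MvPolynomial (Fin 3) K) :
    degreeOf j (flex g) ≤ 3 * degreeOf j g := by
  have h1 : ∀ i, degreeOf j (pderiv i g) ≤ degreeOf j g := fun i => degreeOf_pderiv_le i j g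
  have h2 : ∀ i k, degreeOf j (pderiv k (pderiv i g)) ≤ degreeOf j g := fun i k =>
    (degreeOf_pderiv_le k j _).trans (h1 i)
  have hsq : ∀ i, degreeOf j (pderiv i g ^ 2) ≤ 2 * degreeOf j g := fun i =>
    (degreeOf_pow_le _ _ _).trans (Nat.mul_le_mul_left _ (h1 i))
  have htwo : degreeOf j (2 : MvPolynomial (Fin 3) K) = 0 := by
    rw [← map_ofNat (C : K →+* MvPolynomial (Fin 3) K) 2, degreeOf_C]
  have A : degreeOf j (pderiv 2 (pderiv 2 g) * pderiv 0 g ^ 2) ≤ 3 * degreeOf j g := by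
    refine (degreeOf_mul_le _ _ _).trans ?_
    have := h2 2 2; have := hsq 0; omega
  have B : degreeOf j (2 * pderiv 2 (pderiv 0 g) * pderiv 2 g * pderiv 0 g) ≤
      3 * degreeOf j g := by
    refine (degreeOf_mul_le _ _ _).trans ?_
    have e1 := degreeOf_mul_le j (2 * pderiv 2 (pderiv 0 g)) (pderiv 2 g)
    have e2 := degreeOf_mul_le j 2 (pderiv 2 (pderiv 0 g))
    have := h2 0 2; have := h1 0; have := h1 2
    omega
  have C : degreeOf j (pderiv 0 (pderiv 0 g) * pderiv 2 g ^ 2) ≤ 3 * degreeOf j g := by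
    refine (degreeOf_mul_le _ _ _).trans ?_
    have := h2 0 0; have := hsq 2; omega
  unfold flex
  refine (degreeOf_add_le _ _ _).trans (max_le ?_ C)
  exact (degreeOf_sub_le _ _ _).trans (max_le A B)

theorem finSuccEquiv_pderiv_zero {K : Type*} [CommRing K] {n : ℕ}
    (g : MvPolynomial (Fin (n + 1)) K) :
    finSuccEquiv K n (pderiv 0 g) = Polynomial.derivative (finSuccEquiv K n g) := by
  induction g using MvPolynomial.induction_on with
  | C c => simp [finSuccEquiv_apply]
  | add p q hp hq => simp [hp, hq]
  | mul_X p j hp =>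
    refine Fin.cases ?_ (fun j => ?_) j
    · simp [Derivation.leibniz, hp, finSuccEquiv_X_zero]; ring
    · simp [Derivation.leibniz, hp, finSuccEquiv_X_succ, pderiv_X]; ring

theorem not_dvd_pderiv_zero {K : Type*} [Field K] (p : ℕ) [CharP K p] {n : ℕ}
    {g : MvPolynomial (Fin (n + 1)) K} (h0 : degreeOf 0 g ≠ 0) (hp : degreeOf 0 g < p) :
    ¬ g ∣ pderiv 0 g := by
  intro ⟨q, hq⟩
  have hnd := natDegree_finSuccEquiv g
  set f := finSuccEquiv K n g with hf
  have hf0 : f ≠ 0 := by rintro h; simp [h] at hnd; exact h0 hnd.symm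
  have e : Polynomial.derivative f = f * finSuccEquiv K n q := by
    rw [hf, ← finSuccEquiv_pderiv_zero, hq, map_mul]
  have hne : Polynomial.derivative f ≠ 0 := by
    intro h
    have h1 : (Polynomial.derivative f).coeff (f.natDegree - 1) = 0 := by rw [h]; simp
    rw [Polynomial.coeff_derivative, Nat.sub_add_cancel (by omega)] at h1
    rcases mul_eq_zero.1 h1 with h2 | h2
    · exact hf0 (Polynomial.leadingCoeff_eq_zero.1 h2)
    · have h3 : ((f.natDegree : ℕ) : MvPolynomial (Fin n) K) = 0 := by
        rw [← h2]; rw [← Nat.cast_succ, Nat.succ_eq_add_one, Nat.sub_add_cancel (by omega)]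
      have := (CharP.cast_eq_zero_iff (MvPolynomial (Fin n) K) p _).1 h3
      have := Nat.le_of_dvd (by omega) this
      omega
  have hq0 : finSuccEquiv K n q ≠ 0 := by
    intro h; rw [h, mul_zero] at e; exact hne e
  have h4 := Polynomial.natDegree_derivative_lt (p := f) (by omega)
  rw [e, Polynomial.natDegree_mul hf0 hq0] at h4
  omega

theorem natDegree_aeval_le {K A σ : Type*} [Fintype σ] [CommRing K] [CommRing A] [Algebra K A]
    (a : σ → Polynomial A) (d : σ → ℕ) (ha : ∀ i, (a i).natDegree ≤ d i) (f : MvPolynomial σ K) :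
    (aeval a f).natDegree ≤ ∑ i, degreeOf i f * d i := by
  rw [aeval_def, eval₂_eq']
  refine Polynomial.natDegree_sum_le_of_forall_le _ _ fun m hm => ?_
  rw [IsScalarTower.algebraMap_apply K A (Polynomial A), Polynomial.algebraMap_eq]
  refine (Polynomial.natDegree_C_mul_le _ _).trans ((Polynomial.natDegree_prod_le _ _).trans ?_)
  refine Finset.sum_le_sum fun i _ => Polynomial.natDegree_pow_le.trans ?_
  exact Nat.mul_le_mul (monomial_le_degreeOf i hm) (ha i)

theorem natDegree_C_add_X_mul_C_le {A : Type*} [CommRing A] (a b : A) :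
    (Polynomial.C a + Polynomial.X * Polynomial.C b).natDegree ≤ 1 := by
  compute_degree

theorem natDegree_C_sub_X_mul_C_le {A : Type*} [CommRing A] (a b : A) :
    (Polynomial.C a - Polynomial.X * Polynomial.C b).natDegree ≤ 1 := by
  compute_degree

/-- The restriction of `g` to the tangent direction of the surface with `y` fixed. -/
noncomputable def tangentPoly {K : Type*} [Field K] (g : MvPolynomial (Fin 3) K) :
    Polynomial (MvPolynomial (Fin 3) K) :=
  aeval ![Polynomial.C (X 0) - Polynomial.X * Polynomial.C (pderiv 2 g), Polynomial.C (X 1),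
    Polynomial.C (X 2) + Polynomial.X * Polynomial.C (pderiv 0 g)] g

theorem dvd_coeff_tangentPoly {K : Type*} [Field K] (p : ℕ) [CharP K p]
    {g : MvPolynomial (Fin 3) K} (hg : Irreducible g) (h0 : degreeOf 0 g ≠ 0)
    (hp : degreeOf 0 g + degreeOf 2 g < p) (hF : g ∣ flex g) (m : ℕ) :
    g ∣ (tangentPoly g).coeff m := by
  set v : Fin 3 → Polynomial (MvPolynomial (Fin 3) K) :=
    ![Polynomial.C (X 0) - Polynomial.X * Polynomial.C (pderiv 2 g), Polynomial.C (X 1),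
    Polynomial.C (X 2) + Polynomial.X * Polynomial.C (pderiv 0 g)] with hv
  let D : Derivation K (MvPolynomial (Fin 3) K) (MvPolynomial (Fin 3) K) :=
    pderiv 0 g • pderiv 2 - pderiv 2 g • pderiv 0
  have hD : ∀ f, D f = pderiv 0 g * pderiv 2 f - pderiv 2 g * pderiv 0 f := fun f => by
    simp [D]
  have e1 := derivation_aeval (coeffDerivation D) v g
  have e2 := derivation_aeval
    ((Polynomial.derivative' (R := MvPolynomial (Fin 3) K)).restrictScalars K) v g
  have hX02 : D (X 0) = - pderiv 2 g := by simp [hD, pderiv_X]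
  have hX2 : D (X 2) = pderiv 0 g := by simp [hD, pderiv_X]
  have hX1 : D (X 1) = 0 := by simp [hD, pderiv_X]
  have key : Polynomial.C (pderiv 0 g) * coeffDerivation D (tangentPoly g) =
      (Polynomial.C (pderiv 0 g) + Polynomial.X * Polynomial.C (D (pderiv 0 g))) *
        Polynomial.derivative (tangentPoly g) -
      Polynomial.X * aeval v (pderiv 0 g) * Polynomial.C (flex g) := by
    have e3 : Polynomial.derivative (aeval v g) = ∑ i, aeval v (pderiv i g) *
      Polynomial.derivative (v i) := by
      simpa only [Derivation.restrictScalars_apply, Polynomial.derivative'_apply] using e2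
    have e4 : Polynomial.C (flex g) = Polynomial.C (pderiv 0 g) * Polynomial.C (D (pderiv 2 g)) -
        Polynomial.C (pderiv 2 g) * Polynomial.C (D (pderiv 0 g)) := by
      rw [← Polynomial.C_mul, ← Polynomial.C_mul, ← Polynomial.C_sub]
      refine congrArg Polynomial.C ?_
      rw [hD, hD, flex, pderiv_pderiv_comm 0 2]
      ring
    have d0 : coeffDerivation D (v 0) = - Polynomial.C (pderiv 2 g) -
        Polynomial.X * Polynomial.C (D (pderiv 2 g)) := by
      simp [hv, coeffDerivation_C, coeffDerivation_X, hX02]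
    have d1 : coeffDerivation D (v 1) = 0 := by
      simp [hv, coeffDerivation_C, hX1]
    have d2 : coeffDerivation D (v 2) = Polynomial.C (pderiv 0 g) +
        Polynomial.X * Polynomial.C (D (pderiv 0 g)) := by
      simp [hv, coeffDerivation_C, coeffDerivation_X, hX2]
    have t0 : Polynomial.derivative (v 0) = - Polynomial.C (pderiv 2 g) := by simp [hv]
    have t1 : Polynomial.derivative (v 1) = 0 := by simp [hv]
    have t2 : Polynomial.derivative (v 2) = Polynomial.C (pderiv 0 g) := by simp [hv]
    rw [tangentPoly, ← hv, e3, e4, e1, Fin.sum_univ_three, Fin.sum_univ_three,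
      d0, d1, d2, t0, t1, t2]
    generalize aeval v (pderiv 0 g) = a
    generalize aeval v (pderiv 2 g) = b
    generalize Polynomial.C (pderiv 0 g) = c
    generalize Polynomial.C (pderiv 2 g) = d
    ring
  have hdeg : (tangentPoly g).natDegree < p := by
    refine lt_of_le_of_lt (natDegree_aeval_le v ![1, 0, 1] ?_ g) ?_
    · intro i
      fin_cases i
      · exact natDegree_C_sub_X_mul_C_le _ _
      · exact (Polynomial.natDegree_C _).le
      · exact natDegree_C_add_X_mul_C_le _ _
    · simpa [Fin.sum_univ_three] using hp
  have hgz : ¬ g ∣ pderiv 0 g := not_dvd_pderiv_zero p h0 (by omega)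
  have hprime := hg.prime
  induction m with
  | zero =>
    have : (tangentPoly g).coeff 0 = g := by
      have h : ((Polynomial.constantCoeff (R := MvPolynomial (Fin 3) K)).comp
        (aeval v).toRingHom) = RingHom.id _ := by
        apply MvPolynomial.ringHom_ext
        · intro c; simp [MvPolynomial.algebraMap_eq]
        · intro i; fin_cases i <;> simp [hv]
      exact congrArg (fun φ => φ g) h
    rw [this]
  | succ m ih =>
    obtain ⟨q, hq⟩ := ih
    by_cases hm : (tangentPoly g).natDegree < m + 1
    · rw [Polynomial.coeff_eq_zero_of_natDegree_lt hm]; exact dvd_zero _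
    have hk := congrArg (fun f => f.coeff m) key
    have hder : ∀ f : Polynomial (MvPolynomial (Fin 3) K),
        ((Polynomial.C (pderiv 0 g) + Polynomial.X * Polynomial.C (D (pderiv 0 g))) *
        Polynomial.derivative f).coeff m = pderiv 0 g * (f.coeff (m + 1) * (m + 1)) +
        D (pderiv 0 g) * (f.coeff m * m) := by
      intro f
      rw [add_mul, Polynomial.coeff_add, Polynomial.coeff_C_mul, Polynomial.coeff_derivative,
        mul_assoc]
      cases m with
      | zero => simp
      | succ m => simp [Polynomial.coeff_X_mul, Polynomial.coeff_derivative]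
    simp only [Polynomial.coeff_C_mul, Polynomial.coeff_sub, hder, coeff_coeffDerivation,
      Polynomial.coeff_mul_C, hq, Derivation.leibniz, smul_eq_mul] at hk
    obtain ⟨f', hf'⟩ := hF
    have hDg : D g = 0 := by rw [hD]; ring
    have hdvd : g ∣ pderiv 0 g * ((tangentPoly g).coeff (m + 1) * (m + 1)) := by
      rw [hDg, hf'] at hk
      refine ⟨pderiv 0 g * D q - D (pderiv 0 g) * (q * m) +
        (Polynomial.X * aeval v (pderiv 0 g)).coeff m * f', ?_⟩
      linear_combination -hk
    rcases (hprime.dvd_or_dvd hdvd).resolve_left hgz |> hprime.dvd_or_dvd with h | h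
    · exact h
    · exfalso
      have hne : ((m + 1 : ℕ) : K) ≠ 0 := by
        rw [Ne, CharP.cast_eq_zero_iff K p]
        intro h'; have := Nat.le_of_dvd (by omega) h'; omega
      have hu : IsUnit ((m : MvPolynomial (Fin 3) K) + 1) := by
        have := (IsUnit.mk0 _ hne).map (C : K →+* MvPolynomial (Fin 3) K)
        simpa using this
      exact hprime.not_isUnit (isUnit_of_dvd_unit h hu)

theorem add_mul_ne_one_of_isIntegral {S E T : Type*} [CommRing S] [Field E]
    [Algebra S E] [FaithfulSMul S E] [CommRing T] [IsDomain T] (ev : S →+* T) {s a b : S}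
    {α β : E} (hs : ev s ≠ 0) (ha : ev a = 0) (hb : ev b = 0)
    (hα : IsIntegral S (algebraMap S E s * α)) (hβ : IsIntegral S (algebraMap S E s * β)) :
    algebraMap S E a * α + algebraMap S E b * β ≠ 1 := by
  intro h
  let S' := integralClosure S E
  have hinj : Function.Injective (algebraMap S S') := by
    intro x y hxy
    have := congrArg (algebraMap S' E) hxy
    rw [← IsScalarTower.algebraMap_apply, ← IsScalarTower.algebraMap_apply] at this
    exact FaithfulSMul.algebraMap_injective S E this
  have : (RingHom.ker ev).IsPrime := RingHom.ker_isPrime ev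
  obtain ⟨Q, -, hQ, hQP⟩ := Ideal.exists_ideal_over_prime_of_isIntegral (S := S') (RingHom.ker ev) ⊥
    (by
      intro x hx
      have : algebraMap S S' x = 0 := by simpa using hx
      have hx0 : x = 0 := hinj (by simpa using this)
      simp [hx0])
  have hmem : ∀ x : S, algebraMap S S' x ∈ Q ↔ ev x = 0 := fun x => by
    rw [← Ideal.mem_comap, hQP, RingHom.mem_ker]
  apply hs
  rw [← hmem]
  have : algebraMap S S' s = algebraMap S S' a * ⟨_, hα⟩ + algebraMap S S' b * ⟨_, hβ⟩ := by
    apply Subtype.ext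
    show algebraMap S E s = algebraMap S E a * (algebraMap S E s * α) +
      algebraMap S E b * (algebraMap S E s * β)
    linear_combination -(algebraMap S E s) * h
  rw [this]
  exact Q.add_mem (Q.mul_mem_right _ ((hmem a).2 ha)) (Q.mul_mem_right _ ((hmem b).2 hb))

/-- The substitution `x = c`. -/
noncomputable def substX {K : Type*} [Field K] (c : K) :
    MvPolynomial (Fin 3) K →ₐ[K] Polynomial (Polynomial K) :=
  aeval ![Polynomial.X, Polynomial.C Polynomial.X, Polynomial.C (Polynomial.C c)]

theorem substX_ne_zero {K : Type*} [Field K] (c : K) {g : MvPolynomial (Fin 3) K}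
    (hg : Irreducible g) (h0 : degreeOf 0 g ≠ 0) : substX c g ≠ 0 := by
  intro h
  let I : Ideal (MvPolynomial (Fin 3) K) := Ideal.span {X 2 - C c}
  have hh : (Polynomial.eval₂RingHom (Polynomial.eval₂RingHom ((Ideal.Quotient.mk I).comp C)
      (Ideal.Quotient.mk I (X 1))) (Ideal.Quotient.mk I (X 0))).comp (substX c).toRingHom
      = Ideal.Quotient.mk I := by
    apply MvPolynomial.ringHom_ext
    · intro a
      simp [substX]
    · intro i
      fin_cases i
      · simp [substX]
      · simp [substX]
      · simp only [substX, Fin.reduceFinMk, AlgHom.toRingHom_eq_coe, RingHom.comp_apply,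
          RingHom.coe_coe, aeval_X, Matrix.cons_val, Polynomial.coe_eval₂RingHom,
          Polynomial.eval₂_C]
        rw [eq_comm, Ideal.Quotient.eq]
        exact Ideal.subset_span rfl
  have h1 := congrArg (fun φ => φ g) hh
  simp only [AlgHom.toRingHom_eq_coe, RingHom.comp_apply, RingHom.coe_coe, h, map_zero] at h1
  rw [eq_comm, Ideal.Quotient.eq_zero_iff_mem, Ideal.mem_span_singleton] at h1
  obtain ⟨q, hq⟩ := h1
  have hd : degreeOf 0 (X 2 - C c : MvPolynomial (Fin 3) K) = 0 := by
    refine Nat.le_zero.1 ((degreeOf_sub_le _ _ _).trans ?_)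
    simp [degreeOf_X]
  rcases hg.isUnit_or_isUnit hq with hu | hu
  · have := hu.map (aeval ![0, 0, c] : MvPolynomial (Fin 3) K →ₐ[K] K)
    simp at this
  · obtain ⟨r, hr, hrq⟩ := MvPolynomial.isUnit_iff_eq_C_of_isReduced.1 hu
    apply h0
    rw [hq, hrq]
    refine Nat.le_zero.1 ((degreeOf_mul_le _ _ _).trans ?_)
    simp [hd]

theorem aeval_ruling_eq_zero {K E : Type*} [Field K] [Field E] [Algebra K E]
    {g : MvPolynomial (Fin 3) K} (hg : ∀ m, g ∣ (tangentPoly g).coeff m)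
    (π : MvPolynomial (Fin 3) K →ₐ[K] E) (hπ : π g = 0) {w : E}
    (hw : w * π (pderiv 0 g) = -π (pderiv 2 g)) (h0 : π (pderiv 0 g) ≠ 0) (c : E) :
    aeval ![π (X 0) - w * π (X 2) + w * c, π (X 1), c] g = 0 := by
  set t := (c - π (X 2)) / π (pderiv 0 g) with ht
  have htm : t * π (pderiv 0 g) = c - π (X 2) := div_mul_cancel₀ _ h0
  have h1 : (tangentPoly g).eval₂ π.toRingHom t = 0 := by
    rw [Polynomial.eval₂_eq_sum_range]
    refine Finset.sum_eq_zero fun m _ => ?_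
    obtain ⟨q, hq⟩ := hg m
    rw [hq]
    simp [hπ]
  have h2 : (Polynomial.eval₂RingHom π.toRingHom t).comp
      (aeval ![Polynomial.C (X 0) - Polynomial.X * Polynomial.C (pderiv 2 g), Polynomial.C (X 1),
        Polynomial.C (X 2) + Polynomial.X * Polynomial.C (pderiv 0 g)] :
        MvPolynomial (Fin 3) K →ₐ[K] Polynomial (MvPolynomial (Fin 3) K)).toRingHom =
      (aeval ![π (X 0) - w * π (X 2) + w * c, π (X 1), c] :
        MvPolynomial (Fin 3) K →ₐ[K] E).toRingHom := by
    apply MvPolynomial.ringHom_ext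
    · intro a
      simp [IsScalarTower.algebraMap_apply K (MvPolynomial (Fin 3) K)
        (Polynomial (MvPolynomial (Fin 3) K)), Polynomial.algebraMap_eq, MvPolynomial.algebraMap_eq]
    · intro i
      fin_cases i
      · simp
        linear_combination -t * hw + w * htm
      · simp
      · simp
        linear_combination htm
  rw [← h1]
  exact (congrArg (fun φ => φ g) h2).symm

theorem ruling_parallel {K : Type*} [Field K] (p : ℕ) [CharP K p]
    {g : MvPolynomial (Fin 3) K} (hg : Irreducible g) (h0 : degreeOf 0 g ≠ 0)
    (hp : degreeOf 0 g + degreeOf 2 g < p) (hF : g ∣ flex g) {E : Type*} [Field E]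
    [Algebra (MvPolynomial (Fin 3) K ⧸ Ideal.span {g}) E]
    [FaithfulSMul (MvPolynomial (Fin 3) K ⧸ Ideal.span {g}) E] [Algebra K E]
    [IsScalarTower K (MvPolynomial (Fin 3) K ⧸ Ideal.span {g}) E] 
    (π : MvPolynomial (Fin 3) K →ₐ[K] E)
    (hπ : ∀ f, π f = algebraMap (MvPolynomial (Fin 3) K ⧸ Ideal.span {g}) E
      (Ideal.Quotient.mk _ f)) {w : E}
    (hw : w * π (pderiv 0 g) = -π (pderiv 2 g)) {u' w' l : K} (hl : evM u' w' l g = 0) :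
    π (X 0) - w * π (X 2) + w * algebraMap K E l = algebraMap K E u' +
      algebraMap K E w' * π (X 1) := by
  set S := MvPolynomial (Fin 3) K ⧸ Ideal.span {g}
  have hπ0 : ∀ f, π f = 0 ↔ g ∣ f := fun f => by
    rw [hπ, FaithfulSMul.algebraMap_eq_zero_iff, Ideal.Quotient.eq_zero_iff_mem,
      Ideal.mem_span_singleton]
  have hgz : π (pderiv 0 g) ≠ 0 := fun h =>
    not_dvd_pderiv_zero p h0 (by omega) ((hπ0 _).1 h)
  have hrul := aeval_ruling_eq_zero (dvd_coeff_tangentPoly p hg h0 hp hF) π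
    ((hπ0 g).2 dvd_rfl) hw hgz
  let _ : Algebra (Polynomial K) S :=
    (Polynomial.aeval (R := K) (Ideal.Quotient.mk (Ideal.span {g}) (X 1) : S)).toRingHom.toAlgebra
  let _ : Algebra (Polynomial K) E :=
    ((algebraMap S E).comp (algebraMap (Polynomial K) S)).toAlgebra
  have : IsScalarTower (Polynomial K) S E := IsScalarTower.of_algebraMap_eq fun _ => rfl
  have hKC : ∀ a : K, algebraMap (Polynomial K) E (Polynomial.C a) = algebraMap K E a := by
    intro a
    rw [IsScalarTower.algebraMap_apply (Polynomial K) S E,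
      IsScalarTower.algebraMap_apply K S E]
    congr 1
    show Polynomial.aeval _ (Polynomial.C a) = _
    rw [Polynomial.aeval_C]
  have hKX : algebraMap (Polynomial K) E Polynomial.X = π (X 1) := by
    rw [IsScalarTower.algebraMap_apply (Polynomial K) S E, hπ]
    congr 1
    show Polynomial.aeval _ Polynomial.X = _
    rw [Polynomial.aeval_X]
  have halg : ∀ c : K,
      IsAlgebraic (Polynomial K) (π (X 0) - w * π (X 2) + w * algebraMap K E c) := by
    intro c
    refine ⟨substX c g, substX_ne_zero c hg h0, ?_⟩
    have h2 : (Polynomial.aeval (R := Polynomial K)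
        (π (X 0) - w * π (X 2) + w * algebraMap K E c)).toRingHom.comp (substX c).toRingHom =
        (aeval ![π (X 0) - w * π (X 2) + w * algebraMap K E c, π (X 1), algebraMap K E c] :
        MvPolynomial (Fin 3) K →ₐ[K] E).toRingHom := by
      apply MvPolynomial.ringHom_ext
      · intro a
        simp [substX, hKC, IsScalarTower.algebraMap_apply K (Polynomial K)
          (Polynomial (Polynomial K)), Polynomial.algebraMap_eq]
      · intro i
        fin_cases i <;> simp [substX, hKC, hKX]
    exact (congrArg (fun φ => φ g) h2).trans (hrul _)
  have hU : IsAlgebraic (Polynomial K) (π (X 0) - w * π (X 2)) := by simpa using halg 0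
  have hw' : IsAlgebraic (Polynomial K) w := by simpa using (halg 1).sub hU
  have hK : ∀ a : K, IsAlgebraic (Polynomial K) (algebraMap K E a) := fun a =>
    hKC a ▸ isAlgebraic_algebraMap _
  by_contra hne
  set θ := π (X 0) - w * π (X 2) + w * algebraMap K E l - (algebraMap K E u' +
      algebraMap K E w' * π (X 1)) with hθ
  have hθ0 : θ ≠ 0 := sub_ne_zero.2 hne
  have hθa : IsAlgebraic (Polynomial K) θ :=
    (halg l).sub ((hK _).add ((hK _).mul (hKX ▸ isAlgebraic_algebraMap _)))
  obtain ⟨s₁, hs₁, hi₁⟩ := hθa.inv.exists_integral_multiple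
  obtain ⟨s₂, hs₂, hi₂⟩ := (hw'.mul hθa.inv).exists_integral_multiple
  let ev : S →+* Polynomial K := Ideal.Quotient.lift (Ideal.span {g}) (evM u' w' l).toRingHom (by
    intro a ha
    obtain ⟨q, rfl⟩ := Ideal.mem_span_singleton.1 ha
    simp [hl])
  have hevmk : ∀ f, ev (Ideal.Quotient.mk _ f) = evM u' w' l f := fun f => rfl
  have hevs : ∀ s : Polynomial K, ev (algebraMap (Polynomial K) S s) = s := by
    intro s
    have : (ev.comp (algebraMap (Polynomial K) S)) = RingHom.id _ := by
      apply Polynomial.ringHom_ext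
      · intro a
        show ev (Polynomial.aeval _ (Polynomial.C a)) = _
        rw [Polynomial.aeval_C]
        show ev (Ideal.Quotient.mk _ (C a)) = _
        rw [hevmk]
        simp [evM, Polynomial.algebraMap_eq]
      · show ev (Polynomial.aeval _ Polynomial.X) = _
        rw [Polynomial.aeval_X, hevmk]
        simp [evM]
    exact congrArg (fun φ => φ s) this
  refine add_mul_ne_one_of_isIntegral (E := E) ev (s := algebraMap (Polynomial K) S (s₁ * s₂))
    (a := Ideal.Quotient.mk _ (X 0 - C u' - C w' * X 1))
    (b := Ideal.Quotient.mk _ (C l - X 2)) (α := θ⁻¹) (β := w * θ⁻¹) ?_ ?_ ?_ ?_ ?_ ?_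
  · rw [hevs]; exact mul_ne_zero hs₁ hs₂
  · rw [hevmk]; simp [evM, Polynomial.algebraMap_eq]
  · rw [hevmk]; simp [evM, Polynomial.algebraMap_eq]
  · apply IsIntegral.tower_top (R := Polynomial K)
    rw [← IsScalarTower.algebraMap_apply, mul_comm s₁, map_mul, mul_assoc, ← Algebra.smul_def s₁]
    exact isIntegral_algebraMap.mul hi₁
  · apply IsIntegral.tower_top (R := Polynomial K)
    rw [← IsScalarTower.algebraMap_apply, map_mul, mul_assoc, ← Algebra.smul_def s₂]
    exact isIntegral_algebraMap.mul hi₂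
  · have hc : ∀ a : K, π (C a) = algebraMap K E a := fun a => by
      rw [← MvPolynomial.algebraMap_eq, AlgHom.commutes]
    rw [← hπ, ← hπ, map_sub, map_sub, map_mul, map_sub, hc, hc, hc]
    field_simp
    rw [hθ]; ring

theorem exists_bilinear {K : Type*} [Field K] (p : ℕ) [CharP K p]
    {g : MvPolynomial (Fin 3) K} (hg : Irreducible g) (h0 : degreeOf 0 g ≠ 0)
    (hp : degreeOf 0 g + degreeOf 2 g < p) (hF : g ∣ flex g) {u₁ w₁ l₁ u₂ w₂ l₂ : K}
    (hl : l₁ ≠ l₂) (h₁ : evM u₁ w₁ l₁ g = 0) (h₂ : evM u₂ w₂ l₂ g = 0) :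
    ∃ α β γ δ : K, (∀ u w l, evL u w l g = 0 → u = α + γ * l ∧ w = β + δ * l) ∧
      ∀ u w l, evM u w l g = 0 → u = α + β * l ∧ w = γ + δ * l := by
  have : (Ideal.span {g}).IsPrime := (Ideal.span_singleton_prime hg.ne_zero).2 hg.prime
  let S := MvPolynomial (Fin 3) K ⧸ Ideal.span {g}
  let E := FractionRing S
  let π : MvPolynomial (Fin 3) K →ₐ[K] E :=
    (IsScalarTower.toAlgHom K S E).comp (Ideal.Quotient.mkₐ K _)
  have hπ : ∀ f, π f = algebraMap S E (Ideal.Quotient.mk _ f) := fun f => rfl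
  have hπ0 : ∀ f, π f = 0 ↔ g ∣ f := fun f => by
    rw [hπ, FaithfulSMul.algebraMap_eq_zero_iff, Ideal.Quotient.eq_zero_iff_mem,
      Ideal.mem_span_singleton]
  have hgz : π (pderiv 0 g) ≠ 0 := fun h =>
    not_dvd_pderiv_zero p h0 (by omega) ((hπ0 _).1 h)
  set w : E := -π (pderiv 2 g) / π (pderiv 0 g) with hwdef
  have hw : w * π (pderiv 0 g) = -π (pderiv 2 g) := div_mul_cancel₀ _ hgz
  have e₁ := ruling_parallel p hg h0 hp hF π hπ hw h₁
  have e₂ := ruling_parallel p hg h0 hp hF π hπ hw h₂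
  set β := (u₁ - u₂) / (l₁ - l₂) with hβ
  set δ := (w₁ - w₂) / (l₁ - l₂) with hδ
  have hll := sub_ne_zero.2 hl
  have hβ' : β * (l₁ - l₂) = u₁ - u₂ := div_mul_cancel₀ _ hll
  have hδ' : δ * (l₁ - l₂) = w₁ - w₂ := div_mul_cancel₀ _ hll
  have hβE := congrArg (algebraMap K E) hβ'
  have hδE := congrArg (algebraMap K E) hδ'
  simp only [map_mul, map_sub] at hβE hδE
  have hllE : algebraMap K E l₁ - algebraMap K E l₂ ≠ 0 := by
    rw [← map_sub]; exact (map_ne_zero _).2 hll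
  have ew : w = algebraMap K E β + algebraMap K E δ * π (X 1) := by
    apply mul_right_cancel₀ hllE
    linear_combination e₁ - e₂ - hβE - π (X 1) * hδE
  have hc : ∀ a : K, π (C a) = algebraMap K E a := fun a => by
    rw [← MvPolynomial.algebraMap_eq, AlgHom.commutes]
  have hdvd : g ∣ X 0 - (C (u₁ - β * l₁) + C β * X 2 + C (w₁ - δ * l₁) * X 1 +
      C δ * X 1 * X 2) := by
    rw [← hπ0]
    simp only [map_sub, map_add, map_mul, hc]
    rw [ew] at e₁
    linear_combination e₁
  obtain ⟨q, hq⟩ := hdvd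
  refine ⟨u₁ - β * l₁, β, w₁ - δ * l₁, δ, fun u' w' l' h => ?_, fun u' w' l' h => ?_⟩
  · have := congrArg (evL u' w' l') hq
    rw [map_mul, h, zero_mul] at this
    have c0 := congrArg (fun f => Polynomial.coeff f 0) this
    have c1 := congrArg (fun f => Polynomial.coeff f 1) this
    simp [evL, Polynomial.coeff_C, mul_assoc] at c0 c1
    constructor
    · linear_combination c0
    · linear_combination c1
  · have := congrArg (evM u' w' l') hq
    rw [map_mul, h, zero_mul] at this
    have c0 := congrArg (fun f => Polynomial.coeff f 0) this
    have c1 := congrArg (fun f => Polynomial.coeff f 1) this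
    simp [evM, Polynomial.coeff_C, mul_assoc] at c0 c1
    constructor
    · linear_combination c0
    · linear_combination c1

end

section

open scoped Classical in
/-- The number of pairs of `L × M` related by `G`. -/
noncomputable def edges {ι κ : Type*} (G : ι → κ → Prop) (L : Finset ι) (M : Finset κ) : ℕ :=
  ((L ×ˢ M).filter fun x => G x.1 x.2).card

section edges
variable {ι κ : Type*} {G : ι → κ → Prop}

theorem edges_le_mul (L : Finset ι) (M : Finset κ) : edges G L M ≤ L.card * M.card := by
  classical
  unfold edges
  rw [← Finset.card_product]
  exact Finset.card_filter_le _ _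

open scoped Classical in
theorem edges_eq_sum_left (L : Finset ι) (M : Finset κ) :
    edges G L M = ∑ i ∈ L, (M.filter fun j => G i j).card := by
  simp only [edges, Finset.card_filter, Finset.sum_product]

open scoped Classical in
theorem edges_eq_sum_right (L : Finset ι) (M : Finset κ) :
    edges G L M = ∑ j ∈ M, (L.filter fun i => G i j).card := by
  simp only [edges, Finset.card_filter, Finset.sum_product_right]

open scoped Classical in
theorem edges_le_of_left {L : Finset ι} {M : Finset κ} {c : ℕ}
    (h : ∀ i ∈ L, (M.filter fun j => G i j).card ≤ c) : edges G L M ≤ c * L.card := by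
  rw [edges_eq_sum_left, mul_comm]
  simpa using Finset.sum_le_card_nsmul L _ c h

open scoped Classical in
theorem edges_le_of_right {L : Finset ι} {M : Finset κ} {c : ℕ}
    (h : ∀ j ∈ M, (L.filter fun i => G i j).card ≤ c) : edges G L M ≤ c * M.card := by
  rw [edges_eq_sum_right, mul_comm]
  simpa using Finset.sum_le_card_nsmul M _ c h

theorem edges_mono {L L' : Finset ι} {M M' : Finset κ} (hL : L ⊆ L') (hM : M ⊆ M') :
    edges G L M ≤ edges G L' M' := by
  classical
  exact Finset.card_le_card (Finset.filter_subset_filter _ (Finset.product_subset_product hL hM))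

theorem edges_union_left [DecidableEq ι] (L L' : Finset ι) (M : Finset κ) :
    edges G (L ∪ L') M ≤ edges G L M + edges G L' M := by
  classical
  unfold edges
  rw [Finset.union_product, Finset.filter_union]
  exact Finset.card_union_le _ _

theorem edges_union_right [DecidableEq κ] (L : Finset ι) (M M' : Finset κ) :
    edges G L (M ∪ M') ≤ edges G L M + edges G L M' := by
  classical
  unfold edges
  rw [Finset.product_union, Finset.filter_union]
  exact Finset.card_union_le _ _

end edges

open MvPolynomial

theorem eval_evL {K : Type*} [Field K] (u w l t : K) (g : MvPolynomial (Fin 3) K) :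
    (evL u w l g).eval t = eval ![u + w * t, l, t] g := by
  have : (Polynomial.evalRingHom t).comp (evL u w l).toRingHom = eval ![u + w * t, l, t] := by
    apply MvPolynomial.ringHom_ext
    · intro a; simp [evL]
    · intro i; fin_cases i <;> simp [evL]
  exact congrArg (fun φ => φ g) this

theorem eval_evM {K : Type*} [Field K] (u w l t : K) (g : MvPolynomial (Fin 3) K) :
    (evM u w l g).eval t = eval ![u + w * t, t, l] g := by
  have : (Polynomial.evalRingHom t).comp (evM u w l).toRingHom = eval ![u + w * t, t, l] := by
    apply MvPolynomial.ringHom_ext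
    · intro a; simp [evM]
    · intro i; fin_cases i <;> simp [evM]
  exact congrArg (fun φ => φ g) this

theorem natDegree_C_add_C_mul_X_le {A : Type*} [CommRing A] (a b : A) :
    (Polynomial.C a + Polynomial.C b * Polynomial.X).natDegree ≤ 1 := by
  compute_degree

theorem natDegree_evM_le {K : Type*} [Field K] (u w l : K) (g : MvPolynomial (Fin 3) K) :
    (evM u w l g).natDegree ≤ degreeOf 1 g + degreeOf 0 g := by
  refine (natDegree_aeval_le _ ![1, 1, 0] ?_ g).trans ?_
  · intro i
    fin_cases i
    · exact natDegree_C_add_C_mul_X_le _ _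
    · exact Polynomial.natDegree_X_le
    · exact (Polynomial.natDegree_C _).le
  · simp [Fin.sum_univ_three, add_comm]

theorem natDegree_evL_le {K : Type*} [Field K] (u w l : K) (g : MvPolynomial (Fin 3) K) :
    (evL u w l g).natDegree ≤ degreeOf 2 g + degreeOf 0 g := by
  refine (natDegree_aeval_le _ ![1, 0, 1] ?_ g).trans ?_
  · intro i
    fin_cases i
    · exact natDegree_C_add_C_mul_X_le _ _
    · exact (Polynomial.natDegree_C _).le
    · exact Polynomial.natDegree_X_le
  · simp [Fin.sum_univ_three, add_comm]

theorem card_lines_le_of_degreeOf_eq_zero {K ι : Type*} [Field K] {u w l : ι → K}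
    (hl : Function.Injective l) {g : MvPolynomial (Fin 3) K} (hg : g ≠ 0) (hz : degreeOf 0 g = 0)
    (L : Finset ι) (hL : ∀ i ∈ L, evL (u i) (w i) (l i) g = 0) : L.card ≤ degreeOf 1 g := by
  classical
  have h1 := natDegree_finSuccEquiv g
  rw [hz] at h1
  obtain ⟨r, hr⟩ : ∃ r, finSuccEquiv K 2 g = Polynomial.C r :=
    ⟨_, Polynomial.eq_C_of_natDegree_eq_zero h1⟩
  have hr0 : r ≠ 0 := by
    rintro rfl
    rw [map_zero, EmbeddingLike.map_eq_zero_iff] at hr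
    exact hg hr
  have hdeg : degreeOf 0 r ≤ degreeOf 1 g := by
    have := degreeOf_coeff_finSuccEquiv g 0 0
    rwa [hr, Polynomial.coeff_C_zero] at this
  rw [← Finset.card_image_of_injective L hl]
  refine le_trans (card_le_degreeOf_zero hr0 _ fun t ht => ?_) hdeg
  obtain ⟨i, hi, rfl⟩ := Finset.mem_image.1 ht
  apply eval_finSuccEquiv_eq_zero
  have := hL i hi
  rw [evL_eq_eval₂, hr, Polynomial.eval₂_C] at this
  simpa using this

/-- The two families of lines attached to `(u, w, l)` and a sub-relation `G` of their incidence
relation such that `G i` has at most `k` members on each regulus through the line `i`. -/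
structure LineSystem {K ι : Type*} [Field K] (u w l : ι → K) (G : ι → ι → Prop) (k : ℕ) :
    Prop where
  inj : Function.Injective l
  meet : ∀ i j, G i j → u i + w i * l j = u j + w j * l i
  regulus : ∀ (i : ι) (J : Finset ι) (α β γ δ : K),
    (∀ j ∈ J, u j = α + β * l j ∧ w j = γ + δ * l j) →
    (∀ j ∈ J, u i + w i * l j = u j + w j * l i) →
    ∀ J' ⊆ J, (∀ j ∈ J', G i j) → J'.card ≤ k

namespace LineSystem
variable {K ι : Type*} [Field K] {u w l : ι → K} {G : ι → ι → Prop} {k : ℕ}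

theorem edges_le_of_evM_ne_zero (hS : LineSystem u w l G k) {g : MvPolynomial (Fin 3) K}
    {L M : Finset ι} (hL : ∀ i ∈ L, evL (u i) (w i) (l i) g = 0)
    (hM : ∀ j ∈ M, evM (u j) (w j) (l j) g ≠ 0) :
    edges G L M ≤ (degreeOf 1 g + degreeOf 0 g) * M.card := by
  classical
  refine edges_le_of_right fun j hj => ?_
  refine le_trans ?_ (natDegree_evM_le (u j) (w j) (l j) g)
  rw [← Finset.card_image_of_injective _ hS.inj]
  refine Polynomial.card_le_degree_of_subset_roots fun t ht => ?_
  simp only [Finset.image_val, Multiset.mem_dedup, Multiset.mem_map, Finset.mem_val,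
    Finset.mem_filter] at ht
  obtain ⟨i, ⟨hi, hG⟩, rfl⟩ := ht
  rw [Polynomial.mem_roots (hM j hj), Polynomial.IsRoot, eval_evM, ← hS.meet i j hG, ← eval_evL,
    hL i hi, Polynomial.eval_zero]

theorem edges_le_of_evL_ne_zero (hS : LineSystem u w l G k) {g : MvPolynomial (Fin 3) K}
    {L M : Finset ι} (hL : ∀ i ∈ L, evL (u i) (w i) (l i) g ≠ 0)
    (hM : ∀ j ∈ M, evM (u j) (w j) (l j) g = 0) :
    edges G L M ≤ (degreeOf 2 g + degreeOf 0 g) * L.card := by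
  classical
  refine edges_le_of_left fun i hi => ?_
  refine le_trans ?_ (natDegree_evL_le (u i) (w i) (l i) g)
  rw [← Finset.card_image_of_injective _ hS.inj]
  refine Polynomial.card_le_degree_of_subset_roots fun t ht => ?_
  simp only [Finset.image_val, Multiset.mem_dedup, Multiset.mem_map, Finset.mem_val,
    Finset.mem_filter] at ht
  obtain ⟨j, ⟨hj, hG⟩, rfl⟩ := ht
  rw [Polynomial.mem_roots (hL i hi), Polynomial.IsRoot, eval_evL, hS.meet i j hG, ← eval_evM,
    hM j hj, Polynomial.eval_zero]

theorem edges_le_of_dvd_flex (hS : LineSystem u w l G k) (p : ℕ) [CharP K p]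
    {g : MvPolynomial (Fin 3) K} (hg : Irreducible g) (h0 : degreeOf 0 g ≠ 0)
    (hp : degreeOf 0 g + degreeOf 2 g < p) (hF : g ∣ flex g) {L M : Finset ι}
    (hL : ∀ i ∈ L, evL (u i) (w i) (l i) g = 0) (hM : ∀ j ∈ M, evM (u j) (w j) (l j) g = 0) :
    edges G L M ≤ (k + 1) * L.card := by
  classical
  refine edges_le_of_left fun i hi => ?_
  by_cases hc : M.card ≤ 1
  · exact (Finset.card_filter_le _ _).trans (hc.trans (by omega))
  obtain ⟨j₁, h₁, j₂, h₂, hne⟩ := Finset.one_lt_card.1 (not_le.1 hc)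
  obtain ⟨α, β, γ, δ, hLb, hMb⟩ := exists_bilinear p hg h0 hp hF (hS.inj.ne hne) (hM j₁ h₁)
    (hM j₂ h₂)
  obtain ⟨a1, a2⟩ := hLb _ _ _ (hL i hi)
  have := hS.regulus i M α β γ δ (fun j hj => hMb _ _ _ (hM j hj)) (fun j hj => by
    obtain ⟨b1, b2⟩ := hMb _ _ _ (hM j hj)
    rw [a1, a2, b1, b2]; ring) (M.filter fun j => G i j) (Finset.filter_subset _ _)
    (fun j hj => (Finset.mem_filter.1 hj).2)
  omega

theorem exists_exceptional [DecidableEq ι] (hS : LineSystem u w l G k) (p : ℕ) [CharP K p]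
    (M : Finset ι) (g : MvPolynomial (Fin 3) K) : g ≠ 0 → degreeOf 0 g + degreeOf 2 g < p →
    ∀ L : Finset ι, (∀ i ∈ L, evL (u i) (w i) (l i) g = 0) →
    ∃ B L', L ⊆ B ∪ L' ∧ B ⊆ L ∧ B.card ≤ 6 * degreeOf 1 g * (degreeOf 0 g + 1) ∧
      edges G L' M ≤ (degreeOf 1 g + degreeOf 0 g) * M.card + (k + 1) * L.card := by
  classical
  induction g using WfDvdMonoid.induction_on_irreducible with
  | zero => intro h; exact absurd rfl h
  | unit g hg =>
    intro _ _ L hL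
    refine ⟨∅, ∅, ?_, by simp, by simp, by simp [edges]⟩
    intro i hi
    exact absurd (hL i hi) (hg.map (evL (u i) (w i) (l i))).ne_zero
  | mul f g hf hg ih =>
    intro hne hp L hL
    have d := fun i => degreeOf_mul_eq (n := i) hg.ne_zero hf
    simp only [d] at hp ⊢
    obtain ⟨B₂, L₂, hc₂, hs₂, hb₂, he₂⟩ := ih hf (by omega)
      (L.filter fun i => ¬ evL (u i) (w i) (l i) g = 0) (by
        intro i hi
        rw [Finset.mem_filter] at hi
        have := hL i hi.1
        rw [map_mul, mul_eq_zero] at this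
        exact this.resolve_left hi.2)
    have key : ∀ L : Finset ι, (∀ i ∈ L, evL (u i) (w i) (l i) g = 0) →
        ∃ B L', L ⊆ B ∪ L' ∧ B ⊆ L ∧ B.card ≤ 6 * degreeOf 1 g * (degreeOf 0 g + 1) ∧
        edges G L' M ≤ (degreeOf 1 g + degreeOf 0 g) * M.card + (k + 1) * L.card := by
      intro L hL
      by_cases h0 : degreeOf 0 g = 0
      · refine ⟨L, ∅, by simp, le_rfl, ?_, by simp [edges]⟩
        have := card_lines_le_of_degreeOf_eq_zero hS.inj hg.ne_zero h0 L hL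
        nlinarith
      by_cases hF : g ∣ flex g
      · refine ⟨∅, L, by simp, by simp, by simp, ?_⟩
        have h1 := edges_union_right (G := G) L
          (M.filter fun j => ¬ evM (u j) (w j) (l j) g = 0)
          (M.filter fun j => evM (u j) (w j) (l j) g = 0)
        rw [Finset.union_comm, Finset.filter_union_filter_not_eq] at h1
        have h2 := hS.edges_le_of_evM_ne_zero
          (M := M.filter fun j => ¬ evM (u j) (w j) (l j) g = 0) hL
          (fun j hj => (Finset.mem_filter.1 hj).2)
        have h3 := hS.edges_le_of_dvd_flex p hg h0 (by omega) hF
          (M := M.filter fun j => evM (u j) (w j) (l j) g = 0) hL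
          (fun j hj => (Finset.mem_filter.1 hj).2)
        have h4 := Nat.mul_le_mul_left (degreeOf 1 g + degreeOf 0 g)
          (Finset.card_filter_le M fun j => ¬ evM (u j) (w j) (l j) g = 0)
        omega
      · refine ⟨L, ∅, by simp, le_rfl, ?_, by simp [edges]⟩
        have h1 := card_lines_le_of_not_dvd hS.inj hg h0 hF L
          (fun i hi => ⟨hL i hi, evL_flex (hL i hi)⟩)
        have h2 := Nat.mul_le_mul_left (degreeOf 0 g) (degreeOf_flex_le 1 g)
        have h3 := Nat.mul_le_mul_right (degreeOf 1 g) (degreeOf_flex_le 0 g)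
        nlinarith
    obtain ⟨B₁, L₁, hc₁, hs₁, hb₁, he₁⟩ := key
      (L.filter fun i => evL (u i) (w i) (l i) g = 0) (fun i hi => (Finset.mem_filter.1 hi).2)
    refine ⟨B₁ ∪ B₂, L₁ ∪ L₂, ?_, ?_, ?_, ?_⟩
    · intro i hi
      by_cases h : evL (u i) (w i) (l i) g = 0
      · have := hc₁ (Finset.mem_filter.2 ⟨hi, h⟩)
        simp only [Finset.mem_union] at this ⊢
        tauto
      · have := hc₂ (Finset.mem_filter.2 ⟨hi, h⟩)
        simp only [Finset.mem_union] at this ⊢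
        tauto
    · exact Finset.union_subset (hs₁.trans (Finset.filter_subset _ _))
        (hs₂.trans (Finset.filter_subset _ _))
    · have := Finset.card_union_le B₁ B₂
      nlinarith
    · have h1 := edges_union_left (G := G) L₁ L₂ M
      have h2 := Finset.card_filter_add_card_filter_not (s := L)
        (fun i => evL (u i) (w i) (l i) g = 0)
      nlinarith

end LineSystem

theorem exists_vanishing {K ι : Type*} [Field K] (u w l : ι → K) (M : Finset ι) (a b : ℕ)
    (h : M.card * (2 * b + 1) < (b + 1) * (b + 1) * (a + 1)) :
    ∃ f : MvPolynomial (Fin 3) K, f ≠ 0 ∧ degreeOf 0 f ≤ b ∧ degreeOf 1 f ≤ b ∧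
      degreeOf 2 f ≤ a ∧ ∀ j ∈ M, evM (u j) (w j) (l j) f = 0 := by
  classical
  let d : Fin 3 →₀ ℕ := Finsupp.equivFunOnFinite.symm ![b, b, a]
  let V := restrictSupport K (Finset.Iic d : Set (Fin 3 →₀ ℕ))
  have hV : Module.finrank K V = (b + 1) * (b + 1) * (a + 1) := by
    have h1 : (Finset.Iic d).card = ∏ i, (d i + 1) := by
      rw [Finsupp.card_Iic, ← Finset.prod_subset (Finset.subset_univ d.support)]
      · simp
      · intro i _ hi
        simp [Finsupp.notMem_support_iff.1 hi]
    rw [Module.finrank_eq_card_basis (basisRestrictSupport K _)]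
    simp only [Finset.coe_sort_coe, Fintype.card_coe, h1, Fin.prod_univ_three]
    rfl
  have : FiniteDimensional K V := Module.Finite.of_basis (basisRestrictSupport K _)
  let φ : V →ₗ[K] (M → Fin (2 * b + 1) → K) :=
    LinearMap.pi fun j => LinearMap.pi fun n => Polynomial.lcoeff K n ∘ₗ
      (evM (u j) (w j) (l j)).toLinearMap ∘ₗ V.subtype
  have hφ : LinearMap.ker φ ≠ ⊥ := LinearMap.ker_ne_bot_of_finrank_lt (by
    rw [hV]; simpa [Module.finrank_pi_fintype] using h)
  obtain ⟨f, hf, hf0⟩ := Submodule.exists_mem_ne_zero_of_ne_bot hφ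
  have hd : ∀ i, degreeOf i f.1 ≤ d i := fun i => by
    rw [degreeOf_le_iff]
    intro m hm
    have := f.2 hm
    simp at this
    exact this i
  have h0 : degreeOf 0 f.1 ≤ b := hd 0
  have h1 : degreeOf 1 f.1 ≤ b := hd 1
  refine ⟨f, by simpa using hf0, h0, h1, hd 2, fun j hj => ?_⟩
  ext n
  by_cases hn : n < 2 * b + 1
  · have := congrFun (congrFun (LinearMap.mem_ker.1 hf) ⟨j, hj⟩) ⟨n, hn⟩
    simpa [φ] using this
  · rw [Polynomial.coeff_zero]
    apply Polynomial.coeff_eq_zero_of_natDegree_lt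
    have := natDegree_evM_le (u j) (w j) (l j) f.1
    omega

theorem edges_le_of_card_le {ι κ : Type*} {G : ι → κ → Prop} {L : Finset ι} {m : ℕ} (hm : 0 < m)
    {α β : ℝ} (hβ : 0 ≤ β)
    (h : ∀ M : Finset κ, M.card ≤ m → (edges G L M : ℝ) ≤ α * M.card + β) (M : Finset κ) :
    (edges G L M : ℝ) ≤ α * M.card + β * (M.card / m + 1) := by
  classical
  induction hn : M.card using Nat.strong_induction_on generalizing M with
  | _ n ih =>
    by_cases hc : M.card ≤ m
    · have h1 := h M hc
      have : 0 ≤ β * ((n : ℝ) / m) := by positivity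
      rw [← hn] at this ⊢
      linarith
    · obtain ⟨N, hN, hNm⟩ := Finset.exists_subset_card_eq (not_le.1 hc).le
      have h1 := h N hNm.le
      have h2 := ih (M \ N).card (by rw [Finset.card_sdiff_of_subset hN]; omega) _ rfl
      have h3 : ((M \ N).card : ℝ) = n - m := by
        rw [Finset.card_sdiff_of_subset hN, hn, hNm, Nat.cast_sub (by omega)]
      have h4 : (edges G L M : ℝ) ≤ edges G L N + edges G L (M \ N) := by
        have := edges_union_right (G := G) L N (M \ N)
        rw [Finset.union_sdiff_of_subset hN] at this
        exact_mod_cast this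
      have hm' : (m : ℝ) ≠ 0 := by positivity
      have h5 : ((n : ℝ) - m) / m = n / m - 1 := by rw [sub_div, div_self hm']
      rw [h3, h5] at h2
      rw [hNm] at h1
      linarith

namespace LineSystem
variable {K ι : Type*} [Field K] {u w l : ι → K} {G : ι → ι → Prop} {k : ℕ}

theorem exists_edges_le (hS : LineSystem u w l G k) (p : ℕ) [CharP K p] (L M : Finset ι)
    (a b : ℕ) (h : M.card * (2 * b + 1) < (b + 1) * (b + 1) * (a + 1)) (hp : b + a < p) :
    ∃ B : Finset ι, B.card ≤ 6 * b * (b + 1) ∧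
      edges G L M ≤ edges G B M + 2 * b * M.card + (k + 1 + a + b) * L.card := by
  classical
  obtain ⟨f, hf, h0, h1, h2, hM⟩ := exists_vanishing u w l M a b h
  obtain ⟨B, L', hB, -, hc, he⟩ := hS.exists_exceptional p M f hf (by omega)
    (L.filter fun i => evL (u i) (w i) (l i) f = 0) (fun i hi => (Finset.mem_filter.1 hi).2)
  refine ⟨B, hc.trans (by gcongr), ?_⟩
  have e1 := hS.edges_le_of_evL_ne_zero (L := L.filter fun i => ¬ evL (u i) (w i) (l i) f = 0)
    (fun i hi => (Finset.mem_filter.1 hi).2) hM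
  have e2 : edges G L M ≤ edges G (L.filter fun i => evL (u i) (w i) (l i) f = 0) M +
      edges G (L.filter fun i => ¬ evL (u i) (w i) (l i) f = 0) M := by
    rw [← Finset.filter_union_filter_not_eq (fun i => evL (u i) (w i) (l i) f = 0) L]
    refine (edges_union_left _ _ _).trans ?_
    rw [Finset.filter_union_filter_not_eq]
  have e3 := (edges_mono (G := G) hB (le_refl M)).trans (edges_union_left _ _ _)
  have e4 : (degreeOf 1 f + degreeOf 0 f) * M.card ≤ 2 * b * M.card := by gcongr; omega
  have e5 : (degreeOf 2 f + degreeOf 0 f) *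
      (L.filter fun i => ¬ evL (u i) (w i) (l i) f = 0).card ≤ (a + b) * L.card := by
    gcongr
    exact Finset.filter_subset _ _
  have e6 : (k + 1) * (L.filter fun i => evL (u i) (w i) (l i) f = 0).card ≤ (k + 1) * L.card := by
    gcongr
    exact Finset.filter_subset _ _
  nlinarith

/-- One step of the induction in `LineSystem.edges_le`. -/
theorem edges_le_step (hS : LineSystem u w l G k) (p : ℕ) [CharP K p] {L M : Finset ι} {R : ℝ}
    (hRR : R * R = L.card) (hR : 12 ≤ R) (hRp : 1000 * R ≤ p) (hM : (M.card : ℝ) ≤ p * R / 24)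
    (ih : ∀ B : Finset ι, B.card < L.card →
      (edges G B M : ℝ) ≤ 100 * (M.card * √B.card + B.card * √B.card + k * B.card)) :
    (edges G L M : ℝ) ≤ 75 * R * M.card + (13 * L.card * R + 26 * k * L.card) := by
  have hb1 := Nat.floor_le (show 0 ≤ R / 6 by positivity)
  have hb2 := Nat.lt_floor_add_one (R / 6)
  set b := ⌊R / 6⌋₊
  have hd := Nat.div_mul_le_self (2 * M.card) (b + 1)
  have hd' := Nat.lt_div_mul_add (a := 2 * M.card) (b := b + 1) (by omega)
  set a := 2 * M.card / (b + 1)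
  have ha : (a : ℝ) * R ≤ 12 * M.card := by
    have : (a : ℝ) * (b + 1) ≤ 2 * M.card := by exact_mod_cast hd
    have : (a : ℝ) * (R / 6) ≤ a * (b + 1) := by gcongr
    linarith
  obtain ⟨B, hB, he⟩ := hS.exists_edges_le p L M a b (by nlinarith) (by
    have : (b + a : ℝ) < p := by
      have : (a : ℝ) * R ≤ p / 2 * R := by linarith
      have := le_of_mul_le_mul_right this (by linarith)
      linarith
    exact_mod_cast this)
  have hB' : (B.card : ℝ) ≤ L.card / 4 := by
    have : (B.card : ℝ) ≤ 6 * b * (b + 1) := by exact_mod_cast hB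
    nlinarith
  have hBn : B.card < L.card := by
    have : (B.card : ℝ) < L.card := by nlinarith
    exact_mod_cast this
  have hi := ih B hBn
  have hsB : √(B.card : ℝ) ≤ R / 2 := by
    rw [Real.sqrt_le_left (by positivity)]
    linarith
  have g1 : (M.card : ℝ) * √B.card ≤ M.card * (R / 2) := by gcongr
  have g2 : (B.card : ℝ) * √B.card ≤ L.card / 4 * (R / 2) := by gcongr
  have g3 : (k : ℝ) * B.card ≤ k * (L.card / 4) := by gcongr
  have he' : (edges G L M : ℝ) ≤
      edges G B M + 2 * b * M.card + (k + 1 + a + b) * L.card := by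
    exact_mod_cast he
  have g4 : (b : ℝ) * M.card ≤ R / 6 * M.card := by gcongr
  have g5 : (b : ℝ) * L.card ≤ R / 6 * L.card := by gcongr
  have g6 : (a : ℝ) * L.card ≤ 12 * M.card * R := by
    rw [← hRR, ← mul_assoc]; gcongr
  have g7 : (L.card : ℝ) ≤ L.card * (R / 12) :=
    le_mul_of_one_le_right (by positivity) (by linarith)
  have g8 : 0 ≤ (L.card : ℝ) * R := by positivity
  have g9 : 0 ≤ (k : ℝ) * L.card := by positivity
  have g10 : 0 ≤ (M.card : ℝ) * R := by positivity
  linarith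

theorem edges_le (hS : LineSystem u w l G k) (p : ℕ) [CharP K p] (hk : 1000 * k ≤ p)
    (L M : Finset ι) (hL : 10 ^ 6 * L.card ≤ p ^ 2) :
    (edges G L M : ℝ) ≤ 100 * (M.card * √L.card + L.card * √L.card + k * L.card) := by
  induction hn : L.card using Nat.strong_induction_on generalizing L M with
  | _ n ih =>
  rw [hn] at hL
  set R := √(n : ℝ) with hR
  have hRR : R * R = n := Real.mul_self_sqrt (by positivity)
  have hR0 : 0 ≤ R := Real.sqrt_nonneg _
  by_cases hsm : R < 12
  · have h1 : (edges G L M : ℝ) ≤ n * M.card := by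
      rw [← hn]; exact_mod_cast edges_le_mul L M
    have h2 : (n : ℝ) * M.card ≤ 100 * (M.card * R) := by
      rw [← hRR]
      have : 0 ≤ (M.card : ℝ) * R := by positivity
      nlinarith
    have h3 : 0 ≤ (n : ℝ) * R + k * n := by positivity
    linarith
  rw [not_lt] at hsm
  have hRp : 1000 * R ≤ p := by
    have : (10 ^ 6 * n : ℝ) ≤ p ^ 2 := by exact_mod_cast hL
    rw [← hRR] at this
    have hp0 : (0 : ℝ) ≤ p := by positivity
    nlinarith
  have hkp : 1000 * (k : ℝ) ≤ p := by exact_mod_cast hk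
  have hm1 := Nat.floor_le (show 0 ≤ p * R / 24 by positivity)
  have hm2 := Nat.lt_floor_add_one (p * R / 24)
  set m := ⌊p * R / 24⌋₊
  have hm3 : p * R / 48 ≤ m := by nlinarith
  have hm0 : 0 < m := by
    have : (0 : ℝ) < m := by nlinarith
    exact_mod_cast this
  have main := edges_le_of_card_le (G := G) (L := L) hm0 (α := 75 * R)
    (β := 13 * L.card * R + 26 * k * L.card) (by positivity) (fun M hM => by
      have hM' : (M.card : ℝ) ≤ m := by exact_mod_cast hM
      exact hS.edges_le_step p (by rw [hRR, hn]) hsm hRp (by linarith) fun B hB =>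
        ih B.card (by omega) B M (by omega) rfl) M
  rw [hn] at main
  have hx : (13 * n * R + 26 * k * n) * ((M.card : ℝ) / m) ≤ 25 * (M.card * R) := by
    rw [mul_div_assoc', div_le_iff₀ (by positivity)]
    have f1 : 13 * n * R + 26 * k * n ≤ (25 * R) * (p * R / 48) := by
      have e1 : R * (R * R) ≤ p / 1000 * (R * R) := by gcongr; linarith
      have e2 : (k : ℝ) * (R * R) ≤ p / 1000 * (R * R) := by gcongr; linarith
      have e3 : 0 ≤ (p : ℝ) * (R * R) := by positivity
      rw [← hRR]
      nlinarith
    have f2 : (25 * R) * (p * R / 48) ≤ 25 * R * m := by gcongr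
    have f3 : (0 : ℝ) ≤ M.card := by positivity
    nlinarith
  have g8 : 0 ≤ (n : ℝ) * R := by positivity
  have g9 : 0 ≤ (k : ℝ) * n := by positivity
  nlinarith

end LineSystem

end

/-- Incidence of points `(u, w, l)`: vanishing of the symplectic form on `(1, u, w, l)`. -/
def Inc {F : Type*} [CommRing F] (x y : F × F × F) : Prop :=
  x.1 + x.2.1 * y.2.2 = y.1 + y.2.1 * x.2.2

/-- Collinearity of three points of `F³`. -/
def Coll {F : Type*} [CommRing F] (x y z : F × F × F) : Prop :=
  (z.1 - x.1) * (y.2.1 - x.2.1) = (z.2.1 - x.2.1) * (y.1 - x.1) ∧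
  (z.1 - x.1) * (y.2.2 - x.2.2) = (z.2.2 - x.2.2) * (y.1 - x.1) ∧
  (z.2.1 - x.2.1) * (y.2.2 - x.2.2) = (z.2.2 - x.2.2) * (y.2.1 - x.2.1)

open Polynomial in
theorem exists_generic {K ι : Type*} [Field K] [Infinite K] [Fintype ι] {X : ι → K × K × K}
    (hX : Function.Injective X) :
    ∃ τ : K, (∀ i, 1 + τ * (X i).2.1 ≠ 0) ∧ ∀ i j,
      ((X i).2.2 + τ * (X i).1 + τ ^ 3 * (X i).2.1) * (1 + τ * (X j).2.1) =
      ((X j).2.2 + τ * (X j).1 + τ ^ 3 * (X j).2.1) * (1 + τ * (X i).2.1) → i = j := by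
  classical
  let Q : ι → ι → K[X] := fun i j =>
    C ((X i).2.2 - (X j).2.2) +
    C ((X i).1 - (X j).1 + (X i).2.2 * (X j).2.1 - (X j).2.2 * (X i).2.1) * Polynomial.X +
    C ((X i).1 * (X j).2.1 - (X j).1 * (X i).2.1) * Polynomial.X ^ 2 +
    C ((X i).2.1 - (X j).2.1) * Polynomial.X ^ 3
  have hQ : ∀ i j, i ≠ j → Q i j ≠ 0 := by
    intro i j hij h
    have h0 := congrArg (fun f => coeff f 0) h
    have h1 := congrArg (fun f => coeff f 1) h
    have h3 := congrArg (fun f => coeff f 3) h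
    simp only [Q, coeff_add, coeff_C_mul, coeff_X_pow, coeff_X, coeff_C, coeff_zero] at h0 h1 h3
    norm_num at h0 h1 h3
    rw [sub_eq_zero] at h0 h3
    refine hij (hX (Prod.ext ?_ (Prod.ext h3 h0)))
    rw [h0, h3] at h1
    linear_combination h1
  let P : K[X] := (∏ i, (1 + C (X i).2.1 * Polynomial.X)) *
    ∏ i, ∏ j, if i = j then 1 else Q i j
  have hP : P ≠ 0 := by
    refine mul_ne_zero (Finset.prod_ne_zero_iff.2 fun i _ h => ?_)
      (Finset.prod_ne_zero_iff.2 fun i _ => Finset.prod_ne_zero_iff.2 fun j _ => ?_)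
    · have := congrArg (fun f => coeff f 0) h
      simp at this
    · split_ifs with h
      · exact one_ne_zero
      · exact hQ i j h
  obtain ⟨τ, hτ⟩ : ∃ τ, P.eval τ ≠ 0 := by
    by_contra! h
    exact hP (Polynomial.funext fun r => by simp [h r])
  simp only [P, eval_mul, eval_prod, mul_ne_zero_iff, Finset.prod_ne_zero_iff] at hτ
  refine ⟨τ, fun i => ?_, fun i j h => ?_⟩
  · have := hτ.1 i (Finset.mem_univ i)
    simpa only [eval_add, eval_one, eval_mul, eval_C, eval_X, mul_comm τ] using this
  · by_contra hij
    have := hτ.2 i (Finset.mem_univ i) j (Finset.mem_univ j)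
    rw [if_neg hij] at this
    apply this
    simp only [Q, eval_add, eval_mul, eval_C, eval_X, eval_pow]
    linear_combination h

theorem coll_of_generic {K : Type*} [Field K] {x y z : K × K × K} {τ α β γ δ : K}
    (h : (x.2.2 + τ * x.1 + τ ^ 3 * x.2.1) * (1 + τ * y.2.1) ≠
      (y.2.2 + τ * y.1 + τ ^ 3 * y.2.1) * (1 + τ * x.2.1))
    (a₁ : x.1 = α * (1 + τ * x.2.1) + β * (x.2.2 + τ * x.1 + τ ^ 3 * x.2.1))
    (b₁ : x.2.1 = γ * (1 + τ * x.2.1) + δ * (x.2.2 + τ * x.1 + τ ^ 3 * x.2.1))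
    (a₂ : y.1 = α * (1 + τ * y.2.1) + β * (y.2.2 + τ * y.1 + τ ^ 3 * y.2.1))
    (b₂ : y.2.1 = γ * (1 + τ * y.2.1) + δ * (y.2.2 + τ * y.1 + τ ^ 3 * y.2.1))
    (a₃ : z.1 = α * (1 + τ * z.2.1) + β * (z.2.2 + τ * z.1 + τ ^ 3 * z.2.1))
    (b₃ : z.2.1 = γ * (1 + τ * z.2.1) + δ * (z.2.2 + τ * z.1 + τ ^ 3 * z.2.1)) :
    Coll x y z := by
  obtain ⟨u₁, w₁, l₁⟩ := x
  obtain ⟨u₂, w₂, l₂⟩ := y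
  obtain ⟨u₃, w₃, l₃⟩ := z
  simp only [Coll] at *
  obtain ⟨ξ₁, hξ₁⟩ : ∃ ξ, ξ = 1 + τ * w₁ := ⟨_, rfl⟩
  obtain ⟨ξ₂, hξ₂⟩ : ∃ ξ, ξ = 1 + τ * w₂ := ⟨_, rfl⟩
  obtain ⟨ξ₃, hξ₃⟩ : ∃ ξ, ξ = 1 + τ * w₃ := ⟨_, rfl⟩
  obtain ⟨Λ₁, hΛ₁⟩ : ∃ Λ, Λ = l₁ + τ * u₁ + τ ^ 3 * w₁ := ⟨_, rfl⟩
  obtain ⟨Λ₂, hΛ₂⟩ : ∃ Λ, Λ = l₂ + τ * u₂ + τ ^ 3 * w₂ := ⟨_, rfl⟩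
  obtain ⟨Λ₃, hΛ₃⟩ : ∃ Λ, Λ = l₃ + τ * u₃ + τ ^ 3 * w₃ := ⟨_, rfl⟩
  rw [← hξ₁, ← hΛ₁] at a₁ b₁
  rw [← hξ₂, ← hΛ₂] at a₂ b₂
  rw [← hξ₃, ← hΛ₃] at a₃ b₃
  rw [← hξ₁, ← hΛ₁, ← hξ₂, ← hΛ₂] at h
  have hD : Λ₁ * ξ₂ - Λ₂ * ξ₁ ≠ 0 := sub_ne_zero.2 h
  obtain ⟨a, b, hξ, hΛ⟩ : ∃ a b, ξ₃ = a * ξ₁ + b * ξ₂ ∧ Λ₃ = a * Λ₁ + b * Λ₂ := by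
    refine ⟨(Λ₃ * ξ₂ - Λ₂ * ξ₃) / (Λ₁ * ξ₂ - Λ₂ * ξ₁), (Λ₁ * ξ₃ - Λ₃ * ξ₁) / (Λ₁ * ξ₂ - Λ₂ * ξ₁),
      ?_, ?_⟩ <;> rw [div_mul_eq_mul_div, div_mul_eq_mul_div, ← add_div, eq_div_iff hD] <;> ring
  have hu : u₃ = a * u₁ + b * u₂ := by
    linear_combination a₃ - a * a₁ - b * a₂ + α * hξ + β * hΛ
  have hw : w₃ = a * w₁ + b * w₂ := by
    linear_combination b₃ - a * b₁ - b * b₂ + γ * hξ + δ * hΛ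
  have hl : l₃ = a * l₁ + b * l₂ := by
    linear_combination hΛ - hΛ₃ + a * hΛ₁ + b * hΛ₂ - τ * hu - τ ^ 3 * hw
  have h1 : a = 1 - b := by
    linear_combination hξ₃ - hξ + τ * hw - a * hξ₁ - b * hξ₂
  subst h1
  rw [hu, hw, hl]
  refine ⟨?_, ?_, ?_⟩ <;> ring

theorem lineSystem_of_generic {K ι : Type*} [Field K] {X : ι → K × K × K} {τ : K}
    (h0 : ∀ i, 1 + τ * (X i).2.1 ≠ 0)
    (h1 : ∀ i j, ((X i).2.2 + τ * (X i).1 + τ ^ 3 * (X i).2.1) * (1 + τ * (X j).2.1) =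
      ((X j).2.2 + τ * (X j).1 + τ ^ 3 * (X j).2.1) * (1 + τ * (X i).2.1) → i = j)
    {G : ι → ι → Prop} {k : ℕ} (hk : 1 ≤ k) (hG : ∀ i j, G i j → Inc (X i) (X j))
    (hreg : ∀ i j, G i j → ∀ j', j' ≠ j → Inc (X i) (X j') → ∀ J : Finset ι,
      (∀ j'' ∈ J, Inc (X i) (X j'') ∧ Coll (X j) (X j') (X j'')) → J.card ≤ k) :
    LineSystem (fun i => (X i).1 / (1 + τ * (X i).2.1)) (fun i => (X i).2.1 / (1 + τ * (X i).2.1))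
      (fun i => ((X i).2.2 + τ * (X i).1 + τ ^ 3 * (X i).2.1) / (1 + τ * (X i).2.1)) G k := by
  have hinc : ∀ i j, Inc (X i) (X j) ↔
      (X i).1 / (1 + τ * (X i).2.1) + (X i).2.1 / (1 + τ * (X i).2.1) *
        (((X j).2.2 + τ * (X j).1 + τ ^ 3 * (X j).2.1) / (1 + τ * (X j).2.1)) =
      (X j).1 / (1 + τ * (X j).2.1) + (X j).2.1 / (1 + τ * (X j).2.1) *
        (((X i).2.2 + τ * (X i).1 + τ ^ 3 * (X i).2.1) / (1 + τ * (X i).2.1)) := by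
    intro i j
    have hi := h0 i
    have hj := h0 j
    rw [div_mul_div_comm, div_mul_div_comm, mul_comm (1 + τ * (X j).2.1),
      ← mul_div_mul_right _ _ hj, ← add_div, ← mul_div_mul_right (X j).1 _ hi,
      mul_comm (1 + τ * (X j).2.1), ← add_div,
      div_left_inj' (mul_ne_zero hi hj)]
    unfold Inc
    constructor <;> intro h <;> linear_combination h
  refine ⟨?_, fun i j h => (hinc i j).1 (hG i j h), ?_⟩
  · intro i j h
    rw [div_eq_div_iff (h0 i) (h0 j)] at h
    exact h1 i j h
  · intro i J α β γ δ hJ hi J' hJ' hGJ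
    by_cases hc : J'.card ≤ 1
    · exact hc.trans hk
    obtain ⟨j₁, m₁, j₂, m₂, hne⟩ := Finset.one_lt_card.1 (not_le.1 hc)
    refine (Finset.card_le_card hJ').trans
      (hreg i j₁ (hGJ _ m₁) j₂ hne.symm ((hinc i j₂).2 (hi _ (hJ' m₂))) J fun j hj =>
      ⟨(hinc i j).2 (hi _ hj), ?_⟩)
    obtain ⟨a1, b1⟩ := hJ _ (hJ' m₁)
    obtain ⟨a2, b2⟩ := hJ _ (hJ' m₂)
    obtain ⟨a3, b3⟩ := hJ _ hj
    have hl := mt (h1 j₁ j₂) hne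
    have k1 := h0 j₁
    have k2 := h0 j₂
    have k3 := h0 j
    rw [div_eq_iff k1, add_mul, mul_assoc, div_mul_cancel₀ _ k1] at a1 b1
    rw [div_eq_iff k2, add_mul, mul_assoc, div_mul_cancel₀ _ k2] at a2 b2
    rw [div_eq_iff k3, add_mul, mul_assoc, div_mul_cancel₀ _ k3] at a3 b3
    exact coll_of_generic hl a1 b1 a2 b2 a3 b3

theorem edges_le_of_inc {F ι : Type*} [Field F] [Fintype ι] (p : ℕ) [CharP F p]
    {X : ι → F × F × F} (hX : Function.Injective X) {G : ι → ι → Prop} {k : ℕ} (hk : 1 ≤ k)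
    (hkp : 1000 * k ≤ p) (hp : 10 ^ 6 * Fintype.card ι ≤ p ^ 2)
    (hG : ∀ i j, G i j → Inc (X i) (X j))
    (hreg : ∀ i j, G i j → ∀ j', j' ≠ j → Inc (X i) (X j') → ∀ J : Finset ι,
      (∀ j'' ∈ J, Inc (X i) (X j'') ∧ Coll (X j) (X j') (X j'')) → J.card ≤ k) :
    (edges G Finset.univ Finset.univ : ℝ) ≤
      100 * (2 * (Fintype.card ι * √(Fintype.card ι)) + k * Fintype.card ι) := by
  let φ := algebraMap F (AlgebraicClosure F)
  have hφ : Function.Injective φ := φ.injective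
  have : CharP (AlgebraicClosure F) p := charP_of_injective_algebraMap hφ p
  let Y : ι → AlgebraicClosure F × AlgebraicClosure F × AlgebraicClosure F :=
    fun i => (φ (X i).1, φ (X i).2.1, φ (X i).2.2)
  have hY : Function.Injective Y := fun i j h => by
    simp only [Y, Prod.mk.injEq, hφ.eq_iff] at h
    exact hX (Prod.ext h.1 (Prod.ext h.2.1 h.2.2))
  have hI : ∀ i j, Inc (Y i) (Y j) ↔ Inc (X i) (X j) := fun i j => by
    simp only [Inc, Y, ← map_mul, ← map_add, hφ.eq_iff]
  have hC : ∀ i j k, Coll (Y i) (Y j) (Y k) ↔ Coll (X i) (X j) (X k) := fun i j k => by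
    simp only [Coll, Y, ← map_mul, ← map_sub, hφ.eq_iff]
  obtain ⟨τ, h0, h1⟩ := exists_generic hY
  have hS := lineSystem_of_generic (G := G) (k := k) h0 h1 hk (fun i j h => (hI i j).2 (hG i j h))
    (fun i j h j' hne hj' J hJ => hreg i j h j' hne ((hI i j').1 hj') J fun j'' hj'' =>
      ⟨(hI _ _).1 (hJ _ hj'').1, (hC _ _ _).1 (hJ _ hj'').2⟩)
  have := hS.edges_le p hkp Finset.univ Finset.univ (by simpa using hp)
  simp only [Finset.card_univ] at this
  linarith

section

open Finset

section Curves
variable {F : Type*} [Field F]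

/-- The form whose level sets are the curves with label `y`. -/
def lev (y : F × F × F) (a : F × F) : F := y.1 * (a.1 * a.2) + y.2.1 * a.1 + y.2.2 * a.2

/-- A normalized label: the circles about a point, or the lines in a direction. -/
def IsLabel (y : F × F × F) : Prop := y.1 = 1 ∨ y.1 = 0 ∧ y.2.1 = 1

/-- The curve `lev y = h` is irreducible. -/
def Nondeg (y : F × F × F) (h : F) : Prop := y.1 * h + y.2.1 * y.2.2 ≠ 0

theorem label_eq {y y' : F × F × F} {h h' : F} (hy : IsLabel y) (hy' : IsLabel y')
    (hn : Nondeg y h) (hn' : Nondeg y' h')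
    (h₂ : y.2.2 * y'.1 = y'.2.2 * y.1)
    (h₁ : y.2.2 * y'.2.1 - h * y'.1 = y'.2.2 * y.2.1 - h' * y.1)
    (h₀ : h * y'.2.1 = h' * y.2.1) : y = y' ∧ h = h' := by
  obtain ⟨e, f, g⟩ := y
  obtain ⟨e', f', g'⟩ := y'
  simp only [IsLabel, Nondeg] at *
  rcases hy with rfl | ⟨rfl, rfl⟩ <;> rcases hy' with rfl | ⟨rfl, rfl⟩
  · have hg : g = g' := by linear_combination h₂
    subst hg
    have : (h + f * g) * (f' - f) = 0 := by linear_combination h₀ + f * h₁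
    rcases mul_eq_zero.1 this with h3 | h3
    · exact absurd (by linear_combination h3) hn
    · have : f' = f := by linear_combination h3
      subst this
      exact ⟨rfl, by linear_combination -h₁⟩
  · exact absurd (by linear_combination -h₂) hn'
  · exact absurd (by linear_combination h₂) hn
  · exact ⟨by rw [show g = g' by linear_combination h₁], by linear_combination h₀⟩

theorem card_inter_le {y y' : F × F × F} {h h' : F} (hy : IsLabel y) (hy' : IsLabel y')
    (hn : Nondeg y h) (hn' : Nondeg y' h') (hne : ¬(y = y' ∧ h = h')) (s : Finset (F × F))
    (hs : ∀ a ∈ s, lev y a = h ∧ lev y' a = h') : s.card ≤ 2 := by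
  classical
  have h0 : ∀ a ∈ s, y.1 * a.2 + y.2.1 ≠ 0 := fun a ha h1 => hn (by
    have := (hs a ha).1
    unfold lev at this
    linear_combination (-y.1) * this + (y.1 * a.1 + y.2.2) * h1)
  have hinj : Set.InjOn Prod.snd (s : Set (F × F)) := fun a ha b hb hab => by
    have h1 := (hs a ha).1
    have h2 := (hs b hb).1
    refine Prod.ext (mul_right_cancel₀ (h0 a ha) ?_) hab
    unfold lev at h1 h2
    rw [← hab] at h2
    linear_combination h1 - h2
  rw [← card_image_of_injOn hinj]
  let P : Polynomial F := Polynomial.C (y.2.2 * y'.1 - y'.2.2 * y.1) * Polynomial.X ^ 2 +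
    Polynomial.C (y.2.2 * y'.2.1 - h * y'.1 - (y'.2.2 * y.2.1 - h' * y.1)) * Polynomial.X +
    Polynomial.C (-(h * y'.2.1 - h' * y.2.1))
  have hP : P ≠ 0 := fun hP => hne (by
    have c0 := congrArg (fun f => Polynomial.coeff f 0) hP
    have c1 := congrArg (fun f => Polynomial.coeff f 1) hP
    have c2 := congrArg (fun f => Polynomial.coeff f 2) hP
    simp only [P, Polynomial.coeff_zero, Polynomial.coeff_add, Polynomial.coeff_C_mul,
      Polynomial.coeff_X_pow, Polynomial.coeff_X, Polynomial.coeff_C] at c0 c1 c2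
    norm_num at c0 c1 c2
    exact label_eq hy hy' hn hn' (sub_eq_zero.1 c2) (sub_eq_zero.1 c1)
      (by linear_combination -c0))
  refine (Polynomial.card_le_degree_of_subset_roots (p := P) fun t ht => ?_).trans
    Polynomial.natDegree_quadratic_le
  obtain ⟨a, ha, rfl⟩ := mem_image.1 ht
  rw [Polynomial.mem_roots hP, Polynomial.IsRoot]
  obtain ⟨h1, h2⟩ := hs a ha
  simp only [P, Polynomial.eval_add, Polynomial.eval_mul, Polynomial.eval_C, Polynomial.eval_X,
    Polynomial.eval_pow]
  unfold lev at h1 h2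
  linear_combination (y'.1 * a.2 + y'.2.1) * h1 - (y.1 * a.2 + y.2.1) * h2

end Curves

/-- Sets with more than `2 √n` points each and pairwise intersections of size at most two have
total size at most `2 n`. -/
theorem sum_card_filter_le {α γ : Type*} [DecidableEq γ] (A : Finset α) (C : Finset γ)
    (r : γ → α → Prop) [∀ c, DecidablePred (r c)] {k : ℕ} (hk : 4 * A.card ≤ k ^ 2)
    (hC : ∀ c ∈ C, k ≤ (A.filter (r c)).card)
    (hCC : ∀ c ∈ C, ∀ c' ∈ C, c ≠ c' → (A.filter fun a => r c a ∧ r c' a).card ≤ 2) :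
    ∑ c ∈ C, (A.filter (r c)).card ≤ 2 * A.card := by
  set I := ∑ c ∈ C, (A.filter (r c)).card with hI
  have h1 : C.card * k ≤ I := by
    simpa using card_nsmul_le_sum C _ k hC
  have h2 : I = ∑ a ∈ A, (C.filter fun c => r c a).card := by
    simp only [hI, card_filter]
    exact sum_comm
  have h3 : I ^ 2 ≤ A.card * ∑ a ∈ A, (C.filter fun c => r c a).card ^ 2 := by
    rw [h2]; exact sq_sum_le_card_mul_sum_sq
  have h4 : ∑ a ∈ A, (C.filter fun c => r c a).card ^ 2 =
      ∑ c ∈ C, ∑ c' ∈ C, (A.filter fun a => r c a ∧ r c' a).card := by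
    simp only [card_filter, sq, sum_mul_sum]
    rw [sum_comm]
    refine sum_congr rfl fun c _ => ?_
    rw [sum_comm]
    refine sum_congr rfl fun c' _ => sum_congr rfl fun a _ => ?_
    by_cases h : r c a <;> by_cases h' : r c' a <;> simp [h, h']
  have h5 : ∑ c ∈ C, ∑ c' ∈ C, (A.filter fun a => r c a ∧ r c' a).card ≤ I + 2 * C.card ^ 2 := by
    have : ∀ c ∈ C, ∑ c' ∈ C, (A.filter fun a => r c a ∧ r c' a).card ≤
        (A.filter (r c)).card + 2 * C.card := fun c hc => by
      rw [← add_sum_erase C _ hc]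
      refine add_le_add (card_le_card fun a => by simp +contextual) ?_
      refine (sum_le_card_nsmul _ _ 2 fun c' hc' =>
        hCC c hc c' (mem_of_mem_erase hc') (ne_of_mem_erase hc').symm).trans ?_
      have := card_erase_le (s := C) (a := c)
      simp only [smul_eq_mul]
      omega
    refine (sum_le_sum this).trans ?_
    rw [sum_add_distrib, sum_const, smul_eq_mul, ← hI]
    nlinarith
  have h6 : I ^ 2 ≤ A.card * (I + 2 * C.card ^ 2) :=
    h3.trans (Nat.mul_le_mul_left _ (h4.le.trans h5))
  have h7 : 8 * A.card * C.card ^ 2 ≤ 2 * I ^ 2 := by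
    calc 8 * A.card * C.card ^ 2 = 2 * (4 * A.card * C.card ^ 2) := by ring
      _ ≤ 2 * (k ^ 2 * C.card ^ 2) := by gcongr
      _ = 2 * (C.card * k) ^ 2 := by ring
      _ ≤ 2 * I ^ 2 := by gcongr
  by_contra! h8
  nlinarith

section Rich
variable {F : Type*} [Field F]

open scoped Classical in
/-- The curve through `a` with label `y` is irreducible and contains more than `k` points of `A`. -/
def Rich (A : Finset (F × F)) (k : ℕ) (y : F × F × F) (a : F × F) : Prop :=
  IsLabel y ∧ Nondeg y (lev y a) ∧ k < (A.filter fun b => lev y b = lev y a).card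

open scoped Classical in
theorem sum_card_rich_le [Fintype F] (A : Finset (F × F)) {k : ℕ} (hk : 4 * A.card ≤ k ^ 2) :
    ∑ y, (A.filter (Rich A k y)).card ≤ 2 * A.card := by
  let C : Finset ((F × F × F) × F) := univ.filter fun c =>
    IsLabel c.1 ∧ Nondeg c.1 c.2 ∧ k < (A.filter fun b => lev c.1 b = c.2).card
  refine le_trans ?_ (sum_card_filter_le A C (fun c a => lev c.1 a = c.2) hk
    (fun c hc => (mem_filter.1 hc).2.2.2.le) fun c hc c' hc' hne => ?_)
  · simp only [C]
    rw [sum_filter]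
    refine le_of_le_of_eq ?_ (Fintype.sum_prod_type _).symm
    refine sum_le_sum (fun y _ => ?_)
    rw [← sum_filter]
    refine le_trans (card_le_card fun a ha => ?_) card_biUnion_le
    obtain ⟨ha, hr⟩ := mem_filter.1 ha
    exact mem_biUnion.2 ⟨lev y a, mem_filter.2 ⟨mem_univ _, hr⟩, mem_filter.2 ⟨ha, rfl⟩⟩
  · have h1 := (mem_filter.1 hc).2
    have h2 := (mem_filter.1 hc').2
    exact card_inter_le h1.1 h2.1 h1.2.1 h2.2.1 (fun h => hne (Prod.ext h.1 h.2)) _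
      fun a ha => (mem_filter.1 ha).2

end Rich

section Axes
variable {F : Type*} [Field F] {a b c d x : F × F} {κ κ' : F × F} {y y' : F × F × F}

/-- The squared distance in isotropic coordinates. -/
def nrm (a x : F × F) : F := (a.1 - x.1) * (a.2 - x.2)

/-- The two points differ in both isotropic coordinates. -/
def NonIso (a b : F × F) : Prop := a.1 ≠ b.1 ∧ a.2 ≠ b.2

/-- The axis of the reflection swapping `a` and `b`: the line `u = κ.1 * v + κ.2`. -/
def key (a b : F × F) : F × F :=
  ((b.1 - a.1) / (a.2 - b.2), b.1 - (b.1 - a.1) / (a.2 - b.2) * a.2)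

/-- The reflection in the line `u = κ.1 * v + κ.2` swaps `a` and `b`. -/
def Axis (κ a b : F × F) : Prop := b.1 = κ.1 * a.2 + κ.2 ∧ a.1 = κ.1 * b.2 + κ.2

/-- The line `u = κ.1 * v + κ.2` passes through the label `y`. -/
def Thru (κ : F × F) (y : F × F × F) : Prop := y.2.2 = κ.1 * y.2.1 - y.1 * κ.2

theorem NonIso.axis_key (h : NonIso a b) : Axis (key a b) a b := by
  have := sub_ne_zero.2 h.2
  constructor
  · simp only [key]; ring
  · simp only [key]; field_simp; ring

theorem Axis.symm (h : Axis κ a b) : Axis κ b a := ⟨h.2, h.1⟩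

theorem NonIso.key_fst_ne_zero (h : NonIso a b) : (key a b).1 ≠ 0 :=
  div_ne_zero (sub_ne_zero.2 h.1.symm) (sub_ne_zero.2 h.2)

theorem Axis.right_unique (hκ : κ.1 ≠ 0) (h : Axis κ a b) (h' : Axis κ a c) : b = c :=
  Prod.ext (h.1.trans h'.1.symm) (mul_left_cancel₀ hκ (add_right_cancel (h.2.symm.trans h'.2)))

theorem Axis.lev_eq (hκ : κ.1 ≠ 0) (h : Axis κ a b) (hy : Thru κ y) : lev y a = lev y b := by
  apply mul_left_cancel₀ hκ
  unfold Axis Thru at *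
  unfold lev
  rw [h.1, hy, h.2]
  ring

theorem Axis.nrm_eq (h : Axis κ a b) (h' : Axis κ c d) : nrm a c = nrm b d := by
  unfold nrm
  rw [h.1, h.2, h'.1, h'.2]
  ring

theorem NonIso.nrm_eq_iff (h : NonIso a b) :
    nrm a x = nrm b x ↔ Thru (key a b) (1, -x.2, -x.1) := by
  have := sub_ne_zero.2 h.2
  simp only [nrm, Thru, key]
  field_simp
  constructor <;> intro h
  · linear_combination h
  · linear_combination h

theorem nonIso_of_nrm (hab : a ≠ b) (h : nrm a x = nrm b x) (h0 : nrm a x ≠ 0) : NonIso a b := by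
  unfold nrm at *
  constructor <;> intro h1 <;> apply hab
  · refine Prod.ext h1 ?_
    rw [← h1] at h
    linear_combination mul_left_cancel₀ (left_ne_zero_of_mul h0) h
  · refine Prod.ext ?_ h1
    rw [← h1] at h
    linear_combination mul_right_cancel₀ (right_ne_zero_of_mul h0) h

theorem Thru.unique (hy : IsLabel y) (hy' : IsLabel y') (hne : y ≠ y') (h : Thru κ y)
    (h' : Thru κ y') (k : Thru κ' y) (k' : Thru κ' y') : κ = κ' := by
  obtain ⟨e, f, g⟩ := y
  obtain ⟨e', f', g'⟩ := y'
  simp only [Thru, IsLabel] at *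
  have key : κ.1 = κ'.1 := by
    rcases hy with rfl | ⟨rfl, rfl⟩ <;> rcases hy' with rfl | ⟨rfl, rfl⟩
    · have h1 : (κ.1 - κ'.1) * (f - f') = 0 := by linear_combination -h + h' + k - k'
      rcases mul_eq_zero.1 h1 with h2 | h2
      · exact sub_eq_zero.1 h2
      · have hf : f = f' := sub_eq_zero.1 h2
        subst hf
        exact absurd (by rw [show g = g' by linear_combination h - h']) hne
    · linear_combination k' - h'
    · linear_combination k - h
    · linear_combination k - h
  refine Prod.ext key ?_
  rcases hy with rfl | ⟨rfl, rfl⟩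
  · rw [key] at h
    linear_combination h - k
  · rcases hy' with rfl | ⟨rfl, rfl⟩
    · rw [key] at h'
      linear_combination h' - k'
    · exact absurd (by rw [show g = g' by linear_combination h - h']) hne

end Axes

theorem card_le_of_fibers {α β γ : Type*} {s : Finset α} {t : Finset β} (f : α → β) (g : α → γ)
    (U : β → Finset γ) {n : ℕ} (hf : ∀ x ∈ s, f x ∈ t) (hg : ∀ x ∈ s, g x ∈ U (f x))
    (hU : ∀ b ∈ t, (U b).card ≤ n)
    (hinj : ∀ x ∈ s, ∀ x' ∈ s, f x = f x' → g x = g x' → x = x') : s.card ≤ n * t.card := by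
  classical
  refine card_le_mul_card_image_of_maps_to hf n fun b hb => le_trans ?_ (hU b hb)
  refine card_le_card_of_injOn g (fun x hx => ?_) fun x hx x' hx' h => ?_
  · obtain ⟨h1, rfl⟩ := mem_filter.1 hx
    exact hg x h1
  · obtain ⟨h1, h2⟩ := mem_filter.1 hx
    obtain ⟨h3, h4⟩ := mem_filter.1 hx'
    exact hinj x h1 x' h3 (h2.trans h4.symm) h

/-- An incidence bound for a weighted family of lines. -/
theorem sum_incidence_le {ξ γ θ : Type*} [DecidableEq θ] {A S : Finset ξ} (hA : A ⊆ S) {p : ℕ}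
    (hp : 0 < p) (hS : S.card = p ^ 2) (P : Finset γ) (κ : γ → θ) (on : θ → ξ → Prop)
    [∀ t, DecidablePred (on t)]
    (h₁ : ∀ c ∈ P, (S.filter (on (κ c))).card = p)
    (h₂ : ∀ c ∈ P, ∀ c' ∈ P, κ c ≠ κ c' →
      (S.filter fun x => on (κ c) x ∧ on (κ c') x).card ≤ 1) :
    ((∑ x ∈ A, (P.filter fun c => on (κ c) x).card : ℕ) : ℝ) ≤ A.card * P.card / p +
      √(p * A.card * ((P ×ˢ P).filter fun z => κ z.1 = κ z.2).card) := by
  set W : ξ → ℝ := fun x => (P.filter fun c => on (κ c) x).card with hW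
  set Q := ((P ×ˢ P).filter fun z => κ z.1 = κ z.2).card with hQ
  set w : ℝ := P.card / p with hw
  have hp' : (p : ℝ) ≠ 0 := by positivity
  have e1 : ∑ x ∈ S, W x = p * P.card := by
    have : ∑ x ∈ S, (P.filter fun c => on (κ c) x).card = p * P.card := by
      simp only [card_filter]
      rw [sum_comm, mul_comm]
      simp only [← card_filter]
      rw [sum_congr rfl h₁, sum_const, smul_eq_mul]
    simp only [hW]
    exact_mod_cast this
  have e2 : ∑ x ∈ S, W x ^ 2 ≤ p * Q + (P.card : ℝ) ^ 2 := by
    have : ∑ x ∈ S, (P.filter fun c => on (κ c) x).card ^ 2 ≤ p * Q + P.card ^ 2 := by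
      have f1 : ∑ x ∈ S, (P.filter fun c => on (κ c) x).card ^ 2 =
          ∑ z ∈ P ×ˢ P, (S.filter fun x => on (κ z.1) x ∧ on (κ z.2) x).card := by
        simp only [card_filter, sq, sum_mul_sum, sum_product]
        rw [sum_comm]
        refine sum_congr rfl fun c _ => ?_
        rw [sum_comm]
        refine sum_congr rfl fun c' _ => sum_congr rfl fun a _ => ?_
        by_cases h : on (κ c) a <;> by_cases h' : on (κ c') a <;> simp [h, h']
      rw [f1, ← sum_filter_add_sum_filter_not _ (fun z => κ z.1 = κ z.2)]
      refine add_le_add ?_ ?_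
      · rw [mul_comm, hQ]
        refine sum_le_card_nsmul _ _ p fun z hz => ?_
        obtain ⟨hz, he⟩ := mem_filter.1 hz
        simp only [he, and_self]
        exact (h₁ _ (mem_product.1 hz).2).le
      · refine (sum_le_card_nsmul _ _ 1 fun z hz => ?_).trans ?_
        · obtain ⟨hz, he⟩ := mem_filter.1 hz
          exact h₂ _ (mem_product.1 hz).1 _ (mem_product.1 hz).2 he
        · rw [smul_eq_mul, mul_one, sq, ← card_product]
          exact card_filter_le _ _
    simp only [hW]
    exact_mod_cast this
  have e3 : ∑ x ∈ S, (W x - w) ^ 2 ≤ p * Q := by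
    have : ∑ x ∈ S, (W x - w) ^ 2 = ∑ x ∈ S, W x ^ 2 - 2 * w * ∑ x ∈ S, W x + S.card * w ^ 2 := by
      rw [mul_sum, ← sum_sub_distrib, ← nsmul_eq_mul, ← sum_const, ← sum_add_distrib]
      exact sum_congr rfl fun x _ => by ring
    rw [this, e1, hS]
    have f1 : w * p = P.card := div_mul_cancel₀ _ hp'
    have f2 : 2 * w * (p * P.card) = 2 * (P.card : ℝ) ^ 2 := by
      rw [← f1]; ring
    have f3 : ((p ^ 2 : ℕ) : ℝ) * w ^ 2 = (P.card : ℝ) ^ 2 := by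
      rw [← f1]; push_cast; ring
    rw [f2, f3]
    linarith
  have e4 : ∑ x ∈ A, (W x - w) ≤ √(p * A.card * Q) := by
    apply Real.le_sqrt_of_sq_le
    calc (∑ x ∈ A, (W x - w)) ^ 2 ≤ A.card * ∑ x ∈ A, (W x - w) ^ 2 := sq_sum_le_card_mul_sum_sq
      _ ≤ A.card * ∑ x ∈ S, (W x - w) ^ 2 := by
        gcongr
      _ ≤ A.card * (p * Q) := by gcongr
      _ = p * A.card * Q := by ring
  rw [sum_sub_distrib, sum_const, nsmul_eq_mul, hw] at e4
  push_cast
  rw [mul_div_assoc]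
  linarith

section Bad
variable {F : Type*} [Field F] {A : Finset (F × F)} {k : ℕ} {r : F}

/-- The point of three-space attached to a pair of points at distance `r`. -/
def pt (r : F) (s : (F × F) × (F × F)) : F × F × F :=
  (s.1.1, (s.2.1 - s.1.1) * s.1.2 / r, s.2.1 - s.1.1)

theorem sub_mul_sub_of_nrm {a c : F × F} (h : nrm a c = r) :
    (c.1 - a.1) * (c.2 - a.2) = r := by
  rw [← h, nrm]; ring

theorem pt_injOn (hr : r ≠ 0) {s t : (F × F) × (F × F)} (hs : nrm s.1 s.2 = r)
    (ht : nrm t.1 t.2 = r) (h : pt r s = pt r t) : s = t := by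
  obtain ⟨⟨a₁, a₂⟩, ⟨c₁, c₂⟩⟩ := s
  obtain ⟨⟨b₁, b₂⟩, ⟨d₁, d₂⟩⟩ := t
  have hs := sub_mul_sub_of_nrm hs
  have ht := sub_mul_sub_of_nrm ht
  simp only [pt, Prod.mk.injEq, div_left_inj' hr] at *
  obtain ⟨rfl, h2, h3⟩ := h
  have hl : c₁ - a₁ ≠ 0 := left_ne_zero_of_mul (hs.trans_ne hr)
  rw [← h3] at h2 ht
  obtain rfl := mul_left_cancel₀ hl h2
  have h4 := mul_left_cancel₀ hl (hs.trans ht.symm)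
  have h5 : c₁ = d₁ := by linear_combination h3
  have h6 : c₂ = d₂ := by linear_combination h4
  simp [h5, h6]

theorem Axis.mul_eq {κ a b c d : F × F} (h : Axis κ a b) (h' : Axis κ c d) (hac : nrm a c = r) :
    (c.1 - a.1) * (d.1 - b.1) = κ.1 * r := by
  rw [← hac, nrm, h.1, h'.1]; ring

theorem Axis.inc {κ a b c d : F × F} (h : Axis κ a b) (h' : Axis κ c d) (hr : r ≠ 0)
    (hac : nrm a c = r) : Inc (pt r (a, c)) (pt r (b, d)) := by
  have h1 := h.mul_eq h' hac
  simp only [Inc, pt]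
  have e1 : (c.1 - a.1) * a.2 / r * (d.1 - b.1) = κ.1 * a.2 := by
    field_simp; linear_combination a.2 * h1
  have e2 : (d.1 - b.1) * b.2 / r * (c.1 - a.1) = κ.1 * b.2 := by
    field_simp; linear_combination b.2 * h1
  rw [e1, e2]
  linear_combination h.2 - h.1

theorem rich_of_injOn {θ : Type*} {y : F × F × F} {a : F × F} {h : F} (hy : IsLabel y)
    (hn : Nondeg y h) (ha : lev y a = h) (J : Finset θ) (f : θ → F × F) (hf : Set.InjOn f J)
    (hJ : ∀ z ∈ J, f z ∈ A ∧ lev y (f z) = h) (hk : k < J.card) : Rich A k y a := by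
  classical
  subst ha
  refine ⟨hy, hn, hk.trans_le ?_⟩
  rw [← card_image_of_injOn hf]
  refine card_le_card fun x hx => ?_
  obtain ⟨z, hz, rfl⟩ := mem_image.1 hx
  rw [mem_filter]
  exact hJ z hz

open scoped Classical in
theorem rich_or_of_family {θ : Type*} (hcol : ∀ α, (A.filter fun a => a.1 = α).card ≤ k)
    (hr : r ≠ 0) {α D β γ : F} (hβγ : ¬(β = 0 ∧ γ = 0)) (J : Finset θ) (f : θ → F × F) (l : θ → F)
    (hf : ∀ z ∈ J, f z ∈ A ∧ (f z).1 = α + β * l z ∧ l z * ((f z).2 - D) = r * γ)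
    (hl : ∀ z ∈ J, ∀ z' ∈ J, f z = f z' → l z = l z' → z = z') (hk : k < J.card) {q : F × F}
    (hq : (q.1 - α) * (q.2 - D) = r * (β * γ)) :
    β ≠ 0 ∧ (γ ≠ 0 → Rich A k (1, -D, -α) q) := by
  have hinj : Set.InjOn f (J : Set θ) := fun z hz z' hz' h => by
    obtain ⟨-, h1, h2⟩ := hf z hz
    obtain ⟨-, h3, h4⟩ := hf z' hz'
    refine hl z hz z' hz' h ?_
    rw [h] at h1 h2
    by_cases hβ : β = 0
    · have hγ : r * γ ≠ 0 := mul_ne_zero hr fun h => hβγ ⟨hβ, h⟩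
      exact mul_right_cancel₀ (right_ne_zero_of_mul (h2.trans_ne hγ)) (h2.trans h4.symm)
    · exact mul_left_cancel₀ hβ (add_left_cancel (h1.symm.trans h3))
  refine ⟨fun hβ => ?_, fun hγ => ?_⟩
  · refine absurd (hcol α) (not_le.2 (hk.trans_le ?_))
    rw [← card_image_of_injOn hinj]
    refine card_le_card fun x hx => ?_
    obtain ⟨z, hz, rfl⟩ := mem_image.1 hx
    obtain ⟨h0, h1, -⟩ := hf z hz
    exact mem_filter.2 ⟨h0, by rw [h1, hβ]; ring⟩
  · by_cases hβ : β = 0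
    · refine absurd (hcol α) (not_le.2 (hk.trans_le ?_))
      rw [← card_image_of_injOn hinj]
      refine card_le_card fun x hx => ?_
      obtain ⟨z, hz, rfl⟩ := mem_image.1 hx
      obtain ⟨h0, h1, -⟩ := hf z hz
      exact mem_filter.2 ⟨h0, by rw [h1, hβ]; ring⟩
    refine rich_of_injOn (h := r * (β * γ) - α * D) (Or.inl rfl) ?_ ?_ J f hinj
      (fun z hz => ?_) hk
    · have : r * (β * γ) ≠ 0 := mul_ne_zero hr (mul_ne_zero hβ hγ)
      intro h
      simp only at h
      exact this (by linear_combination h)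
    · simp only [lev]
      linear_combination hq
    · obtain ⟨h0, h1, h2⟩ := hf z hz
      refine ⟨h0, ?_⟩
      simp only [lev]
      rw [h1]
      linear_combination β * h2

open scoped Classical in
theorem exists_rich_of_parallel {κ a b c d : F × F} (hr : r ≠ 0) (hac : nrm a c = r)
    (hbd : nrm b d = r) (h : Axis κ a b) (h' : Axis κ c d) (hκ : κ.1 ≠ 0)
    (J : Finset ((F × F) × (F × F)))
    (hJ : ∀ z ∈ J, z.1 ∈ A ∧ z.2 ∈ A ∧ nrm z.1 z.2 = r ∧ Inc (pt r (a, c)) (pt r z) ∧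
      z.2.1 - z.1.1 = d.1 - b.1) (hk : k < J.card) :
    Rich A k (0, 1, κ.1) a ∧ Rich A k (0, 1, κ.1) c := by
  have hm := h.mul_eq h' hac
  have hs := sub_mul_sub_of_nrm hac
  have hlt : d.1 - b.1 ≠ 0 := left_ne_zero_of_mul ((sub_mul_sub_of_nrm hbd).trans_ne hr)
  have hls : c.1 - a.1 ≠ 0 := left_ne_zero_of_mul (hs.trans_ne hr)
  have hn : ∀ h : F, Nondeg (0, 1, κ.1) h := fun h => by simpa [Nondeg] using hκ
  have key : ∀ z ∈ J, lev (0, 1, κ.1) z.1 = lev (0, 1, κ.1) a ∧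
      lev (0, 1, κ.1) z.2 = lev (0, 1, κ.1) c := fun z hz => by
    obtain ⟨-, -, h3, h4, h5⟩ := hJ z hz
    have h6 := sub_mul_sub_of_nrm h3
    simp only [Inc, pt, h5] at h4
    rw [h5] at h6
    have e1 : (c.1 - a.1) * a.2 / r * (d.1 - b.1) = κ.1 * a.2 := by
      field_simp; linear_combination a.2 * hm
    have e2 : (d.1 - b.1) * z.1.2 / r * (c.1 - a.1) = κ.1 * z.1.2 := by
      field_simp; linear_combination z.1.2 * hm
    rw [e1, e2] at h4
    have e3 : κ.1 * (z.2.2 - z.1.2) = c.1 - a.1 := by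
      apply mul_left_cancel₀ hlt
      linear_combination κ.1 * h6 - hm
    have e4 : κ.1 * (c.2 - a.2) = d.1 - b.1 := by
      apply mul_left_cancel₀ hls
      linear_combination κ.1 * hs - hm
    simp only [lev]
    constructor
    · linear_combination -h4
    · linear_combination e3 - e4 + h5 - h4
  have hinj : ∀ z ∈ J, ∀ z' ∈ J, z.1.1 - z'.1.1 = z.2.1 - z'.2.1 ∧
      z.1.2 - z'.1.2 = z.2.2 - z'.2.2 := fun z hz z' hz' => by
    obtain ⟨-, -, h3, -, h5⟩ := hJ z hz
    obtain ⟨-, -, k3, -, k5⟩ := hJ z' hz'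
    have h6 := sub_mul_sub_of_nrm h3
    have k6 := sub_mul_sub_of_nrm k3
    rw [h5] at h6
    rw [k5] at k6
    have := mul_left_cancel₀ hlt (h6.trans k6.symm)
    exact ⟨by linear_combination k5 - h5, by linear_combination -this⟩
  constructor
  · refine rich_of_injOn (Or.inr ⟨rfl, rfl⟩) (hn _) rfl J Prod.fst (fun z hz z' hz' e => ?_)
      (fun z hz => ⟨(hJ z hz).1, (key z hz).1⟩) hk
    obtain ⟨i1, i2⟩ := hinj z hz z' hz'
    rw [e, sub_self] at i1 i2
    exact Prod.ext e (Prod.ext (sub_eq_zero.1 i1.symm) (sub_eq_zero.1 i2.symm))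
  · refine rich_of_injOn (Or.inr ⟨rfl, rfl⟩) (hn _) rfl J Prod.snd (fun z hz z' hz' e => ?_)
      (fun z hz => ⟨(hJ z hz).2.1, (key z hz).2⟩) hk
    obtain ⟨i1, i2⟩ := hinj z hz z' hz'
    rw [e, sub_self] at i1 i2
    exact Prod.ext (Prod.ext (sub_eq_zero.1 i1) (sub_eq_zero.1 i2)) e

open scoped Classical in
/-- A pair of pairs that is not in general position comes from a label with rich curves. -/
theorem exists_label (hcol : ∀ α, (A.filter fun a => a.1 = α).card ≤ k) {κ a b c d : F × F}
    (hr : r ≠ 0) (hac : nrm a c = r) (hbd : nrm b d = r) (h : Axis κ a b) (h' : Axis κ c d)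
    (hab : a.1 ≠ b.1) (hcd : c.1 ≠ d.1) (hκ : κ.1 ≠ 0) {t' : (F × F) × (F × F)}
    (ht' : nrm t'.1 t'.2 = r) (hne : t' ≠ (b, d)) (hi' : Inc (pt r (a, c)) (pt r t'))
    (J : Finset ((F × F) × (F × F)))
    (hJ : ∀ z ∈ J, z.1 ∈ A ∧ z.2 ∈ A ∧ nrm z.1 z.2 = r ∧ Inc (pt r (a, c)) (pt r z) ∧
      Coll (pt r (b, d)) (pt r t') (pt r z)) (hk : k < J.card) :
    ∃ y, Thru κ y ∧ (Rich A k y a ∧ Rich A k y c ∨ a.1 = -y.2.2 ∧ Rich A k y c ∨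
      c.1 = -y.2.2 ∧ Rich A k y a) := by
  have hi := h.inc h' hr hac
  have hs := sub_mul_sub_of_nrm hac
  have hls : c.1 - a.1 ≠ 0 := left_ne_zero_of_mul (hs.trans_ne hr)
  have hm := h.mul_eq h' hac
  by_cases hpar : t'.2.1 - t'.1.1 = d.1 - b.1
  · refine ⟨(0, 1, κ.1), by simp [Thru], Or.inl ?_⟩
    refine exists_rich_of_parallel hr hac hbd h h' hκ J (fun z hz => ?_) hk
    obtain ⟨h1, h2, h3, h4, h5⟩ := hJ z hz
    refine ⟨h1, h2, h3, h4, ?_⟩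
    by_contra hz
    refine hne (pt_injOn hr ht' hbd ?_)
    obtain ⟨-, h6, h7⟩ := h5
    have e : (pt r t').2.2 = (pt r (b, d)).2.2 := hpar
    rw [e, sub_self, mul_zero, eq_comm, mul_eq_zero] at h6 h7
    have hz' : (pt r z).2.2 - (pt r (b, d)).2.2 ≠ 0 := sub_ne_zero.2 hz
    exact Prod.ext (sub_eq_zero.1 (h6.resolve_left hz'))
      (Prod.ext (sub_eq_zero.1 (h7.resolve_left hz')) e)
  · have hl : (pt r t').2.2 - (pt r (b, d)).2.2 ≠ 0 := sub_ne_zero.2 hpar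
    obtain ⟨α, β, hβ, hα⟩ : ∃ α β, (pt r t').1 = α + β * (pt r t').2.2 ∧
        (pt r (b, d)).1 = α + β * (pt r (b, d)).2.2 := by
      set β := ((pt r t').1 - (pt r (b, d)).1) / ((pt r t').2.2 - (pt r (b, d)).2.2) with hβ
      rw [eq_div_iff hl] at hβ
      exact ⟨(pt r (b, d)).1 - β * (pt r (b, d)).2.2, β, by linear_combination -hβ, by ring⟩
    obtain ⟨γ, δ, hδ, hγ⟩ : ∃ γ δ, (pt r t').2.1 = γ + δ * (pt r t').2.2 ∧
        (pt r (b, d)).2.1 = γ + δ * (pt r (b, d)).2.2 := by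
      set β := ((pt r t').2.1 - (pt r (b, d)).2.1) / ((pt r t').2.2 - (pt r (b, d)).2.2) with hβ
      rw [eq_div_iff hl] at hβ
      exact ⟨(pt r (b, d)).2.1 - β * (pt r (b, d)).2.2, β, by linear_combination -hβ, by ring⟩
    have hu : ∀ z ∈ J, (pt r z).1 = α + β * (pt r z).2.2 := fun z hz => by
      obtain ⟨-, h6, -⟩ := (hJ z hz).2.2.2.2
      apply mul_right_cancel₀ hl
      linear_combination h6 + ((pt r t').2.2 - (pt r z).2.2) * hα +
        ((pt r z).2.2 - (pt r (b, d)).2.2) * hβ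
    have hw : ∀ z ∈ J, (pt r z).2.1 = γ + δ * (pt r z).2.2 := fun z hz => by
      obtain ⟨-, -, h6⟩ := (hJ z hz).2.2.2.2
      apply mul_right_cancel₀ hl
      linear_combination h6 + ((pt r t').2.2 - (pt r z).2.2) * hγ +
        ((pt r z).2.2 - (pt r (b, d)).2.2) * hδ
    have hws : (pt r (a, c)).2.1 = β + δ * (pt r (a, c)).2.2 := by
      apply mul_right_cancel₀ hl
      unfold Inc at hi hi'
      linear_combination hi' - hi + hβ - hα + (pt r (a, c)).2.2 * (hδ - hγ)
    have hus : (pt r (a, c)).1 = α + γ * (pt r (a, c)).2.2 := by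
      unfold Inc at hi
      linear_combination hi - (pt r (b, d)).2.2 * hws + hα + (pt r (a, c)).2.2 * hγ
    have hw' : ∀ z : (F × F) × (F × F), ∀ γ, (pt r z).2.1 = γ + δ * (pt r z).2.2 →
        (z.2.1 - z.1.1) * (z.1.2 - r * δ) = r * γ := fun z γ hz => by
      simp only [pt, div_eq_iff hr] at hz
      linear_combination hz
    have hws := hw' _ _ hws
    have hw := fun z hz => hw' z _ (hw z hz)
    simp only [pt] at hus hu hα hws
    have hb0 : ¬(β = 0 ∧ γ = 0) := by
      rintro ⟨rfl, rfl⟩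
      exact hab (by linear_combination hus - hα)
    have hb1 : ¬(β + 1 = 0 ∧ γ + 1 = 0) := by
      rintro ⟨h1, h2⟩
      exact hcd (by linear_combination hus - hα + (c.1 - a.1) * h2 - (d.1 - b.1) * h1)
    obtain ⟨-, ra⟩ := rich_or_of_family (q := a) hcol hr hb0 J Prod.fst (fun z => z.2.1 - z.1.1)
      (α := α) (D := r * δ) (fun z hz => ⟨(hJ z hz).1, hu z hz, hw z hz⟩)
      (fun z hz z' hz' e1 e2 => by
        have h1 := sub_mul_sub_of_nrm (hJ z hz).2.2.1
        have h2 := sub_mul_sub_of_nrm (hJ z' hz').2.2.1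
        have h3 := left_ne_zero_of_mul (h2.trans_ne hr)
        rw [e2] at h1
        have h4 := mul_left_cancel₀ h3 (h1.trans h2.symm)
        rw [e1] at h4 e2
        exact Prod.ext e1 (Prod.ext (sub_left_injective e2) (sub_left_injective h4))) hk
      (by linear_combination (a.2 - r * δ) * hus + γ * hws)
    obtain ⟨-, rc⟩ := rich_or_of_family (q := c) hcol hr hb1 J Prod.snd (fun z => z.2.1 - z.1.1)
      (α := α) (D := r * δ) (fun z hz => ⟨(hJ z hz).2.1, by linear_combination hu z hz, by
        have h1 := sub_mul_sub_of_nrm (hJ z hz).2.2.1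
        linear_combination hw z hz + h1⟩)
      (fun z hz z' hz' e1 e2 => by
        have h1 := sub_mul_sub_of_nrm (hJ z hz).2.2.1
        have h2 := sub_mul_sub_of_nrm (hJ z' hz').2.2.1
        have h3 := left_ne_zero_of_mul (h2.trans_ne hr)
        rw [e2] at h1
        have h4 := mul_left_cancel₀ h3 (h1.trans h2.symm)
        rw [e1] at h4 e2
        exact Prod.ext (Prod.ext (sub_right_injective e2) (sub_right_injective h4)) e1) hk
      (by
        have h1 : (c.1 - a.1) * (c.2 - r * δ) = r * (β + 1) := by linear_combination hws + hs
        linear_combination (c.2 - r * δ) * hus + (γ + 1) * h1)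
    refine ⟨(1, -(r * δ), -α), ?_, ?_⟩
    · have h1 : κ.1 * (a.2 - r * δ) = β * (d.1 - b.1) := by
        apply mul_left_cancel₀ hls
        linear_combination κ.1 * hws - β * hm
      simp only [Thru]
      linear_combination hα - h.1 - h1
    · by_cases h0 : γ = 0
      · refine Or.inr (Or.inl ⟨?_, rc (by rw [h0, zero_add]; exact one_ne_zero)⟩)
        rw [hus, h0]; ring
      · by_cases h1 : γ + 1 = 0
        · exact Or.inr (Or.inr ⟨by linear_combination hus + (c.1 - a.1) * h1, ra h0⟩)
        · exact Or.inl ⟨ra h0, rc h1⟩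

end Bad

section Quads
variable {F : Type*} [Field F] {A : Finset (F × F)} {k : ℕ}

/-- Two pairs of points of `A` which are swapped by a common reflection. -/
structure IsQuad (A : Finset (F × F)) (z : ((F × F) × (F × F)) × ((F × F) × (F × F))) : Prop where
  mem₁₁ : z.1.1 ∈ A
  mem₁₂ : z.1.2 ∈ A
  mem₂₁ : z.2.1 ∈ A
  mem₂₂ : z.2.2 ∈ A
  nonIso₁ : NonIso z.1.1 z.1.2
  nonIso₂ : NonIso z.2.1 z.2.2
  key_eq : key z.1.1 z.1.2 = key z.2.1 z.2.2

variable {z z' : ((F × F) × (F × F)) × ((F × F) × (F × F))}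

theorem IsQuad.axis₁ (h : IsQuad A z) : Axis (key z.1.1 z.1.2) z.1.1 z.1.2 := h.nonIso₁.axis_key

theorem IsQuad.axis₂ (h : IsQuad A z) : Axis (key z.1.1 z.1.2) z.2.1 z.2.2 :=
  h.key_eq ▸ h.nonIso₂.axis_key

theorem IsQuad.eq_of_left (h : IsQuad A z) (h' : IsQuad A z') (h₁ : z.1 = z'.1)
    (h₂ : z.2.1 = z'.2.1) : z = z' := by
  refine Prod.ext h₁ (Prod.ext h₂ ?_)
  have h3 := h'.axis₂
  rw [← h₁, ← h₂] at h3
  exact h.axis₂.right_unique h.nonIso₁.key_fst_ne_zero h3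

theorem IsQuad.eq_of_left' (h : IsQuad A z) (h' : IsQuad A z') (h₁ : z.1 = z'.1)
    (h₂ : z.2.2 = z'.2.2) : z = z' := by
  refine Prod.ext h₁ (Prod.ext ?_ h₂)
  have h3 := h'.axis₂
  rw [← h₁, ← h₂] at h3
  exact h.axis₂.symm.right_unique h.nonIso₁.key_fst_ne_zero h3.symm

theorem IsQuad.eq_of_right (h : IsQuad A z) (h' : IsQuad A z') (h₁ : z.2 = z'.2)
    (h₂ : z.1.1 = z'.1.1) : z = z' := by
  refine Prod.ext (Prod.ext h₂ ?_) h₁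
  have h2 := h.axis₁
  have h3 := h'.axis₁
  have h4 := h.nonIso₁.key_fst_ne_zero
  rw [h.key_eq] at h2 h4
  rw [h'.key_eq, ← h₁, ← h₂] at h3
  exact h2.right_unique h4 h3

open scoped Classical in
theorem card_quad_isotropic_le (hcol : ∀ α, (A.filter fun a => a.1 = α).card ≤ k)
    (Q : Finset (((F × F) × (F × F)) × ((F × F) × (F × F)))) (hQ : ∀ z ∈ Q, IsQuad A z) :
    (Q.filter fun z => nrm z.1.1 z.2.1 = 0).card ≤ 2 * k * A.card ^ 2 := by
  have h1 : (Q.filter fun z => z.1.1.1 = z.2.1.1).card ≤ k * (A ×ˢ A).card := by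
    refine card_le_of_fibers (fun z => z.1) (fun z => z.2.1)
      (fun b => A.filter fun a => a.1 = b.1.1) (fun z hz => ?_) (fun z hz => ?_)
      (fun b _ => hcol _) fun z hz z' hz' => ?_
    · obtain ⟨hz, -⟩ := mem_filter.1 hz
      exact mem_product.2 ⟨(hQ z hz).mem₁₁, (hQ z hz).mem₁₂⟩
    · obtain ⟨hz, h⟩ := mem_filter.1 hz
      exact mem_filter.2 ⟨(hQ z hz).mem₂₁, h.symm⟩
    · exact (hQ z (mem_filter.1 hz).1).eq_of_left (hQ z' (mem_filter.1 hz').1)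
  have h2 : (Q.filter fun z => z.1.1.2 = z.2.1.2).card ≤ k * (A ×ˢ A).card := by
    refine card_le_of_fibers (fun z => z.1) (fun z => z.2.2)
      (fun b => A.filter fun a => a.1 = b.2.1) (fun z hz => ?_) (fun z hz => ?_)
      (fun b _ => hcol _) fun z hz z' hz' => ?_
    · obtain ⟨hz, -⟩ := mem_filter.1 hz
      exact mem_product.2 ⟨(hQ z hz).mem₁₁, (hQ z hz).mem₁₂⟩
    · obtain ⟨hz, h⟩ := mem_filter.1 hz
      exact mem_filter.2 ⟨(hQ z hz).mem₂₂, by rw [(hQ z hz).axis₁.1, (hQ z hz).axis₂.1, h]⟩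
    · exact (hQ z (mem_filter.1 hz).1).eq_of_left' (hQ z' (mem_filter.1 hz').1)
  calc (Q.filter fun z => nrm z.1.1 z.2.1 = 0).card
      ≤ ((Q.filter fun z => z.1.1.1 = z.2.1.1) ∪ Q.filter fun z => z.1.1.2 = z.2.1.2).card := by
        refine card_le_card fun z hz => ?_
        obtain ⟨hz, h⟩ := mem_filter.1 hz
        rw [mem_union, mem_filter, mem_filter]
        rcases mul_eq_zero.1 h with h | h
        · exact Or.inl ⟨hz, sub_eq_zero.1 h⟩
        · exact Or.inr ⟨hz, sub_eq_zero.1 h⟩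
    _ ≤ k * (A ×ˢ A).card + k * (A ×ˢ A).card := (card_union_le _ _).trans (add_le_add h1 h2)
    _ = _ := by rw [card_product]; ring

/-- The line of three-space through the points `t` and `t'` contains few points of the
configuration in the plane dual to `s`, for every point `t'` of it. -/
def IsGeneral (A : Finset (F × F)) (k : ℕ) (s t : (F × F) × (F × F)) : Prop :=
  ∀ r, nrm s.1 s.2 = r → ∀ t' : (F × F) × (F × F), nrm t'.1 t'.2 = r → t' ≠ t →
    Inc (pt r s) (pt r t') → ∀ J : Finset ((F × F) × (F × F)),
    (∀ z ∈ J, z.1 ∈ A ∧ z.2 ∈ A ∧ nrm z.1 z.2 = r ∧ Inc (pt r s) (pt r z) ∧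
      Coll (pt r t) (pt r t') (pt r z)) → J.card ≤ k

open scoped Classical in
theorem IsQuad.exists_label (hcol : ∀ α, (A.filter fun a => a.1 = α).card ≤ k) (h : IsQuad A z)
    (h₀ : nrm z.1.1 z.2.1 ≠ 0) (hg : ¬IsGeneral A k (z.1.1, z.2.1) (z.1.2, z.2.2)) :
    ∃ y, Thru (key z.1.1 z.1.2) y ∧ (Rich A k y z.1.1 ∧ Rich A k y z.2.1 ∨
      z.1.1.1 = -y.2.2 ∧ Rich A k y z.2.1 ∨ z.2.1.1 = -y.2.2 ∧ Rich A k y z.1.1) := by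
  unfold IsGeneral at hg
  push Not at hg
  obtain ⟨r, hr, t', ht', hne, hi, J, hJ, hk⟩ := hg
  obtain rfl : nrm z.1.1 z.2.1 = r := hr
  exact Stmt2.exists_label hcol h₀ rfl (h.axis₁.nrm_eq h.axis₂).symm h.axis₁ h.axis₂ h.nonIso₁.1
    h.nonIso₂.1 h.nonIso₁.key_fst_ne_zero ht' hne hi J hJ hk

open scoped Classical in
theorem card_quad_rich_le {m : ℕ} (hcol : ∀ α, (A.filter fun a => a.1 = α).card ≤ k)
    (hcurve : ∀ y h, IsLabel y → Nondeg y h → (A.filter fun a => lev y a = h).card ≤ m)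
    (Q : Finset (((F × F) × (F × F)) × ((F × F) × (F × F)))) (hQ : ∀ z ∈ Q, IsQuad A z)
    (y : F × F × F) :
    (Q.filter fun z => Thru (key z.1.1 z.1.2) y ∧ (Rich A k y z.1.1 ∧ Rich A k y z.2.1 ∨
      z.1.1.1 = -y.2.2 ∧ Rich A k y z.2.1 ∨ z.2.1.1 = -y.2.2 ∧ Rich A k y z.1.1)).card ≤
      m * ((A.filter (Rich A k y)).card + 2 * k) * (A.filter (Rich A k y)).card := by
  set R := A.filter (Rich A k y) with hR
  have h1 : (Q.filter fun z => Thru (key z.1.1 z.1.2) y ∧ Rich A k y z.1.1 ∧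
      Rich A k y z.2.1).card ≤ m * (R ×ˢ R).card := by
    refine card_le_of_fibers (fun z => (z.1.1, z.2.1)) (fun z => z.1.2)
      (fun b => A.filter fun a => lev y a = lev y b.1) (fun z hz => ?_) (fun z hz => ?_)
      (fun b hb => ?_) fun z hz z' hz' h1 h2 => ?_
    · obtain ⟨hz, -, h2, h3⟩ := mem_filter.1 hz
      exact mem_product.2 ⟨mem_filter.2 ⟨(hQ z hz).mem₁₁, h2⟩, mem_filter.2 ⟨(hQ z hz).mem₂₁, h3⟩⟩
    · obtain ⟨hz, h1, -⟩ := mem_filter.1 hz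
      exact mem_filter.2 ⟨(hQ z hz).mem₁₂,
        ((hQ z hz).axis₁.lev_eq (hQ z hz).nonIso₁.key_fst_ne_zero h1).symm⟩
    · have := (mem_filter.1 (mem_product.1 hb).1).2
      exact hcurve _ _ this.1 this.2.1
    · rw [Prod.mk.injEq] at h1
      exact (hQ z (mem_filter.1 hz).1).eq_of_left (hQ z' (mem_filter.1 hz').1)
        (Prod.ext h1.1 h2) h1.2
  have h2 : (Q.filter fun z => Thru (key z.1.1 z.1.2) y ∧ z.1.1.1 = -y.2.2 ∧
      Rich A k y z.2.1).card ≤ (k * m) * R.card := by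
    refine card_le_of_fibers (fun z => z.2.1) (fun z => (z.1.1, z.2.2))
      (fun b => (A.filter fun a => a.1 = -y.2.2) ×ˢ A.filter fun a => lev y a = lev y b)
      (fun z hz => ?_) (fun z hz => ?_) (fun b hb => ?_) fun z hz z' hz' h1 h2 => ?_
    · obtain ⟨hz, -, h2, h3⟩ := mem_filter.1 hz
      exact mem_filter.2 ⟨(hQ z hz).mem₂₁, h3⟩
    · obtain ⟨hz, h1, h2, -⟩ := mem_filter.1 hz
      exact mem_product.2 ⟨mem_filter.2 ⟨(hQ z hz).mem₁₁, h2⟩, mem_filter.2 ⟨(hQ z hz).mem₂₂,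
        ((hQ z hz).axis₂.lev_eq (hQ z hz).nonIso₁.key_fst_ne_zero h1).symm⟩⟩
    · have := (mem_filter.1 hb).2
      rw [card_product]
      exact Nat.mul_le_mul (hcol _) (hcurve _ _ this.1 this.2.1)
    · rw [Prod.mk.injEq] at h2
      exact (hQ z (mem_filter.1 hz).1).eq_of_right (hQ z' (mem_filter.1 hz').1)
        (Prod.ext h1 h2.2) h2.1
  have h3 : (Q.filter fun z => Thru (key z.1.1 z.1.2) y ∧ z.2.1.1 = -y.2.2 ∧
      Rich A k y z.1.1).card ≤ (k * m) * R.card := by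
    refine card_le_of_fibers (fun z => z.1.1) (fun z => (z.2.1, z.1.2))
      (fun b => (A.filter fun a => a.1 = -y.2.2) ×ˢ A.filter fun a => lev y a = lev y b)
      (fun z hz => ?_) (fun z hz => ?_) (fun b hb => ?_) fun z hz z' hz' h1 h2 => ?_
    · obtain ⟨hz, -, h2, h3⟩ := mem_filter.1 hz
      exact mem_filter.2 ⟨(hQ z hz).mem₁₁, h3⟩
    · obtain ⟨hz, h1, h2, -⟩ := mem_filter.1 hz
      exact mem_product.2 ⟨mem_filter.2 ⟨(hQ z hz).mem₂₁, h2⟩, mem_filter.2 ⟨(hQ z hz).mem₁₂,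
        ((hQ z hz).axis₁.lev_eq (hQ z hz).nonIso₁.key_fst_ne_zero h1).symm⟩⟩
    · have := (mem_filter.1 hb).2
      rw [card_product]
      exact Nat.mul_le_mul (hcol _) (hcurve _ _ this.1 this.2.1)
    · rw [Prod.mk.injEq] at h2
      exact (hQ z (mem_filter.1 hz).1).eq_of_left (hQ z' (mem_filter.1 hz').1)
        (Prod.ext h1 h2.2) h2.1
  rw [card_product] at h1
  simp only [and_or_left, filter_or]
  refine (card_union_le _ _).trans ?_
  refine (add_le_add h1 ((card_union_le _ _).trans (add_le_add h2 h3))).trans (le_of_eq ?_)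
  ring

open scoped Classical in
theorem card_quad_not_isGeneral_le [Fintype F] {m τ : ℕ}
    (hcol : ∀ α, (A.filter fun a => a.1 = α).card ≤ k)
    (hcurve : ∀ y h, IsLabel y → Nondeg y h → (A.filter fun a => lev y a = h).card ≤ m)
    (hk : 4 * A.card ≤ k ^ 2)
    (Q : Finset (((F × F) × (F × F)) × ((F × F) × (F × F)))) (hQ : ∀ z ∈ Q, IsQuad A z)
    (hτ : ∀ z ∈ Q, ∀ y, Thru (key z.1.1 z.1.2) y → (A.filter (Rich A k y)).card ≤ τ) :
    (Q.filter fun z => nrm z.1.1 z.2.1 ≠ 0 ∧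
      ¬IsGeneral A k (z.1.1, z.2.1) (z.1.2, z.2.2)).card ≤ 2 * m * (τ + 2 * k) * A.card := by
  let Y : Finset (F × F × F) := univ.filter fun y => (A.filter (Rich A k y)).card ≤ τ
  calc _ ≤ (Y.biUnion fun y => Q.filter fun z => Thru (key z.1.1 z.1.2) y ∧
        (Rich A k y z.1.1 ∧ Rich A k y z.2.1 ∨ z.1.1.1 = -y.2.2 ∧ Rich A k y z.2.1 ∨
          z.2.1.1 = -y.2.2 ∧ Rich A k y z.1.1)).card := by
        refine card_le_card fun z hz => ?_
        obtain ⟨hz, h0, hg⟩ := mem_filter.1 hz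
        obtain ⟨y, hy⟩ := (hQ z hz).exists_label hcol h0 hg
        exact mem_biUnion.2 ⟨y, mem_filter.2 ⟨mem_univ _, hτ z hz y hy.1⟩, mem_filter.2 ⟨hz, hy⟩⟩
    _ ≤ ∑ y ∈ Y, m * (τ + 2 * k) * (A.filter (Rich A k y)).card := by
        refine card_biUnion_le.trans (sum_le_sum fun y hy => ?_)
        refine (card_quad_rich_le hcol hcurve Q hQ y).trans ?_
        have := (mem_filter.1 hy).2
        gcongr
    _ ≤ m * (τ + 2 * k) * (2 * A.card) := by
        rw [← mul_sum]
        gcongr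
        exact (sum_le_sum_of_subset (subset_univ _)).trans (sum_card_rich_le A hk)
    _ = _ := by ring

end Quads

section Triples
variable {F : Type*} [Field F] {A : Finset (F × F)} {k : ℕ}

open scoped Classical in
/-- The pairs of points of `A` at distance `r`. -/
noncomputable def distPairs (A : Finset (F × F)) (r : F) : Finset ((F × F) × (F × F)) :=
  (A ×ˢ A).filter fun s => nrm s.1 s.2 = r

open scoped Classical in
/-- The nondegenerate isosceles triangles `(x, a, b)` with apex `x`. -/
noncomputable def triangles (A : Finset (F × F)) : Finset ((F × F) × ((F × F) × (F × F))) :=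
  (A ×ˢ (A ×ˢ A)).filter fun z => nrm z.2.1 z.1 = nrm z.2.2 z.1 ∧ nrm z.2.1 z.1 ≠ 0

open scoped Classical in
theorem sq_card_distPairs_le (A : Finset (F × F)) (r : F) : (distPairs A r).card ^ 2 ≤
    A.card * ∑ x ∈ A, (A.filter fun a => nrm a x = r).card ^ 2 := by
  have : (distPairs A r).card = ∑ x ∈ A, (A.filter fun a => nrm a x = r).card := by
    simp only [distPairs, card_filter, sum_product_right]
  rw [this]
  exact sq_sum_le_card_mul_sum_sq

open scoped Classical in
theorem sum_card_distPairs_le [Fintype F] (A : Finset (F × F)) :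
    ∑ r ∈ univ.filter (fun r : F => r ≠ 0), (distPairs A r).card ≤ A.card ^ 2 := by
  unfold distPairs
  calc _ ≤ ∑ r : F, ((A ×ˢ A).filter fun s => nrm s.1 s.2 = r).card :=
        sum_le_sum_of_subset (subset_univ _)
    _ = (A ×ˢ A).card := (card_eq_sum_card_fiberwise fun _ _ => mem_univ _).symm
    _ = _ := by rw [card_product, sq]

open scoped Classical in
theorem sum_sq_card_distPairs_le [Fintype F] (A : Finset (F × F)) :
    ∑ r ∈ univ.filter (fun r : F => r ≠ 0), (distPairs A r).card ^ 2 ≤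
      A.card * (triangles A).card := by
  refine (sum_le_sum fun r _ => sq_card_distPairs_le A r).trans (le_of_eq ?_)
  rw [← mul_sum]
  congr 1
  rw [card_eq_sum_card_fiberwise (f := fun z => nrm z.2.1 z.1) (t := univ.filter fun r : F => r ≠ 0)
    (fun z hz => mem_filter.2 ⟨mem_univ _, (mem_filter.1 hz).2.2⟩)]
  refine sum_congr rfl fun r hr => ?_
  rw [triangles, filter_filter, card_filter, sum_product]
  refine sum_congr rfl fun x _ => ?_
  rw [sq, ← card_product, ← card_filter, ← filter_product]
  congr 1
  refine filter_congr fun z _ => ?_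
  have := (mem_filter.1 hr).2
  constructor
  · rintro ⟨h1, h2⟩
    exact ⟨⟨h1.trans h2.symm, h1.trans_ne this⟩, h1⟩
  · rintro ⟨⟨h1, -⟩, h2⟩
    exact ⟨h2, h1.symm.trans h2⟩

open scoped Classical in
theorem card_distPairs_le (A : Finset (F × F)) {r : F} (hr : r ≠ 0) :
    (distPairs A r).card ^ 2 ≤ 3 * A.card ^ 3 := by
  refine (sq_card_distPairs_le A r).trans ?_
  have h1 : ∑ x ∈ A, (A.filter fun a => nrm a x = r).card ^ 2 =
      ∑ z ∈ A ×ˢ A, (A.filter fun x => nrm z.1 x = r ∧ nrm z.2 x = r).card := by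
    simp only [sq, ← card_product, ← filter_product]
    simp only [card_filter]
    exact sum_comm
  have h2 : ∑ z ∈ A ×ˢ A, (A.filter fun x => nrm z.1 x = r ∧ nrm z.2 x = r).card ≤
      3 * A.card ^ 2 := by
    rw [← sum_filter_add_sum_filter_not _ fun z => z.1 = z.2]
    have e1 : ∑ z ∈ (A ×ˢ A).filter (fun z => z.1 = z.2),
        (A.filter fun x => nrm z.1 x = r ∧ nrm z.2 x = r).card ≤ A.card * A.card := by
      refine (sum_le_card_nsmul _ _ _ fun z _ => card_filter_le _ _).trans ?_
      rw [smul_eq_mul]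
      refine Nat.mul_le_mul_right _ (card_le_card_of_injOn Prod.fst (fun z hz => ?_) ?_)
      · exact (mem_product.1 (mem_filter.1 hz).1).1
      · intro z hz z' hz' h
        exact Prod.ext h ((mem_filter.1 hz).2.symm.trans (h.trans (mem_filter.1 hz').2))
    have e2 : ∑ z ∈ (A ×ˢ A).filter (fun z => ¬z.1 = z.2),
        (A.filter fun x => nrm z.1 x = r ∧ nrm z.2 x = r).card ≤ (A ×ˢ A).card * 2 := by
      refine (sum_le_card_nsmul _ _ 2 fun z hz => ?_).trans ?_
      · have hn : ∀ a : F × F, Nondeg (1, -a.2, -a.1) (r - a.1 * a.2) := fun a => by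
          simpa [Nondeg, mul_comm] using hr
        refine card_inter_le (y := (1, -z.1.2, -z.1.1)) (y' := (1, -z.2.2, -z.2.1))
          (Or.inl rfl) (Or.inl rfl) (hn _) (hn _) (fun h => (mem_filter.1 hz).2 ?_) _ fun x hx => ?_
        · have := h.1
          simp only [Prod.mk.injEq, neg_inj, true_and] at this
          exact Prod.ext this.2 this.1
        · obtain ⟨-, h1, h2⟩ := mem_filter.1 hx
          simp only [nrm, lev] at *
          exact ⟨by linear_combination h1, by linear_combination h2⟩
      · rw [smul_eq_mul]
        exact Nat.mul_le_mul_right _ (card_filter_le _ _)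
    rw [card_product] at e2
    linarith
  rw [h1]
  calc A.card * _ ≤ A.card * (3 * A.card ^ 2) := Nat.mul_le_mul_left _ h2
    _ = _ := by ring

open scoped Classical in
theorem card_quad_isGeneral_le_of_nrm (p : ℕ) [CharP F p] (hk : 1 ≤ k) (hkp : 1000 * k ≤ p) {r : F}
    (hr : r ≠ 0) (hp : 10 ^ 6 * (distPairs A r).card ≤ p ^ 2)
    (Q : Finset (((F × F) × (F × F)) × ((F × F) × (F × F)))) (hQ : ∀ z ∈ Q, IsQuad A z) :
    ((Q.filter fun z => nrm z.1.1 z.2.1 = r ∧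
      IsGeneral A k (z.1.1, z.2.1) (z.1.2, z.2.2)).card : ℝ) ≤
      100 * (2 * ((distPairs A r).card * √((distPairs A r).card)) + k * (distPairs A r).card) := by
  obtain ⟨G, hG⟩ : ∃ G : {s // s ∈ distPairs A r} → {s // s ∈ distPairs A r} → Prop,
      ∀ s t, G s t ↔ Inc (pt r s) (pt r t) ∧ IsGeneral A k s t := ⟨_, fun _ _ => Iff.rfl⟩
  have hmem : ∀ s : (F × F) × (F × F), s ∈ distPairs A r ↔
      (s.1 ∈ A ∧ s.2 ∈ A) ∧ nrm s.1 s.2 = r := fun s => by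
    rw [distPairs, mem_filter, mem_product]
  have key := edges_le_of_inc p (X := fun s : {s // s ∈ distPairs A r} => pt r s) (G := G)
    (fun s t h => Subtype.ext (pt_injOn hr ((hmem _).1 s.2).2 ((hmem _).1 t.2).2 h)) hk hkp
    (by rwa [Fintype.card_coe]) (fun s t h => ((hG s t).1 h).1) (fun s t h t' hne hi J hJ => by
      rw [← card_map (Function.Embedding.subtype fun s => s ∈ distPairs A r)]
      refine ((hG s t).1 h).2 r ((hmem _).1 s.2).2 t' ((hmem _).1 t'.2).2
        (fun e => hne (Subtype.ext e)) hi _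
        fun z hz => ?_
      obtain ⟨z, hz', rfl⟩ := mem_map.1 hz
      have := (hmem _).1 z.2
      exact ⟨this.1.1, this.1.2, this.2, hJ z hz'⟩)
  rw [Fintype.card_coe] at key
  refine le_trans ?_ key
  have h1 : (Q.filter fun z => nrm z.1.1 z.2.1 = r ∧
      IsGeneral A k (z.1.1, z.2.1) (z.1.2, z.2.2)).card ≤ edges G univ univ := by
    unfold edges
    have hm : ∀ z ∈ Q.filter fun z => nrm z.1.1 z.2.1 = r ∧
        IsGeneral A k (z.1.1, z.2.1) (z.1.2, z.2.2),
        (z.1.1, z.2.1) ∈ distPairs A r ∧ (z.1.2, z.2.2) ∈ distPairs A r := fun z hz => by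
      obtain ⟨hz, h1, -⟩ := mem_filter.1 hz
      have h := hQ z hz
      exact ⟨(hmem _).2 ⟨⟨h.mem₁₁, h.mem₂₁⟩, h1⟩, (hmem _).2 ⟨⟨h.mem₁₂, h.mem₂₂⟩,
        (h.axis₁.nrm_eq h.axis₂).symm.trans h1⟩⟩
    refine le_trans (card_le_card fun z hz => ?_) (card_image_le
      (f := fun e : {s // s ∈ distPairs A r} × {s // s ∈ distPairs A r} =>
        ((e.1.1.1, e.2.1.1), (e.1.1.2, e.2.1.2))))
    refine mem_image.2 ⟨(⟨_, (hm z hz).1⟩, ⟨_, (hm z hz).2⟩), ?_, rfl⟩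
    rw [mem_filter]
    refine ⟨?_, (hG _ _).2 ⟨?_, ?_⟩⟩
    · exact mem_product.2 ⟨mem_univ _, mem_univ _⟩
    · obtain ⟨hz, h1, -⟩ := mem_filter.1 hz
      exact (hQ z hz).axis₁.inc (hQ z hz).axis₂ hr h1
    · exact (mem_filter.1 hz).2.2
  exact_mod_cast h1

open scoped Classical in
theorem card_quad_isGeneral_le [Fintype F] (p : ℕ) [CharP F p] (hk : 1 ≤ k) (hkp : 1000 * k ≤ p)
    (hp : 3 * 10 ^ 12 * A.card ^ 3 ≤ p ^ 4)
    (Q : Finset (((F × F) × (F × F)) × ((F × F) × (F × F)))) (hQ : ∀ z ∈ Q, IsQuad A z) :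
    ((Q.filter fun z => nrm z.1.1 z.2.1 ≠ 0 ∧
      IsGeneral A k (z.1.1, z.2.1) (z.1.2, z.2.2)).card : ℝ) ≤
      200 * √((A.card : ℝ) ^ 3 * (triangles A).card) + 100 * k * (A.card : ℝ) ^ 2 := by
  have h1 : (Q.filter fun z => nrm z.1.1 z.2.1 ≠ 0 ∧
      IsGeneral A k (z.1.1, z.2.1) (z.1.2, z.2.2)).card =
      ∑ r ∈ univ.filter (fun r : F => r ≠ 0), (Q.filter fun z => nrm z.1.1 z.2.1 = r ∧
        IsGeneral A k (z.1.1, z.2.1) (z.1.2, z.2.2)).card := by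
    rw [card_eq_sum_card_fiberwise (f := fun z => nrm z.1.1 z.2.1)
      (t := univ.filter fun r : F => r ≠ 0)
      (fun z hz => mem_filter.2 ⟨mem_univ _, (mem_filter.1 hz).2.1⟩)]
    refine sum_congr rfl fun r hr => ?_
    rw [filter_filter]
    congr 1
    refine filter_congr fun z _ => ?_
    have := (mem_filter.1 hr).2
    constructor
    · rintro ⟨⟨-, h1⟩, h2⟩
      exact ⟨h2, h1⟩
    · rintro ⟨h1, h2⟩
      exact ⟨⟨h1.trans_ne this, h2⟩, h1⟩
  rw [h1]
  push_cast
  have h2 : ∀ r ∈ univ.filter (fun r : F => r ≠ 0), ((Q.filter fun z => nrm z.1.1 z.2.1 = r ∧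
        IsGeneral A k (z.1.1, z.2.1) (z.1.2, z.2.2)).card : ℝ) ≤
      200 * (√((distPairs A r).card) * (distPairs A r).card) + 100 * k * (distPairs A r).card := by
    intro r hr
    have hr := (mem_filter.1 hr).2
    have h3 := card_distPairs_le A hr
    refine (card_quad_isGeneral_le_of_nrm p hk hkp hr ?_ Q hQ).trans (le_of_eq (by ring))
    refine (Nat.pow_le_pow_iff_left two_ne_zero).1 ?_
    nlinarith
  refine (sum_le_sum h2).trans ?_
  rw [sum_add_distrib, ← mul_sum, ← mul_sum]
  have h3 : (∑ r ∈ univ.filter (fun r : F => r ≠ 0), ((distPairs A r).card : ℝ)) ≤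
      (A.card : ℝ) ^ 2 := by exact_mod_cast sum_card_distPairs_le A
  have h4 : (∑ r ∈ univ.filter (fun r : F => r ≠ 0), ((distPairs A r).card : ℝ) ^ 2) ≤
      A.card * (triangles A).card := by exact_mod_cast sum_sq_card_distPairs_le A
  gcongr
  apply Real.le_sqrt_of_sq_le
  refine (sum_mul_sq_le_sq_mul_sq _ _ _).trans ?_
  simp only [Real.sq_sqrt (Nat.cast_nonneg _)]
  refine (mul_le_mul h3 h4 (by positivity) (by positivity)).trans (le_of_eq (by ring))

end Triples

section Main
variable {F : Type*} [Field F] {A : Finset (F × F)} {k : ℕ}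

open scoped Classical in
theorem card_quad_le [Fintype F] (p : ℕ) [CharP F p] {m τ : ℕ}
    (hcol : ∀ α, (A.filter fun a => a.1 = α).card ≤ k)
    (hcurve : ∀ y h, IsLabel y → Nondeg y h → (A.filter fun a => lev y a = h).card ≤ m)
    (hk : 1 ≤ k) (hkA : 4 * A.card ≤ k ^ 2) (hkp : 1000 * k ≤ p)
    (hp : 3 * 10 ^ 12 * A.card ^ 3 ≤ p ^ 4)
    (Q : Finset (((F × F) × (F × F)) × ((F × F) × (F × F)))) (hQ : ∀ z ∈ Q, IsQuad A z)
    (hτ : ∀ z ∈ Q, ∀ y, Thru (key z.1.1 z.1.2) y → (A.filter (Rich A k y)).card ≤ τ) :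
    (Q.card : ℝ) ≤ 102 * k * (A.card : ℝ) ^ 2 + 200 * √((A.card : ℝ) ^ 3 * (triangles A).card) +
      2 * m * (τ + 2 * k) * A.card := by
  have h1 : ((Q.filter fun z => nrm z.1.1 z.2.1 = 0).card : ℝ) ≤ 2 * k * (A.card : ℝ) ^ 2 := by
    exact_mod_cast card_quad_isotropic_le hcol Q hQ
  have h2 := card_quad_isGeneral_le p hk hkp hp Q hQ
  have h3 : ((Q.filter fun z => nrm z.1.1 z.2.1 ≠ 0 ∧
      ¬IsGeneral A k (z.1.1, z.2.1) (z.1.2, z.2.2)).card : ℝ) ≤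
      2 * m * (τ + 2 * k) * A.card := by
    exact_mod_cast card_quad_not_isGeneral_le hcol hcurve hkA Q hQ hτ
  have h4 : Q.card ≤ (Q.filter fun z => nrm z.1.1 z.2.1 = 0).card +
      ((Q.filter fun z => nrm z.1.1 z.2.1 ≠ 0 ∧
        IsGeneral A k (z.1.1, z.2.1) (z.1.2, z.2.2)).card +
      (Q.filter fun z => nrm z.1.1 z.2.1 ≠ 0 ∧
        ¬IsGeneral A k (z.1.1, z.2.1) (z.1.2, z.2.2)).card) := by
    rw [← filter_filter, ← filter_filter, card_filter_add_card_filter_not,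
      card_filter_add_card_filter_not]
  have h5 : (Q.card : ℝ) ≤ (Q.filter fun z => nrm z.1.1 z.2.1 = 0).card +
      ((Q.filter fun z => nrm z.1.1 z.2.1 ≠ 0 ∧
        IsGeneral A k (z.1.1, z.2.1) (z.1.2, z.2.2)).card +
      (Q.filter fun z => nrm z.1.1 z.2.1 ≠ 0 ∧
        ¬IsGeneral A k (z.1.1, z.2.1) (z.1.2, z.2.2)).card) := by exact_mod_cast h4
  linarith

open scoped Classical in
theorem card_triangles_thru_le {y : F × F × F} (hy : IsLabel y) :
    ((triangles A).filter fun z => z.2.1 ≠ z.2.2 ∧ Thru (key z.2.1 z.2.2) y).card ≤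
      2 * A.card ^ 2 := by
  have hmem : ∀ z ∈ triangles A, (z.1 ∈ A ∧ z.2.1 ∈ A ∧ z.2.2 ∈ A) ∧
      nrm z.2.1 z.1 = nrm z.2.2 z.1 ∧ nrm z.2.1 z.1 ≠ 0 := fun z hz => by
    rw [triangles, mem_filter, mem_product, mem_product] at hz
    exact hz
  have h1 : ((triangles A).filter fun z => y = (1, -z.1.2, -z.1.1)).card ≤ (A ×ˢ A).card := by
    refine card_le_card_of_injOn Prod.snd (fun z hz => ?_) fun z hz z' hz' h => ?_
    · have := hmem z (mem_filter.1 hz).1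
      exact mem_product.2 this.1.2
    · have h1 := (mem_filter.1 hz).2.symm.trans (mem_filter.1 hz').2
      simp only [Prod.mk.injEq, neg_inj, true_and] at h1
      exact Prod.ext (Prod.ext h1.2 h1.1) h
  have h2 : ((triangles A).filter fun z => y ≠ (1, -z.1.2, -z.1.1) ∧ z.2.1 ≠ z.2.2 ∧
      Thru (key z.2.1 z.2.2) y).card ≤ (A ×ˢ A).card := by
    refine card_le_card_of_injOn (fun z => (z.1, z.2.1)) (fun z hz => ?_) fun z hz z' hz' h => ?_
    · have := hmem z (mem_filter.1 hz).1
      exact mem_product.2 ⟨this.1.1, this.1.2.1⟩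
    · obtain ⟨hz, hne, hab, ht⟩ := mem_filter.1 hz
      obtain ⟨hz', hne', hab', ht'⟩ := mem_filter.1 hz'
      obtain ⟨-, h1, h2⟩ := hmem z hz
      obtain ⟨-, h1', h2'⟩ := hmem z' hz'
      have hn := nonIso_of_nrm hab h1 h2
      have hn' := nonIso_of_nrm hab' h1' h2'
      obtain ⟨hx, ha⟩ := Prod.mk.inj h
      rw [hn.nrm_eq_iff] at h1
      rw [hn'.nrm_eq_iff, ← hx] at h1'
      have hκ := Thru.unique hy (Or.inl rfl) hne ht h1 ht' h1'
      have h3 := hn'.axis_key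
      rw [← hκ, ← ha] at h3
      exact Prod.ext hx (Prod.ext ha (hn.axis_key.right_unique hn.key_fst_ne_zero h3))
  rw [card_product] at h1 h2
  calc _ ≤ (((triangles A).filter fun z => y = (1, -z.1.2, -z.1.1)) ∪
        (triangles A).filter fun z => y ≠ (1, -z.1.2, -z.1.1) ∧ z.2.1 ≠ z.2.2 ∧
          Thru (key z.2.1 z.2.2) y).card := by
        refine card_le_card fun z hz => ?_
        obtain ⟨hz, h⟩ := mem_filter.1 hz
        rw [mem_union, mem_filter, mem_filter]
        by_cases h1 : y = (1, -z.1.2, -z.1.1)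
        · exact Or.inl ⟨hz, h1⟩
        · exact Or.inr ⟨hz, h1, h⟩
    _ ≤ A.card * A.card + A.card * A.card := (card_union_le _ _).trans (add_le_add h1 h2)
    _ = _ := by ring

open scoped Classical in
theorem card_triangles_le [Fintype F] (p : ℕ) [CharP F p] {m τ : ℕ} {S : Finset (F × F)}
    (hAS : A ⊆ S) (hS : S.card = p ^ 2)
    (hbis : ∀ a ∈ A, ∀ b ∈ A, NonIso a b →
      (S.filter fun x => Thru (key a b) (1, -x.2, -x.1)).card = p)
    (hcol : ∀ α, (A.filter fun a => a.1 = α).card ≤ k)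
    (hcurve : ∀ y h, IsLabel y → Nondeg y h → (A.filter fun a => lev y a = h).card ≤ m)
    (hk : 1 ≤ k) (hkA : 4 * A.card ≤ k ^ 2) (hkp : 1000 * k ≤ p)
    (hp : 3 * 10 ^ 12 * A.card ^ 3 ≤ p ^ 4) :
    ∃ N : ℕ, N * τ ≤ 2 * A.card ∧ ((triangles A).card : ℝ) ≤
      (A.card : ℝ) ^ 2 + N * (2 * A.card ^ 2) + (A.card : ℝ) * (A.card : ℝ) ^ 2 / p +
      √(p * A.card * (102 * k * (A.card : ℝ) ^ 2 +
        200 * √((A.card : ℝ) ^ 3 * (triangles A).card) + 2 * m * (τ + 2 * k) * A.card)) := by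
  let Y : Finset (F × F × F) := univ.filter fun y => τ < (A.filter (Rich A k y)).card
  have hY : ∀ y ∈ Y, IsLabel y := fun y hy => by
    obtain ⟨a, ha⟩ := card_pos.1 ((Nat.zero_le _).trans_lt (mem_filter.1 hy).2)
    exact (mem_filter.1 ha).2.1
  let P := (A ×ˢ A).filter fun c => NonIso c.1 c.2 ∧ ∀ y ∈ Y, ¬Thru (key c.1 c.2) y
  have hP : ∀ c ∈ P, (c.1 ∈ A ∧ c.2 ∈ A) ∧ NonIso c.1 c.2 ∧ ∀ y ∈ Y, ¬Thru (key c.1 c.2) y :=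
    fun c hc => by
      rw [mem_filter, mem_product] at hc
      exact hc
  have hPc : P.card ≤ A.card ^ 2 := (card_filter_le _ _).trans (by rw [card_product, sq])
  have hp0 : 0 < p := by omega
  have hmem : ∀ z ∈ triangles A, (z.1 ∈ A ∧ z.2.1 ∈ A ∧ z.2.2 ∈ A) ∧
      nrm z.2.1 z.1 = nrm z.2.2 z.1 ∧ nrm z.2.1 z.1 ≠ 0 := fun z hz => by
    rw [triangles, mem_filter, mem_product, mem_product] at hz
    exact hz
  have t1 : ((triangles A).filter fun z => z.2.1 = z.2.2).card ≤ A.card ^ 2 := by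
    rw [sq, ← card_product]
    refine card_le_card_of_injOn (fun z => (z.1, z.2.1)) (fun z hz => ?_) fun z hz z' hz' h => ?_
    · have := hmem z (mem_filter.1 hz).1
      exact mem_product.2 ⟨this.1.1, this.1.2.1⟩
    · obtain ⟨h1, h2⟩ := Prod.mk.inj h
      exact Prod.ext h1 (Prod.ext h2
        ((mem_filter.1 hz).2.symm.trans (h2.trans (mem_filter.1 hz').2)))
  have t2 : (Y.biUnion fun y => (triangles A).filter fun z => z.2.1 ≠ z.2.2 ∧
      Thru (key z.2.1 z.2.2) y).card ≤ Y.card * (2 * A.card ^ 2) :=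
    card_biUnion_le.trans ((sum_le_card_nsmul _ _ _ fun y hy =>
      card_triangles_thru_le (hY y hy)).trans (le_of_eq (smul_eq_mul _ _)))
  have t3 : ((triangles A).filter fun z => z.2 ∈ P).card ≤
      ∑ x ∈ A, (P.filter fun c => Thru (key c.1 c.2) (1, -x.2, -x.1)).card := by
    rw [← card_sigma]
    refine card_le_card_of_injOn (fun z => ⟨z.1, z.2⟩) (fun z hz => ?_) fun z hz z' hz' h => ?_
    · obtain ⟨hz, hzP⟩ := mem_filter.1 hz
      obtain ⟨h1, h2, -⟩ := hmem z hz
      exact mem_sigma.2 ⟨h1.1, mem_filter.2 ⟨hzP, (hP _ hzP).2.1.nrm_eq_iff.1 h2⟩⟩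
    · simp only [Sigma.mk.injEq, heq_eq_eq] at h
      exact Prod.ext h.1 h.2
  have t4 : (triangles A).card ≤ A.card ^ 2 + Y.card * (2 * A.card ^ 2) +
      ∑ x ∈ A, (P.filter fun c => Thru (key c.1 c.2) (1, -x.2, -x.1)).card := by
    refine le_trans (card_le_card (t := (((triangles A).filter fun z => z.2.1 = z.2.2) ∪
      (Y.biUnion fun y => (triangles A).filter fun z => z.2.1 ≠ z.2.2 ∧
        Thru (key z.2.1 z.2.2) y)) ∪ (triangles A).filter fun z => z.2 ∈ P) fun z hz => ?_)
      ((card_union_le _ _).trans (add_le_add ((card_union_le _ _).trans (add_le_add t1 t2)) t3))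
    by_cases h1 : z.2.1 = z.2.2
    · exact mem_union_left _ (mem_union_left _ (mem_filter.2 ⟨hz, h1⟩))
    by_cases h2 : ∃ y ∈ Y, Thru (key z.2.1 z.2.2) y
    · obtain ⟨y, hy, h2⟩ := h2
      exact mem_union_left _ (mem_union_right _ (mem_biUnion.2 ⟨y, hy, mem_filter.2 ⟨hz, h1, h2⟩⟩))
    · push Not at h2
      obtain ⟨h3, h4, h5⟩ := hmem z hz
      exact mem_union_right _ (mem_filter.2 ⟨hz, mem_filter.2 ⟨mem_product.2 h3.2,
        nonIso_of_nrm h1 h4 h5, h2⟩⟩)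
  refine ⟨Y.card, ?_, ?_⟩
  · refine le_trans ?_ (sum_card_rich_le A hkA)
    refine le_trans ?_ (sum_le_sum_of_subset (subset_univ Y))
    rw [← smul_eq_mul]
    exact card_nsmul_le_sum _ _ _ fun y hy => (mem_filter.1 hy).2.le
  · have t5 := sum_incidence_le hAS hp0 hS P (fun c => key c.1 c.2)
      (fun κ x => Thru κ (1, -x.2, -x.1))
      (fun c hc => hbis _ (hP c hc).1.1 _ (hP c hc).1.2 (hP c hc).2.1)
      (fun c _ c' _ hne => card_le_one.2 fun x hx x' hx' => by
        by_contra hxx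
        obtain ⟨-, h1, h2⟩ := mem_filter.1 hx
        obtain ⟨-, h3, h4⟩ := mem_filter.1 hx'
        refine hne (Thru.unique (Or.inl rfl) (Or.inl rfl) (fun h => hxx ?_) h1 h3 h2 h4)
        simp only [Prod.mk.injEq, neg_inj, true_and] at h
        exact Prod.ext h.2 h.1)
    have t6 := card_quad_le p hcol hcurve hk hkA hkp hp
      ((P ×ˢ P).filter fun z => key z.1.1 z.1.2 = key z.2.1 z.2.2) (τ := τ)
      (fun z hz => by
        obtain ⟨hz, h⟩ := mem_filter.1 hz
        obtain ⟨h1, h2⟩ := mem_product.1 hz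
        exact ⟨(hP _ h1).1.1, (hP _ h1).1.2, (hP _ h2).1.1, (hP _ h2).1.2, (hP _ h1).2.1,
          (hP _ h2).2.1, h⟩)
      (fun z hz y hy => by
        by_contra h
        have h1 := (mem_product.1 (mem_filter.1 hz).1).1
        exact (hP _ h1).2.2 y (mem_filter.2 ⟨mem_univ _, not_le.1 h⟩) hy)
    have t7 : ((triangles A).card : ℝ) ≤ (A.card : ℝ) ^ 2 + Y.card * (2 * A.card ^ 2) +
        ((∑ x ∈ A, (P.filter fun c => Thru (key c.1 c.2) (1, -x.2, -x.1)).card : ℕ) : ℝ) := by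
      exact_mod_cast t4
    have t8 : (P.card : ℝ) ≤ (A.card : ℝ) ^ 2 := by exact_mod_cast hPc
    refine t7.trans ?_
    rw [add_assoc _ (_ / _)]
    refine add_le_add le_rfl (t5.trans ?_)
    gcongr

theorem le_of_sqrt_bound {T G : ℝ} (hG : 0 < G)
    (h : T ≤ 6 * G + √(354 * G ^ 2 + 200 * √(G ^ 3 * T))) : T ≤ 100 * G := by
  by_contra! hT
  have hT0 : 0 < T := by linarith
  have h1 : √(G ^ 3 * T) ≤ T ^ 2 / 1000 := by
    apply Real.sqrt_le_iff.2 ⟨by positivity, ?_⟩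
    have : G ^ 3 ≤ (T / 100) ^ 3 := by gcongr; linarith
    calc G ^ 3 * T ≤ (T / 100) ^ 3 * T := by gcongr
      _ = (T ^ 2 / 1000) ^ 2 := by ring
  have h2 : √(354 * G ^ 2 + 200 * √(G ^ 3 * T)) ≤ T / 2 := by
    apply Real.sqrt_le_iff.2 ⟨by positivity, ?_⟩
    have : G ^ 2 ≤ (T / 100) ^ 2 := by gcongr; linarith
    nlinarith
  linarith

end Main

theorem pow_three_le_of_bound {n p k T N τ : ℝ} (hp : 1 ≤ p) (hpn : p ≤ n) (hnp : n ^ 4 ≤ p ^ 5)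
    (hk : 1 ≤ k) (hk₁ : p * n ≤ k ^ 3) (hk₂ : k ^ 3 ≤ 27 * (p * n)) (hN : 0 ≤ N)
    (hT₀ : 0 ≤ T) (hτ₁ : k * n ≤ p * τ) (hτ₂ : p * τ ≤ k * n + p) (hNτ : N * τ ≤ 2 * n)
    (hT : T ≤ n ^ 2 + N * (2 * n ^ 2) + n * n ^ 2 / p +
      √(p * n * (102 * k * n ^ 2 + 200 * √(n ^ 3 * T) + 2 * (2 * p) * (τ + 2 * k) * n))) :
    T ^ 3 ≤ 10 ^ 6 * (p ^ 2 * n ^ 5) := by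
  have hp0 : 0 < p := by linarith
  have hn0 : 0 < n := by linarith
  have hk0 : 0 < k := by linarith
  obtain ⟨G, hG0, hG⟩ : ∃ G : ℝ, 0 < G ∧ G ^ 3 = p ^ 2 * n ^ 5 := by
    refine ⟨(p ^ 2 * n ^ 5) ^ ((1 : ℝ) / 3), by positivity, ?_⟩
    rw [← Real.rpow_natCast, ← Real.rpow_mul (by positivity)]
    norm_num
  have cube : ∀ {x y : ℝ}, 0 ≤ y → x ^ 3 ≤ y ^ 3 → x ≤ y := fun hy h =>
    le_of_pow_le_pow_left₀ three_ne_zero hy h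
  have g1 : n ^ 2 ≤ G := by
    apply cube hG0.le
    have : n ≤ p ^ 2 := by
      refine le_of_pow_le_pow_left₀ (n := 4) (by norm_num) (by positivity) (hnp.trans ?_)
      rw [← pow_mul]
      exact pow_le_pow_right₀ hp (by norm_num)
    rw [hG]
    calc (n ^ 2) ^ 3 = n * n ^ 5 := by ring
      _ ≤ _ := by gcongr
  have g2 : n * n ^ 2 / p ≤ G := by
    apply cube hG0.le
    rw [hG, div_pow, div_le_iff₀ (by positivity)]
    calc (n * n ^ 2) ^ 3 = n ^ 4 * n ^ 5 := by ring
      _ ≤ p ^ 5 * n ^ 5 := by gcongr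
      _ = _ := by ring
  have g3 : p * n ^ 2 / k ≤ G := by
    apply cube hG0.le
    rw [hG, div_pow, div_le_iff₀ (by positivity)]
    calc (p * n ^ 2) ^ 3 = p ^ 2 * n ^ 5 * (p * n) := by ring
      _ ≤ _ := by gcongr
  have g4 : N * n ^ 2 ≤ 2 * G := by
    have h1 : N * k ≤ 2 * p := by
      have : N * k * n ≤ 2 * p * n := by
        calc N * k * n = N * (k * n) := by ring
          _ ≤ N * (p * τ) := by gcongr
          _ = p * (N * τ) := by ring
          _ ≤ p * (2 * n) := by gcongr
          _ = _ := by ring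
      exact le_of_mul_le_mul_right this hn0
    calc N * n ^ 2 ≤ 2 * (p * n ^ 2 / k) := by
          rw [← mul_div_assoc, le_div_iff₀ hk0]
          nlinarith [sq_nonneg n]
      _ ≤ 2 * G := by gcongr
  have g5 : p * k * n ^ 3 ≤ 3 * G ^ 2 := by
    apply cube (by positivity)
    calc (p * k * n ^ 3) ^ 3 = p ^ 3 * k ^ 3 * n ^ 9 := by ring
      _ ≤ p ^ 3 * (27 * (p * n)) * n ^ 9 := by gcongr
      _ = 27 * (p ^ 2 * n ^ 5) ^ 2 := by ring
      _ = _ := by rw [← hG]; ring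
  have g6 : p * n * √(n ^ 3 * T) = √(G ^ 3 * T) := by
    rw [hG, show p ^ 2 * n ^ 5 * T = (p * n) ^ 2 * (n ^ 3 * T) by ring,
      Real.sqrt_mul (sq_nonneg (p * n)), Real.sqrt_sq (by positivity)]
  have g7 : 2 * (2 * p) * (τ + 2 * k) * n ≤ 16 * k * n ^ 2 := by
    have h1 : p ≤ k * n := by nlinarith
    have h2 : p * k ≤ n * k := by gcongr
    have h3 : 2 * (2 * p) * (τ + 2 * k) ≤ 16 * k * n := by nlinarith
    nlinarith
  have hTG : T ≤ 100 * G := by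
    refine le_of_sqrt_bound hG0 (hT.trans ?_)
    refine add_le_add (by linarith) (Real.sqrt_le_sqrt ?_)
    have : p * n * (2 * (2 * p) * (τ + 2 * k) * n) ≤ p * n * (16 * k * n ^ 2) := by gcongr
    nlinarith
  calc T ^ 3 ≤ (100 * G) ^ 3 := by gcongr
    _ = 10 ^ 6 * G ^ 3 := by ring
    _ = _ := by rw [hG]

open scoped Classical in
theorem card_triangles_pow_three_le {F : Type*} [Field F] [Fintype F] {A S : Finset (F × F)}
    {k : ℕ} (p : ℕ) [CharP F p] (hAS : A ⊆ S) (hS : S.card = p ^ 2)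
    (hbis : ∀ a ∈ A, ∀ b ∈ A, NonIso a b →
      (S.filter fun x => Thru (key a b) (1, -x.2, -x.1)).card = p)
    (hcol : ∀ α, (A.filter fun a => a.1 = α).card ≤ k)
    (hcurve : ∀ y h, IsLabel y → Nondeg y h → (A.filter fun a => lev y a = h).card ≤ 2 * p)
    (hk : 1 ≤ k) (hkA : 4 * A.card ≤ k ^ 2) (hkp : 1000 * k ≤ p)
    (hp : 3 * 10 ^ 12 * A.card ^ 3 ≤ p ^ 4) (hpn : p ≤ A.card) (hnp : A.card ^ 4 ≤ p ^ 5)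
    (hk₁ : p * A.card ≤ k ^ 3) (hk₂ : k ^ 3 ≤ 27 * (p * A.card)) :
    ((triangles A).card : ℝ) ^ 3 ≤ 10 ^ 6 * ((p : ℝ) ^ 2 * (A.card : ℝ) ^ 5) := by
  have hp1 : 1 ≤ p := by omega
  have hp0 : (0 : ℝ) < p := by exact_mod_cast hp1
  obtain ⟨N, hN, hT⟩ := card_triangles_le (τ := ⌈(k * A.card : ℝ) / p⌉₊) p hAS hS hbis hcol hcurve
    hk hkA hkp hp
  refine pow_three_le_of_bound (k := k) (N := N) (τ := ⌈(k * A.card : ℝ) / p⌉₊)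
    (by exact_mod_cast hp1) (by exact_mod_cast hpn) (by exact_mod_cast hnp) (by exact_mod_cast hk)
    (by exact_mod_cast hk₁) (by exact_mod_cast hk₂) (Nat.cast_nonneg _) (Nat.cast_nonneg _) ?_ ?_
    (by exact_mod_cast hN) (by push_cast at hT; exact hT)
  · rw [← div_le_iff₀' hp0]
    exact Nat.le_ceil _
  · have := (Nat.ceil_lt_add_one (show 0 ≤ (k * A.card : ℝ) / p by positivity)).le
    calc (p : ℝ) * _ ≤ p * (k * A.card / p + 1) := by gcongr
      _ = _ := by field_simp

section Isotropic
variable {K F : Type*} [Field K] [Field F] (φ : K →+* F) {i : F}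

/-- Isotropic coordinates on the plane `K²`, with values in an extension `F` of `K`. -/
def iso (φ : K →+* F) (i : F) (x : K × K) : F × F := (φ x.1 + i * φ x.2, φ x.1 - i * φ x.2)

theorem nrm_iso (hi : i * i = -1) (a x : K × K) :
    nrm (iso φ i a) (iso φ i x) = φ (dist2 a x) := by
  simp only [nrm, iso, dist2, map_add, map_sub, map_pow]
  linear_combination -(φ a.2 - φ x.2) ^ 2 * hi

theorem ne_zero_of_mul_self (hi : i * i = -1) : i ≠ 0 := by
  rintro rfl
  simp at hi

theorem iso_injective (hi : i * i = -1) (h2 : (2 : F) ≠ 0) : Function.Injective (iso φ i) := by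
  intro x y h
  simp only [iso, Prod.mk.injEq] at h
  obtain ⟨h₁, h₃⟩ := h
  refine Prod.ext (φ.injective (mul_left_cancel₀ h2 ?_))
    (φ.injective (mul_left_cancel₀ (mul_ne_zero h2 (ne_zero_of_mul_self hi)) ?_))
  · linear_combination h₁ + h₃
  · linear_combination h₁ - h₃

theorem card_line_eq [Fintype K] [DecidableEq K] {u v c : K} (h : ¬(u = 0 ∧ v = 0)) :
    (univ.filter fun x : K × K => u * x.1 + v * x.2 = c).card = Fintype.card K := by
  rw [← card_univ]
  by_cases hv : v = 0
  · have hu : u ≠ 0 := fun hu => h ⟨hu, hv⟩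
    refine card_bij' (fun x _ => x.2) (fun t _ => (c / u, t)) ?_ ?_ ?_ ?_
    · simp
    · intro t _
      simp [hv, mul_div_cancel₀ _ hu]
    · intro x hx
      have := (mem_filter.1 hx).2
      refine Prod.ext ?_ rfl
      rw [div_eq_iff hu]
      rw [hv] at this
      linear_combination -this
    · simp
  · refine card_bij' (fun x _ => x.1) (fun t _ => (t, (c - u * t) / v)) ?_ ?_ ?_ ?_
    · simp
    · intro t _
      simp [mul_div_cancel₀ _ hv]
    · intro x hx
      have := (mem_filter.1 hx).2
      refine Prod.ext rfl ?_
      rw [div_eq_iff hv]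
      linear_combination -this
    · simp

theorem card_dist2_eq_dist2 [Fintype K] [DecidableEq K] (h2 : (2 : K) ≠ 0) {a b : K × K}
    (h : a ≠ b) :
    (univ.filter fun x : K × K => dist2 a x = dist2 b x).card = Fintype.card K := by
  rw [← card_line_eq (u := 2 * (b.1 - a.1)) (v := 2 * (b.2 - a.2))
    (c := b.1 ^ 2 + b.2 ^ 2 - a.1 ^ 2 - a.2 ^ 2)]
  · congr 1
    refine filter_congr fun x _ => ?_
    simp only [dist2]
    constructor <;> intro h <;> linear_combination h
  · rintro ⟨h3, h4⟩
    exact h (Prod.ext (sub_eq_zero.1 ((mul_eq_zero.1 h3).resolve_left h2)).symm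
      (sub_eq_zero.1 ((mul_eq_zero.1 h4).resolve_left h2)).symm)

open scoped Classical in
theorem card_iso_bisector [Fintype K] (hi : i * i = -1) (h2 : (2 : F) ≠ 0) {a b : K × K}
    (h : NonIso (iso φ i a) (iso φ i b)) :
    ((univ.image (iso φ i)).filter fun x =>
      Thru (key (iso φ i a) (iso φ i b)) (1, -x.2, -x.1)).card = Fintype.card K := by
  rw [filter_image, card_image_of_injective _ (iso_injective φ hi h2),
    ← card_dist2_eq_dist2 (a := a) (b := b)]
  · congr 1
    refine filter_congr fun x _ => ?_
    rw [← h.nrm_eq_iff, nrm_iso φ hi, nrm_iso φ hi, φ.injective.eq_iff]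
  · intro h
    exact h2 (by rw [← map_ofNat φ 2, h, map_zero])
  · rintro rfl
    exact h.1 rfl

open scoped Classical in
theorem card_iso_curve_le [Fintype K] (hi : i * i = -1) (h2 : (2 : F) ≠ 0) {y : F × F × F} {h : F}
    (hy : IsLabel y) :
    (univ.filter fun x : K × K => lev y (iso φ i x) = h).card ≤ 2 * Fintype.card K := by
  have hi0 := ne_zero_of_mul_self hi
  have hlev : ∀ x : K × K, lev y (iso φ i x) = y.1 * φ x.2 ^ 2 +
      i * (y.2.1 - y.2.2) * φ x.2 + (y.1 * φ x.1 ^ 2 + (y.2.1 + y.2.2) * φ x.1) := fun x => by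
    simp only [lev, iso]
    linear_combination -y.1 * φ x.2 ^ 2 * hi
  rw [← card_univ]
  by_cases hd : y.1 = 0 ∧ y.2.1 = y.2.2
  · have h21 : y.2.1 = 1 := by
      rcases hy with h3 | h3
      · exact absurd (h3.symm.trans hd.1) one_ne_zero
      · exact h3.2
    refine (card_le_card_of_injOn Prod.snd (fun _ _ => mem_univ _) fun x hx x' hx' e => ?_).trans
      (Nat.le_mul_of_pos_left _ two_pos)
    have e1 := (mem_filter.1 hx).2
    have e2 := (mem_filter.1 hx').2
    rw [hlev, hd.1, ← hd.2, h21] at e1 e2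
    refine Prod.ext (φ.injective (mul_left_cancel₀ h2 ?_)) e
    linear_combination e1 - e2
  · refine card_le_of_fibers (fun x => x.1) (fun x => φ x.2) (fun b =>
      (Polynomial.C y.1 * Polynomial.X ^ 2 + Polynomial.C (i * (y.2.1 - y.2.2)) * Polynomial.X +
        Polynomial.C (y.1 * φ b ^ 2 + (y.2.1 + y.2.2) * φ b - h)).roots.toFinset)
      (fun _ _ => mem_univ _) (fun x hx => ?_) (fun b _ => ?_)
      (fun x _ x' _ e1 e2 => Prod.ext e1 (φ.injective e2))
    · rw [Multiset.mem_toFinset, Polynomial.mem_roots', Polynomial.IsRoot.def]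
      refine ⟨fun h0 => ?_, ?_⟩
      · generalize y.1 * φ x.1 ^ 2 + (y.2.1 + y.2.2) * φ x.1 - h = c at h0
        refine hd ⟨?_, ?_⟩
        · simpa using congrArg (fun q => Polynomial.coeff q 2) h0
        · have := congrArg (fun q => Polynomial.coeff q 1) h0
          simpa [hi0, sub_eq_zero, Polynomial.coeff_X] using this
      · have := (mem_filter.1 hx).2
        rw [hlev] at this
        simp only [Polynomial.eval_add, Polynomial.eval_mul, Polynomial.eval_C,
          Polynomial.eval_pow, Polynomial.eval_X]
        linear_combination this
    · exact (Multiset.toFinset_card_le _).trans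
        ((Polynomial.card_roots' _).trans Polynomial.natDegree_quadratic_le)

open scoped Classical in
theorem card_iso_snd_le [Fintype K] (hi : i * i = -1) (β : F) :
    (univ.filter fun x : K × K => (iso φ i x).2 = β).card ≤ Fintype.card K := by
  rw [← card_univ]
  refine card_le_card_of_injOn Prod.fst (fun _ _ => mem_univ _) fun x hx x' hx' e => ?_
  have e1 := (mem_filter.1 hx).2
  have e2 := (mem_filter.1 hx').2
  have e3 : φ x.1 = φ x'.1 := congrArg φ e
  simp only [iso] at e1 e2
  refine Prod.ext e (φ.injective (mul_left_cancel₀ (ne_zero_of_mul_self hi) ?_))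
  linear_combination e2 - e1 + e3

end Isotropic

/-- A set whose points are determined by two coordinates has a large part on which the fibres of
one of them are small. -/
theorem exists_small_fibers {α β : Type*} [DecidableEq β] (A : Finset α) (f g : α → β)
    (hfg : ∀ a ∈ A, ∀ b ∈ A, f a = f b → g a = g b → a = b) {k : ℕ} (hk : 4 * A.card ≤ k ^ 2) :
    3 * A.card ≤ 8 * (A.filter fun a => (A.filter fun b => f b = f a).card ≤ k).card ∨
      3 * A.card ≤ 8 * (A.filter fun a => (A.filter fun b => g b = g a).card ≤ k).card := by
  classical
  have rich : ∀ f : α → β,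
      ((A.filter fun a => k < (A.filter fun b => f b = f a).card).image f).card * k ≤ A.card := by
    intro f
    calc _ ≤ ∑ c ∈ (A.filter fun a => k < (A.filter fun b => f b = f a).card).image f,
          (A.filter fun b => f b = c).card := by
          rw [← smul_eq_mul]
          refine card_nsmul_le_sum _ _ _ fun c hc => ?_
          obtain ⟨a, ha, rfl⟩ := mem_image.1 hc
          exact (mem_filter.1 ha).2.le
      _ ≤ ∑ c ∈ A.image f, (A.filter fun b => f b = c).card :=
          sum_le_sum_of_subset (image_subset_image (filter_subset _ _))
      _ = A.card := (card_eq_sum_card_image f A).symm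
  have hf := card_filter_add_card_filter_not (s := A)
    fun a => (A.filter fun b => f b = f a).card ≤ k
  have hg := card_filter_add_card_filter_not (s := A)
    fun a => (A.filter fun b => g b = g a).card ≤ k
  simp only [not_le] at hf hg
  have h1 := card_union_add_card_inter (A.filter fun a => k < (A.filter fun b => f b = f a).card)
    (A.filter fun a => k < (A.filter fun b => g b = g a).card)
  have h2 : ((A.filter fun a => k < (A.filter fun b => f b = f a).card) ∪
      A.filter fun a => k < (A.filter fun b => g b = g a).card).card ≤ A.card :=
    card_le_card (union_subset (filter_subset _ _) (filter_subset _ _))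
  have h3 : ((A.filter fun a => k < (A.filter fun b => f b = f a).card) ∩
      A.filter fun a => k < (A.filter fun b => g b = g a).card).card ≤
      ((A.filter fun a => k < (A.filter fun b => f b = f a).card).image f).card *
      ((A.filter fun a => k < (A.filter fun b => g b = g a).card).image g).card := by
    rw [← card_product]
    refine card_le_card_of_injOn (fun a => (f a, g a)) (fun a ha => ?_) fun a ha b hb e => ?_
    · obtain ⟨h4, h5⟩ := mem_inter.1 ha
      exact mem_product.2 ⟨mem_image_of_mem f h4, mem_image_of_mem g h5⟩
    · obtain ⟨e1, e2⟩ := Prod.mk.inj e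
      exact hfg a (mem_filter.1 (mem_inter.1 ha).1).1 b (mem_filter.1 (mem_inter.1 hb).1).1 e1 e2
  have h6 := Nat.mul_le_mul (rich f) (rich g)
  set r := ((A.filter fun a => k < (A.filter fun b => f b = f a).card).image f).card
  set s := ((A.filter fun a => k < (A.filter fun b => g b = g a).card).image g).card
  have h7 : 4 * (r * s) ≤ A.card := by
    rcases A.card.eq_zero_or_pos with h0 | h0
    · rw [h0] at h6 ⊢
      rcases Nat.eq_zero_or_pos k with hk0 | hk0
      · have : ∀ f : α → β, ((A.filter fun a => k < (A.filter fun b => f b = f a).card).image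
            f).card = 0 := by simp [card_eq_zero.1 h0]
        simp only [r, this, zero_mul, mul_zero, le_refl]
      · have : r * s = 0 := by
          have : r * s * (k * k) ≤ 0 := by linarith
          have h8 : 0 < k * k := by positivity
          exact (Nat.mul_eq_zero.1 (Nat.le_zero.1 this)).resolve_right h8.ne'
        omega
    · refine Nat.le_of_mul_le_mul_right ?_ h0
      calc 4 * (r * s) * A.card = r * s * (4 * A.card) := by ring
        _ ≤ r * s * k ^ 2 := Nat.mul_le_mul_left _ hk
        _ = r * k * (s * k) := by ring
        _ ≤ _ := h6
  omega

theorem sq_card_le_card_image_mul {α β : Type*} [DecidableEq β] (s : Finset α) (f : α → β) :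
    s.card ^ 2 ≤ (s.image f).card * ((s ×ˢ s).filter fun z => f z.1 = f z.2).card := by
  have h1 : ((s ×ˢ s).filter fun z => f z.1 = f z.2).card =
      ∑ c ∈ s.image f, (s.filter fun a => f a = c).card ^ 2 := by
    rw [card_eq_sum_card_fiberwise (f := fun z => f z.1) (t := s.image f)
      fun z hz => mem_image_of_mem f (mem_product.1 (mem_filter.1 hz).1).1]
    refine sum_congr rfl fun c _ => ?_
    rw [sq, ← card_product, ← filter_product, filter_filter]
    congr 1
    refine filter_congr fun z _ => ?_
    constructor
    · rintro ⟨h1, h2⟩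
      exact ⟨h2, h1.symm.trans h2⟩
    · rintro ⟨h1, h2⟩
      exact ⟨h1.trans h2.symm, h1⟩
  rw [h1, card_eq_sum_card_image f s]
  exact sq_sum_le_card_mul_sum_sq

open scoped Classical in
theorem card_pow_three_le {F : Type*} [Field F] {A : Finset (F × F)} {D : ℕ}
    (hD : ∀ x ∈ A, (A.image fun a => nrm a x).card ≤ D)
    (h : ∀ x ∈ A, A.card ≤ 4 * (A.filter fun a => nrm a x ≠ 0).card) :
    A.card ^ 3 ≤ 16 * (D * (triangles A).card) := by
  have h1 : (triangles A).card = ∑ x ∈ A, (((A.filter fun a => nrm a x ≠ 0) ×ˢ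
      (A.filter fun a => nrm a x ≠ 0)).filter fun z => nrm z.1 x = nrm z.2 x).card := by
    rw [triangles, card_filter, sum_product]
    refine sum_congr rfl fun x _ => ?_
    rw [← card_filter, ← filter_product, filter_filter]
    congr 1
    refine filter_congr fun z _ => ?_
    constructor
    · rintro ⟨h1, h2⟩
      exact ⟨⟨h2, h1 ▸ h2⟩, h1⟩
    · rintro ⟨⟨h1, -⟩, h2⟩
      exact ⟨h2, h1⟩
  calc A.card ^ 3 = ∑ x ∈ A, A.card ^ 2 := by rw [sum_const, smul_eq_mul]; ring
    _ ≤ ∑ x ∈ A, 16 * (D * (((A.filter fun a => nrm a x ≠ 0) ×ˢ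
      (A.filter fun a => nrm a x ≠ 0)).filter fun z => nrm z.1 x = nrm z.2 x).card) := by
        refine sum_le_sum fun x hx => ?_
        have h2 := sq_card_le_card_image_mul (A.filter fun a => nrm a x ≠ 0) fun a => nrm a x
        have h3 : ((A.filter fun a => nrm a x ≠ 0).image fun a => nrm a x).card ≤ D :=
          (card_le_card (image_subset_image (filter_subset _ _))).trans (hD x hx)
        calc A.card ^ 2 ≤ (4 * (A.filter fun a => nrm a x ≠ 0).card) ^ 2 :=
              Nat.pow_le_pow_left (h x hx) 2
          _ = 16 * (A.filter fun a => nrm a x ≠ 0).card ^ 2 := by ring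
          _ ≤ _ := Nat.mul_le_mul_left _ (h2.trans (Nat.mul_le_mul_right _ h3))
    _ = _ := by rw [h1, mul_sum, mul_sum]

open scoped Classical in
theorem pow_four_le_of_small_columns {K F : Type*} [Field K] [Fintype K] [Field F] [Fintype F]
    (φ : K →+* F) {i : F} (hi : i * i = -1) (h2 : (2 : F) ≠ 0) (p : ℕ) [CharP F p]
    (hK : Fintype.card K = p) {B : Finset (K × K)} {k D : ℕ}
    (hcol : ∀ a ∈ B, (B.filter fun b => (iso φ i b).1 = (iso φ i a).1).card ≤ k)
    (hD : ∀ x ∈ B, (B.image fun a => dist2 a x).card ≤ D)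
    (hk : 1 ≤ k) (hkB : 4 * B.card ≤ k ^ 2) (hkp : 1000 * k ≤ p)
    (hp : 3 * 10 ^ 12 * B.card ^ 3 ≤ p ^ 4) (hpn : 3 * p ≤ 2 * B.card) (hnp : B.card ^ 4 ≤ p ^ 5)
    (hk₁ : p * B.card ≤ k ^ 3) (hk₂ : k ^ 3 ≤ 27 * (p * B.card)) :
    B.card ^ 4 ≤ 10 ^ 10 * (D ^ 3 * p ^ 2) := by
  have hinj := iso_injective φ hi h2
  have hc : (B.image (iso φ i)).card = B.card := card_image_of_injective _ hinj
  have hcol' : ∀ α, ((B.image (iso φ i)).filter fun a => a.1 = α).card ≤ k := fun α => by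
    rw [filter_image, card_image_of_injective _ hinj]
    rcases (B.filter fun b => (iso φ i b).1 = α).eq_empty_or_nonempty with h0 | ⟨a, ha⟩
    · rw [h0]; simp
    · obtain ⟨ha', rfl⟩ := mem_filter.1 ha
      exact hcol a ha'
  have hsub : B.image (iso φ i) ⊆ univ.image (iso φ i) := image_subset_image (subset_univ _)
  have hT := card_triangles_pow_three_le (A := B.image (iso φ i)) (S := univ.image (iso φ i))
    (k := k) p hsub
    (by rw [card_image_of_injective _ hinj, card_univ, Fintype.card_prod, hK, sq])
    (fun a ha b hb hab => by
      obtain ⟨a, -, rfl⟩ := mem_image.1 ha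
      obtain ⟨b, -, rfl⟩ := mem_image.1 hb
      rw [card_iso_bisector φ hi h2 hab, hK])
    hcol'
    (fun y h hy _ => by
      refine (card_le_card (filter_subset_filter _ hsub)).trans ?_
      rw [filter_image, card_image_of_injective _ hinj, ← hK]
      exact card_iso_curve_le φ hi h2 hy)
    hk (by rwa [hc]) hkp (by rwa [hc]) (by rw [hc]; omega) (by rwa [hc]) (by rwa [hc])
    (by rwa [hc])
  have hL := card_pow_three_le (A := B.image (iso φ i)) (D := D)
    (fun x hx => by
      obtain ⟨x, hx', rfl⟩ := mem_image.1 hx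
      refine le_trans (le_of_eq ?_) (hD x hx')
      rw [← card_image_of_injective _ φ.injective, image_image, image_image]
      congr 1
      exact image_congr fun a _ => nrm_iso φ hi a x)
    (fun x hx => by
      have h3 := card_filter_add_card_filter_not (s := B.image (iso φ i)) fun a => nrm a x = 0
      have h4 : ((B.image (iso φ i)).filter fun a => nrm a x = 0).card ≤ k + p := by
        refine le_trans (card_le_card (t := ((B.image (iso φ i)).filter fun a => a.1 = x.1) ∪
          (univ.image (iso φ i)).filter fun a => a.2 = x.2) fun a ha => ?_)
          ((card_union_le _ _).trans (add_le_add (hcol' _) ?_))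
        · obtain ⟨ha, h0⟩ := mem_filter.1 ha
          rcases mul_eq_zero.1 h0 with h0 | h0
          · exact mem_union_left _ (mem_filter.2 ⟨ha, sub_eq_zero.1 h0⟩)
          · exact mem_union_right _ (mem_filter.2 ⟨hsub ha, sub_eq_zero.1 h0⟩)
        · rw [filter_image, card_image_of_injective _ hinj, ← hK]
          exact card_iso_snd_le φ hi _
      rw [hc] at h3 ⊢
      change B.card ≤ 4 * ((B.image (iso φ i)).filter fun a => ¬nrm a x = 0).card
      omega)
  rw [hc] at hT hL
  set T := (triangles (B.image (iso φ i))).card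
  have hT' : T ^ 3 ≤ 10 ^ 6 * (p ^ 2 * B.card ^ 5) := by exact_mod_cast hT
  have hB : 0 < B.card := by omega
  refine Nat.le_of_mul_le_mul_right ?_ (show 0 < B.card ^ 5 by positivity)
  calc B.card ^ 4 * B.card ^ 5 = (B.card ^ 3) ^ 3 := by ring
    _ ≤ (16 * (D * T)) ^ 3 := Nat.pow_le_pow_left hL 3
    _ = 4096 * D ^ 3 * T ^ 3 := by ring
    _ ≤ 4096 * D ^ 3 * (10 ^ 6 * (p ^ 2 * B.card ^ 5)) := Nat.mul_le_mul_left _ hT'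
    _ = 4096 * 10 ^ 6 * (D ^ 3 * p ^ 2 * B.card ^ 5) := by ring
    _ ≤ 10 ^ 10 * (D ^ 3 * p ^ 2 * B.card ^ 5) := Nat.mul_le_mul_right _ (by norm_num)
    _ = _ := by ring

theorem exists_pow_three_between {m : ℕ} (hm : 1 ≤ m) : ∃ k, 1 ≤ k ∧ m ≤ k ^ 3 ∧ k ^ 3 ≤ 8 * m := by
  have hex : ∃ k, m ≤ k ^ 3 := ⟨m, Nat.le_self_pow three_ne_zero m⟩
  classical
  refine ⟨Nat.find hex, ?_, Nat.find_spec hex, ?_⟩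
  · rw [Nat.one_le_iff_ne_zero]
    intro h
    have := Nat.find_spec hex
    rw [h] at this
    omega
  · obtain ⟨j, hj⟩ | h : (∃ j, Nat.find hex = j + 2) ∨ Nat.find hex < 2 := by
      by_cases h : Nat.find hex < 2
      · exact Or.inr h
      · exact Or.inl ⟨Nat.find hex - 2, by omega⟩
    · have h1 := Nat.find_min hex (show j + 1 < Nat.find hex by omega)
      rw [hj]
      calc (j + 2) ^ 3 ≤ (2 * (j + 1)) ^ 3 := Nat.pow_le_pow_left (by omega) 3
        _ = 8 * (j + 1) ^ 3 := by ring
        _ ≤ 8 * m := by omega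
    · calc Nat.find hex ^ 3 ≤ 1 ^ 3 := Nat.pow_le_pow_left (by omega) 3
        _ ≤ _ := by omega

theorem exists_mul_self_eq_neg_one (p : ℕ) [Fact p.Prime] (hp : p ≠ 2) :
    ∃ i : GaloisField p 2, i * i = -1 := by
  let _ := Fintype.ofFinite (GaloisField p 2)
  have h : IsSquare (-1 : GaloisField p 2) := by
    rw [FiniteField.isSquare_neg_one_iff, ← Nat.card_eq_fintype_card,
      GaloisField.card p 2 two_ne_zero, sq, Nat.mul_mod]
    have := (Nat.Prime.eq_two_or_odd (Fact.out : p.Prime)).resolve_left hp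
    have h4 : p % 4 = 1 ∨ p % 4 = 3 := by omega
    rcases h4 with h | h <;> rw [h] <;> norm_num
  obtain ⟨i, hi⟩ := h
  exact ⟨i, hi.symm⟩

open scoped Classical in
theorem card_image_le_pinnedMax {F : Type*} [CommRing F] {A B : Finset (F × F)} (h : B ⊆ A)
    {x : F × F} (hx : x ∈ A) : (B.image fun a => dist2 a x).card ≤ pinnedMax A := by
  refine le_trans ?_ (le_sup (f := fun x => pinnedCount A x) hx)
  rw [pinnedCount, ← coe_image, Set.ncard_coe_finset]
  exact card_le_card (image_subset_image h)

theorem one_le_pinnedMax {F : Type*} [CommRing F] {A : Finset (F × F)} {x : F × F} (hx : x ∈ A) :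
    1 ≤ pinnedMax A := by
  classical
  refine le_trans (Nat.one_le_iff_ne_zero.2 ?_) (card_image_le_pinnedMax subset_rfl hx)
  exact (card_pos.2 (Nonempty.image ⟨x, hx⟩ _)).ne'

theorem pow_four_le_of_large (p : ℕ) [Fact p.Prime] (hp : 10 ^ 50 ≤ p)
    (A : Finset (ZMod p × ZMod p)) (h₁ : 4 * p ≤ A.card) (h₂ : A.card ^ 4 ≤ p ^ 5) :
    A.card ^ 4 ≤ 10 ^ 12 * (pinnedMax A ^ 3 * p ^ 2) := by
  classical
  have hp2 : p ≠ 2 := by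
    rintro rfl
    norm_num at hp
  obtain ⟨i, hi⟩ := exists_mul_self_eq_neg_one p hp2
  let _ := Fintype.ofFinite (GaloisField p 2)
  have h2 : (2 : GaloisField p 2) ≠ 0 := Ring.two_ne_zero (by rwa [ringChar.eq _ p])
  let φ := algebraMap (ZMod p) (GaloisField p 2)
  obtain ⟨k, hk, hk₁, hk₂⟩ := exists_pow_three_between (m := p * A.card)
    (Nat.mul_pos (by omega) (by omega))
  have root : ∀ {a b m : ℕ}, m ≠ 0 → a ^ m ≤ b ^ m → a ≤ b := fun hm h =>
    (Nat.pow_le_pow_iff_left hm).1 h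
  have big : ∀ c, c ≤ 10 ^ 50 → c ≤ p := fun c hc => hc.trans hp
  have e1 : 64 * A.card ≤ p ^ 2 := by
    refine root four_ne_zero ?_
    calc (64 * A.card) ^ 4 = 2 ^ 24 * A.card ^ 4 := by ring
      _ ≤ p * p ^ 5 := Nat.mul_le_mul (big _ (by norm_num)) h₂
      _ = p ^ 6 := by ring
      _ ≤ p ^ 8 := Nat.pow_le_pow_right (by omega) (by norm_num)
      _ = _ := by ring
  have e2 : 4 * A.card ≤ k ^ 2 := by
    refine root three_ne_zero ?_
    calc (4 * A.card) ^ 3 = 64 * A.card * A.card ^ 2 := by ring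
      _ ≤ p ^ 2 * A.card ^ 2 := Nat.mul_le_mul_right _ e1
      _ = (p * A.card) ^ 2 := by ring
      _ ≤ (k ^ 3) ^ 2 := Nat.pow_le_pow_left hk₁ 2
      _ = _ := by ring
  have e3 : 8 * 10 ^ 9 * A.card ≤ p ^ 2 := by
    refine root four_ne_zero ?_
    calc (8 * 10 ^ 9 * A.card) ^ 4 = (8 * 10 ^ 9) ^ 4 * A.card ^ 4 := by ring
      _ ≤ p * p ^ 5 := Nat.mul_le_mul (big _ (by norm_num)) h₂
      _ = p ^ 6 := by ring
      _ ≤ p ^ 8 := Nat.pow_le_pow_right (by omega) (by norm_num)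
      _ = _ := by ring
  have e4 : 1000 * k ≤ p := by
    refine root three_ne_zero ?_
    calc (1000 * k) ^ 3 = 10 ^ 9 * k ^ 3 := by ring
      _ ≤ 10 ^ 9 * (8 * (p * A.card)) := Nat.mul_le_mul_left _ hk₂
      _ = p * (8 * 10 ^ 9 * A.card) := by ring
      _ ≤ p * p ^ 2 := Nat.mul_le_mul_left _ e3
      _ = _ := by ring
  have e5 : 3 * 10 ^ 12 * A.card ^ 3 ≤ p ^ 4 := by
    refine root four_ne_zero ?_
    calc (3 * 10 ^ 12 * A.card ^ 3) ^ 4 = (3 * 10 ^ 12) ^ 4 * (A.card ^ 4) ^ 3 := by ring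
      _ ≤ p * (p ^ 5) ^ 3 := Nat.mul_le_mul (big _ (by norm_num)) (Nat.pow_le_pow_left h₂ 3)
      _ = _ := by ring
  have main : ∀ j : GaloisField p 2, j * j = -1 →
      3 * A.card ≤ 8 * (A.filter fun a =>
        (A.filter fun b => (iso φ j b).1 = (iso φ j a).1).card ≤ k).card →
      A.card ^ 4 ≤ 10 ^ 12 * (pinnedMax A ^ 3 * p ^ 2) := by
    intro j hj hc
    set B := A.filter fun a => (A.filter fun b => (iso φ j b).1 = (iso φ j a).1).card ≤ k with hB
    have hBA : B ⊆ A := filter_subset _ _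
    have hBc : B.card ≤ A.card := card_le_card hBA
    have key := pow_four_le_of_small_columns (B := B) (D := pinnedMax A) φ hj h2 p (ZMod.card p)
      (fun a ha => (card_le_card (filter_subset_filter _ hBA)).trans (mem_filter.1 ha).2)
      (fun x hx => by
        convert card_image_le_pinnedMax hBA (hBA hx))
      hk ((Nat.mul_le_mul_left _ hBc).trans e2) e4
      ((Nat.mul_le_mul_left _ (Nat.pow_le_pow_left hBc 3)).trans e5) (by omega)
      ((Nat.pow_le_pow_left hBc 4).trans h₂) ((Nat.mul_le_mul_left _ hBc).trans hk₁)
      (hk₂.trans (by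
        have := Nat.mul_le_mul_left p hc
        nlinarith))
    refine Nat.le_of_mul_le_mul_left ?_ (show 0 < 3 ^ 4 by norm_num)
    calc 3 ^ 4 * A.card ^ 4 = (3 * A.card) ^ 4 := by ring
      _ ≤ (8 * B.card) ^ 4 := Nat.pow_le_pow_left hc 4
      _ = 4096 * B.card ^ 4 := by ring
      _ ≤ 4096 * (10 ^ 10 * (pinnedMax A ^ 3 * p ^ 2)) := Nat.mul_le_mul_left _ key
      _ ≤ 3 ^ 4 * (10 ^ 12 * (pinnedMax A ^ 3 * p ^ 2)) := by omega
  have hneg : -i * -i = -1 := by rw [neg_mul_neg, hi]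
  rcases exists_small_fibers A (fun a => (iso φ i a).1) (fun a => (iso φ i a).2)
    (fun a _ b _ e1 e2 => iso_injective φ hi h2 (Prod.ext e1 e2)) e2 with h | h
  · exact main i hi h
  · refine main (-i) hneg ?_
    have : ∀ x, (iso φ (-i) x).1 = (iso φ i x).2 := fun x => by
      simp only [iso]; ring
    simp only [this]
    exact h

theorem rpow_bound {n p D : ℝ} (hn : 0 ≤ n) (hp : 0 < p) (hD : 0 ≤ D) {C : ℝ} (hC : 0 < C)
    (h : n ^ 4 ≤ C ^ 3 * (D ^ 3 * p ^ 2)) :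
    C⁻¹ * n ^ ((4 : ℝ) / 3) * p ^ (-((2 : ℝ) / 3)) ≤ D := by
  refine le_of_pow_le_pow_left₀ three_ne_zero hD ?_
  have h1 : (n ^ ((4 : ℝ) / 3)) ^ 3 = n ^ 4 := by
    rw [← Real.rpow_natCast, ← Real.rpow_mul hn, ← Real.rpow_natCast]
    norm_num
  have h2 : (p ^ (-((2 : ℝ) / 3))) ^ 3 = (p ^ 2)⁻¹ := by
    rw [← Real.rpow_natCast, ← Real.rpow_mul hp.le, ← Real.rpow_natCast p 2, ← Real.rpow_neg hp.le]
    norm_num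
  rw [mul_pow, mul_pow, h1, h2, inv_pow, ← div_eq_mul_inv, div_le_iff₀ (by positivity),
    inv_mul_le_iff₀ (by positivity)]
  exact h

end

/-- Pinned distances over `F_p`, intermediate range: there is an absolute constant `c > 0` such
that for every prime `p` and every `A ⊆ F_p²` with `4p < |A| < p^(5/4)` we have
`Δ_pin(A) ≥ c·|A|^(4/3)·p^(-2/3)`. -/
theorem pinned_distances_Fp :
    ∃ c : ℝ, 0 < c ∧
      ∀ p : ℕ, p.Prime →
        ∀ A : Finset (ZMod p × ZMod p),
          4 * (p : ℝ) < (A.card : ℝ) →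
          (A.card : ℝ) < (p : ℝ) ^ ((5 : ℝ) / 4) →
          c * (A.card : ℝ) ^ ((4 : ℝ) / 3) * (p : ℝ) ^ (-((2 : ℝ) / 3)) ≤ (pinnedMax A : ℝ) := by
  refine ⟨(10 ^ 50)⁻¹, by positivity, fun p hp A h₁ h₂ => ?_⟩
  have : Fact p.Prime := ⟨hp⟩
  have hp0 : (0 : ℝ) < p := by exact_mod_cast hp.pos
  have h₁' : 4 * p < A.card := by exact_mod_cast h₁
  have h₂' : A.card ^ 4 ≤ p ^ 5 := by
    have : (A.card : ℝ) ^ 4 ≤ ((p : ℝ) ^ ((5 : ℝ) / 4)) ^ 4 := by gcongr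
    rw [← Real.rpow_natCast ((p : ℝ) ^ ((5 : ℝ) / 4)), ← Real.rpow_mul hp0.le] at this
    norm_num at this
    exact_mod_cast this
  refine rpow_bound (Nat.cast_nonneg _) hp0 (Nat.cast_nonneg _) (by positivity) ?_
  suffices h : A.card ^ 4 ≤ (10 ^ 50) ^ 3 * (pinnedMax A ^ 3 * p ^ 2) by exact_mod_cast h
  rcases le_total (10 ^ 50) p with h | h
  · exact (pow_four_le_of_large p h A h₁'.le h₂').trans (Nat.mul_le_mul_right _ (by norm_num))
  · obtain ⟨x, hx⟩ := Finset.card_pos.1 ((Nat.zero_le _).trans_lt h₁')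
    have h1 : 1 ≤ pinnedMax A := one_le_pinnedMax hx
    calc A.card ^ 4 ≤ p ^ 3 * (1 ^ 3 * p ^ 2) := h₂'.trans (le_of_eq (by ring))
      _ ≤ _ := Nat.mul_le_mul (Nat.pow_le_pow_left h 3)
        (Nat.mul_le_mul_right _ (Nat.pow_le_pow_left h1 3))

end Stmt2
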